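/- arXiv:1411.2790 — 2 statements merged into one kernel-verified Lean document; each statement's English description precedes it below -/
import Mathlib

section
/- Let k be a field with char k ≠ 2, a ∈ k^×, ε ∈ {1, −1}, and let G = ⟨τ, λ, σ⟩ be the group of k-automorphisms of k(x1,x2,x3) (isomorphic to the alternating group A4) defined by τ: x1 ↦ a/x1, x2 ↦ εa/x2, x3 ↦ εx3; λ: x1 ↦ εa/x1, x2 ↦ εx2, x3 ↦ a/x3; σ: x1 ↦ x2, x2 ↦ x3, x3 ↦ x1. Then: (1) if ε = 1, then k(x1,x2,x3)^G is k-rational; (2) if ε = −1 and [k(√a, √−1) : k] ≤ 2, then k(x1,x2,x3)^G is k-rational. -/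
open MvPolynomial Polynomial

noncomputable section

/-- A field extension `K` of `k` is `k`-rational if it is isomorphic, as a `k`-algebra,
to a rational function field `k(x₁, …, xₙ)` in finitely many variables. -/
def IsRational (k K : Type*) [Field k] [Field K] [Algebra k K] : Prop :=
  ∃ n : ℕ, Nonempty (K ≃ₐ[k] FractionRing (MvPolynomial (Fin n) k))

section

universe u

variable {k K : Type u} [Field k] [Field K] [Algebra k K]

/-- The extension `K / F` has degree at most `n`. -/
def DegLE (F : IntermediateField k K) (n : ℕ) : Prop := Module.rank F K ≤ n

theorem DegLE.of_root {F : IntermediateField k K} {m n : ℕ} (θ : K) (p : Polynomial F)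
    (hp : p ≠ 0) (hroot : Polynomial.aeval θ p = 0) (hm : p.natDegree ≤ m)
    (h : ∀ B : IntermediateField k K, F ≤ B → θ ∈ B → DegLE B n) : DegLE F (m * n) := by
  have hθ : IsIntegral F θ := (show IsAlgebraic F θ from ⟨p, hp, hroot⟩).isIntegral
  set L := IntermediateField.adjoin F {θ} with hL
  have h1 : Module.rank L K ≤ n := by
    refine h (L.restrictScalars k) (fun x hx => ?_) (IntermediateField.mem_adjoin_simple_self F θ)
    exact L.algebraMap_mem ⟨x, hx⟩
  have h2 : Module.rank F L ≤ m := by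
    have : FiniteDimensional F L := IntermediateField.adjoin.finiteDimensional hθ
    rw [← Module.finrank_eq_rank, hL, IntermediateField.adjoin.finrank hθ]
    exact_mod_cast (Polynomial.natDegree_le_of_dvd (minpoly.dvd F θ hroot) hp).trans hm
  unfold DegLE
  rw [← rank_mul_rank F L K]
  push_cast
  exact mul_le_mul' h2 h1

theorem DegLE.of_quadratic {F : IntermediateField k K} {n : ℕ} (θ b c : K) (hb : b ∈ F)
    (hc : c ∈ F) (hθ : θ ^ 2 + b * θ + c = 0)
    (h : ∀ B : IntermediateField k K, F ≤ B → θ ∈ B → DegLE B n) : DegLE F (2 * n) := by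
  refine DegLE.of_root θ
    (Polynomial.X ^ 2 + Polynomial.C ⟨b, hb⟩ * Polynomial.X + Polynomial.C ⟨c, hc⟩) ?_ ?_ ?_ h
  · exact Polynomial.Monic.ne_zero (by monicity!)
  · simpa using hθ
  · compute_degree!

theorem DegLE.of_cubic {F : IntermediateField k K} {n : ℕ} (θ b c d : K) (hb : b ∈ F)
    (hc : c ∈ F) (hd : d ∈ F) (hθ : θ ^ 3 + b * θ ^ 2 + c * θ + d = 0)
    (h : ∀ B : IntermediateField k K, F ≤ B → θ ∈ B → DegLE B n) : DegLE F (3 * n) := by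
  refine DegLE.of_root θ (Polynomial.X ^ 3 + Polynomial.C ⟨b, hb⟩ * Polynomial.X ^ 2 +
    Polynomial.C ⟨c, hc⟩ * Polynomial.X + Polynomial.C ⟨d, hd⟩) ?_ ?_ ?_ h
  · exact Polynomial.Monic.ne_zero (by monicity!)
  · simpa using hθ
  · compute_degree!

theorem degLE_top : DegLE (⊤ : IntermediateField k K) 1 := by
  unfold DegLE
  rw [Module.rank_eq_one_iff_finrank_eq_one.2 IntermediateField.finrank_top]
  simp

theorem DegLE.algebraicIndependent (htr : Algebra.trdeg k K = 3) {f : Fin 3 → K} {n : ℕ}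
    (h : DegLE (IntermediateField.adjoin k (Set.range f)) n) : AlgebraicIndependent k f := by
  have hfin : Module.Finite (IntermediateField.adjoin k (Set.range f)) K :=
    Module.rank_lt_aleph0_iff.1 (lt_of_le_of_lt h (Cardinal.natCast_lt_aleph0))
  have halg : Algebra.IsAlgebraic (IntermediateField.adjoin k (Set.range f)) K := inferInstance
  open IntermediateField.algebraAdjoinAdjoin in
  have : Algebra.IsAlgebraic (Algebra.adjoin k (Set.range f)) K :=
    Algebra.IsAlgebraic.trans _ (IntermediateField.adjoin k (Set.range f)) _
  refine (Algebra.IsAlgebraic.isTranscendenceBasis_of_lift_le_trdeg_of_finite k (A := K) f ?_).1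
  rw [htr]; simp

theorem AlgebraicIndependent.ne_zero_of_eval {f : Fin 3 → K} (h : AlgebraicIndependent k f)
    (g : MvPolynomial (Fin 3) k) (v : Fin 3 → k) (hv : MvPolynomial.eval v g ≠ 0) :
    MvPolynomial.aeval f g ≠ 0 := by
  intro h0
  apply hv
  rw [(injective_iff_map_eq_zero _).1 h g h0, map_zero]

theorem twelve_le_natCard (G : Subgroup (K ≃ₐ[k] K)) [Finite G] (τ lam σ : K ≃ₐ[k] K) (hτ : τ ∈ G)
    (hlam : lam ∈ G) (hσ : σ ∈ G) (hτ2 : τ * τ = 1) (hlam2 : lam * lam = 1)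
    (hcomm : τ * lam = lam * τ) (hτ1 : τ ≠ 1) (hlam1 : lam ≠ 1) (hne : τ ≠ lam)
    (hσ3 : σ ^ 3 = 1) (hσ1 : σ ≠ 1) : 12 ≤ Nat.card G := by
  have h3 : 3 ∣ Nat.card G := by
    have : orderOf σ = 3 := by
      have : Fact (Nat.Prime 3) := ⟨Nat.prime_three⟩
      exact orderOf_eq_prime hσ3 hσ1
    rw [← this]
    exact (orderOf_injective G.subtype G.subtype_injective ⟨σ, hσ⟩) ▸ orderOf_dvd_natCard _
  have h4 : 4 ∣ Nat.card G := by
    let V : Subgroup (K ≃ₐ[k] K) :=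
      { carrier := {1, τ, lam, τ * lam}
        one_mem' := by simp
        mul_mem' := by
          have e1 : ∀ x, τ * (τ * x) = x := fun x => by rw [← mul_assoc, hτ2, one_mul]
          have e2 : ∀ x, lam * (lam * x) = x := fun x => by rw [← mul_assoc, hlam2, one_mul]
          have e3 : ∀ x, lam * (τ * x) = τ * (lam * x) := fun x => by
            rw [← mul_assoc, ← hcomm, mul_assoc]
          rintro a b (rfl | rfl | rfl | rfl) (rfl | rfl | rfl | rfl) <;>
            simp [mul_assoc, hτ2, hlam2, e1, e3, ← hcomm]
        inv_mem' := by
          have e1 : τ⁻¹ = τ := inv_eq_of_mul_eq_one_left hτ2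
          have e2 : lam⁻¹ = lam := inv_eq_of_mul_eq_one_left hlam2
          rintro a (rfl | rfl | rfl | rfl) <;> simp [e1, e2, hcomm] }
    have hV : V ≤ G := by
      rintro a (rfl | rfl | rfl | rfl)
      exacts [G.one_mem, hτ, hlam, G.mul_mem hτ hlam]
    have hcard : Nat.card V = 4 := by
      change Nat.card ({1, τ, lam, τ * lam} : Set (K ≃ₐ[k] K)) = 4
      rw [Nat.card_coe_set_eq]
      have n1 : (1 : K ≃ₐ[k] K) ≠ τ * lam := fun h => hne (by
        rw [← mul_one τ, ← hlam2, ← mul_assoc, ← h, one_mul])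
      have n2 : τ ≠ τ * lam := fun h => hlam1 (by simpa using h.symm)
      have n3 : lam ≠ τ * lam := fun h => hτ1 (by simpa using h.symm)
      classical
      rw [Set.ncard_eq_toFinset_card']
      simp [hτ1.symm, hlam1.symm, hne, n1, n2, n3]
    rw [← hcard]
    exact Subgroup.card_dvd_of_le hV
  have h12 : 12 ∣ Nat.card G :=
    Nat.Coprime.mul_dvd_of_dvd_of_dvd (m := 4) (n := 3) (by norm_num) h4 h3
  exact Nat.le_of_dvd Nat.card_pos h12


theorem trdeg_fractionRing : Algebra.trdeg k (FractionRing (MvPolynomial (Fin 3) k)) = 3 := by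
  have : Algebra.IsAlgebraic (MvPolynomial (Fin 3) k) (FractionRing (MvPolynomial (Fin 3) k)) :=
    IsLocalization.isAlgebraic _ (nonZeroDivisors (MvPolynomial (Fin 3) k))
  rw [← trdeg_add_eq k (MvPolynomial (Fin 3) k),
    trdeg_eq_zero (R := MvPolynomial (Fin 3) k)]
  simp

theorem isRational_fixedField_closure (htr : Algebra.trdeg k K = 3) (τ lam σ : K ≃ₐ[k] K)
    (hτ2 : τ * τ = 1) (hlam2 : lam * lam = 1)
    (hcomm : τ * lam = lam * τ) (hτ1 : τ ≠ 1) (hlam1 : lam ≠ 1) (hne : τ ≠ lam)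
    (hσ3 : σ ^ 3 = 1) (hσ1 : σ ≠ 1) (f : Fin 3 → K)
    (hf : ∀ i, τ (f i) = f i ∧ lam (f i) = f i ∧ σ (f i) = f i)
    (hdeg : DegLE (IntermediateField.adjoin k (Set.range f)) 12) :
    IsRational k (IntermediateField.fixedField (Subgroup.closure {τ, lam, σ})) := by
  set G := Subgroup.closure {τ, lam, σ} with hG
  set M := IntermediateField.fixedField G with hM
  set F := IntermediateField.adjoin k (Set.range f) with hF
  have hFM : F ≤ M := by
    rw [hF, IntermediateField.adjoin_le_iff, hM]
    rintro _ ⟨i, rfl⟩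
    have : G ≤ MulAction.stabilizer (K ≃ₐ[k] K) (f i) := by
      rw [hG, Subgroup.closure_le]
      rintro g (rfl | rfl | rfl)
      exacts [(hf i).1, (hf i).2.1, (hf i).2.2]
    exact fun g => this g.2
  have hfinF : Module.Finite F K :=
    Module.rank_lt_aleph0_iff.1 (lt_of_le_of_lt hdeg (Cardinal.natCast_lt_aleph0))
  have hrel := IntermediateField.relrank_mul_rank_top hFM
  have hfinM : Module.Finite M K := by
    refine Module.rank_lt_aleph0_iff.1 (lt_of_le_of_lt ?_ (Cardinal.natCast_lt_aleph0 (n := 12)))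
    refine le_trans ?_ hdeg
    rw [← hrel]
    refine le_mul_of_one_le_left' ?_
    rw [Cardinal.one_le_iff_ne_zero]
    intro h0
    rw [h0, zero_mul] at hrel
    exact rank_pos.ne hrel
  have hGM : G ≤ M.fixingSubgroup := (IntermediateField.le_iff_le G M).1 le_rfl
  have hfinfix : Finite M.fixingSubgroup := Finite.of_equiv _ M.fixingSubgroupEquiv.symm.toEquiv
  have h12 : 12 ≤ Module.finrank M K := by
    have h1 := twelve_le_natCard M.fixingSubgroup τ lam σ
      (hGM (Subgroup.subset_closure (by simp))) (hGM (Subgroup.subset_closure (by simp)))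
      (hGM (Subgroup.subset_closure (by simp))) hτ2 hlam2 hcomm hτ1 hlam1 hne hσ3 hσ1
    rw [Nat.card_congr M.fixingSubgroupEquiv.toEquiv, Nat.card_eq_fintype_card] at h1
    exact h1.trans AlgEquiv.card_le
  have hMF : M = F := by
    refine le_antisymm ?_ hFM
    rw [← IntermediateField.relfinrank_eq_one_iff]
    have h := IntermediateField.relfinrank_mul_finrank_top hFM
    have hF12 : Module.finrank F K ≤ 12 := by
      have := hdeg
      unfold DegLE at this
      rw [← Module.finrank_eq_rank] at this
      exact_mod_cast this
    have hpos : 0 < Module.finrank F K := Module.finrank_pos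
    nlinarith [Nat.pos_of_ne_zero (fun h0 => by simp [h0] at h; omega :
      IntermediateField.relfinrank F M ≠ 0)]
  have hind := DegLE.algebraicIndependent htr hdeg
  rw [hMF]
  exact ⟨3, ⟨hind.aevalEquivField.symm⟩⟩

def masudaN (a b c : K) : K := (a + b + c) ^ 2 - 3 * (a * b + b * c + c * a)
def masudaU (a b c : K) : K := (a * b ^ 2 + b * c ^ 2 + c * a ^ 2 - 3 * (a * b * c)) / masudaN a b c
def masudaV (a b c : K) : K := (a ^ 2 * b + b ^ 2 * c + c ^ 2 * a - 3 * (a * b * c)) / masudaN a b c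

theorem masuda_e2 {a b c : K} (hN : masudaN a b c ≠ 0) :
    a * b + b * c + c * a = (a + b + c) * (masudaU a b c + masudaV a b c) -
    3 * (masudaU a b c ^ 2 - masudaU a b c * masudaV a b c + masudaV a b c ^ 2) := by
  unfold masudaU masudaV
  field_simp
  unfold masudaN
  ring

theorem masuda_e3 {a b c : K} (hN : masudaN a b c ≠ 0) :
    a * b * c = (a + b + c) * (masudaU a b c * masudaV a b c) -
    (masudaU a b c + masudaV a b c) *
      (masudaU a b c ^ 2 - masudaU a b c * masudaV a b c + masudaV a b c ^ 2) := by
  unfold masudaU masudaV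
  field_simp
  unfold masudaN
  ring

theorem masuda_mem {B : IntermediateField k K} {a b c : K} (hab : a ≠ b) (hac : a ≠ c)
    (ha : a ∈ B) (hs : a + b + c ∈ B) (h2 : a * b + b * c + c * a ∈ B)
    (hw : a ^ 2 * b + b ^ 2 * c + c ^ 2 * a ∈ B) : b ∈ B ∧ c ∈ B := by
  have hb : b ∈ B := by
    have h0 : (a - b) * (a - c) ≠ 0 := mul_ne_zero (sub_ne_zero.2 hab) (sub_ne_zero.2 hac)
    set s := a + b + c with hs'
    set e := a * b + b * c + c * a with he
    set w := a ^ 2 * b + b ^ 2 * c + c ^ 2 * a with hw'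
    have hD : (a - b) * (a - c) = a ^ 2 - a * (s - a) + (e - a * (s - a)) := by
      rw [hs', he]; ring
    have hb : b = (w - a * ((s - a) ^ 2 - (e - a * (s - a)))) / ((a - b) * (a - c)) := by
      rw [eq_div_iff h0, hs', he, hw']; ring
    rw [hb, hD]
    apply_rules [add_mem, sub_mem, mul_mem, div_mem, pow_mem]
  refine ⟨hb, ?_⟩
  rw [show c = a + b + c - a - b by ring]
  apply_rules [sub_mem]

theorem DegLE.of_masuda {F : IntermediateField k K} {n : ℕ} {a b c : K} (hN : masudaN a b c ≠ 0)
    (hab : a ≠ b) (hac : a ≠ c) (hs : a + b + c ∈ F) (hU : masudaU a b c ∈ F)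
    (hV : masudaV a b c ∈ F)
    (h : ∀ B : IntermediateField k K, F ≤ B → a ∈ B → b ∈ B → c ∈ B → DegLE B n) :
    DegLE F (3 * n) := by
  have h2 : a * b + b * c + c * a ∈ F := by
    rw [masuda_e2 hN]
    apply_rules [add_mem, sub_mem, mul_mem, pow_mem, ofNat_mem]
  have h3 : a * b * c ∈ F := by
    rw [masuda_e3 hN]
    apply_rules [add_mem, sub_mem, mul_mem, pow_mem, ofNat_mem]
  have hw : a ^ 2 * b + b ^ 2 * c + c ^ 2 * a ∈ F := by
    have : a ^ 2 * b + b ^ 2 * c + c ^ 2 * a = masudaV a b c *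
        ((a + b + c) ^ 2 - 3 * (a * b + b * c + c * a)) + 3 * (a * b * c) := by
      rw [show (a + b + c) ^ 2 - 3 * (a * b + b * c + c * a) = masudaN a b c from rfl, masudaV,
        div_mul_cancel₀ _ hN]
      ring
    rw [this]
    apply_rules [add_mem, sub_mem, mul_mem, pow_mem, ofNat_mem]
  refine DegLE.of_cubic a (-(a + b + c)) (a * b + b * c + c * a) (-(a * b * c)) (neg_mem hs) h2
    (neg_mem h3) (by ring) fun B hFB ha => ?_
  obtain ⟨hb, hc⟩ := masuda_mem hab hac ha (hFB hs) (hFB h2) (hFB hw)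
  exact h B hFB ha hb hc

theorem isRational_of_monomial_action (htr : Algebra.trdeg k K = 3) {x : Fin 3 → K}
    (hind : AlgebraicIndependent k x)
    (hgen : ∀ B : IntermediateField k K, (∀ i, x i ∈ B) → B = ⊤)
    {a ε : k} (ha : a ≠ 0) (hε : ε = 1 ∨ ε = -1) {τ lam σ : K ≃ₐ[k] K}
    (hτ1 : τ (x 0) = algebraMap k K a * (x 0)⁻¹)
    (hτ2 : τ (x 1) = algebraMap k K (ε * a) * (x 1)⁻¹)
    (hτ3 : τ (x 2) = algebraMap k K ε * x 2)
    (hlam1 : lam (x 0) = algebraMap k K (ε * a) * (x 0)⁻¹)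
    (hlam2 : lam (x 1) = algebraMap k K ε * x 1)
    (hlam3 : lam (x 2) = algebraMap k K a * (x 2)⁻¹)
    (hσ1 : σ (x 0) = x 1) (hσ2 : σ (x 1) = x 2) (hσ3 : σ (x 2) = x 0) (f : Fin 3 → K)
    (hf : ∀ i, τ (f i) = f i ∧ lam (f i) = f i ∧ σ (f i) = f i)
    (hdeg : DegLE (IntermediateField.adjoin k (Set.range f)) 12) :
    IsRational k (IntermediateField.fixedField (Subgroup.closure {τ, lam, σ})) := by
  have hext : ∀ g h : K ≃ₐ[k] K, (∀ i, g (x i) = h (x i)) → g = h := by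
    intro g h hgh
    let E : IntermediateField k K :=
      { AlgHom.equalizer g.toAlgHom h.toAlgHom with
        inv_mem' := fun y (hy : g y = h y) => show g y⁻¹ = h y⁻¹ by rw [map_inv₀, map_inv₀, hy] }
    have hE : E = ⊤ := hgen E hgh
    ext y
    exact (show y ∈ E from hE ▸ IntermediateField.mem_top)
  have hε2 : ε * ε = 1 := by rcases hε with rfl | rfl <;> ring
  have hεK : algebraMap k K ε * algebraMap k K ε = 1 := by rw [← map_mul, hε2, map_one]
  have hε0 : algebraMap k K ε ≠ 0 := left_ne_zero_of_mul_eq_one hεK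
  have haK : algebraMap k K a ≠ 0 := by simpa using ha
  have hx : ∀ i, x i ≠ 0 := fun i => hind.ne_zero i
  have hsq : ∀ i, x i * x i ≠ algebraMap k K a := by
    intro i h
    refine hind.ne_zero_of_eval (X i * X i - MvPolynomial.C a) 0 (by simpa using ha) ?_
    simp [h]
  refine isRational_fixedField_closure htr τ lam σ ?_ ?_ ?_ ?_ ?_ ?_ ?_ ?_ f hf hdeg
  · refine hext _ _ fun i => ?_
    fin_cases i
    · simp [hτ1]
      field_simp
    · simp [hτ2]
      field_simp
    · simp [hτ3, ← mul_assoc, hεK]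
  · refine hext _ _ fun i => ?_
    fin_cases i
    · simp [hlam1]
      field_simp
    · simp [hlam2, ← mul_assoc, hεK]
    · simp [hlam3]
      field_simp
  · refine hext _ _ fun i => ?_
    have := hx 0
    have := hx 1
    have := hx 2
    fin_cases i
    · simp [hτ1, hlam1]
      field_simp
      linear_combination hεK
    · simp [hτ2, hlam2]
      field_simp
      linear_combination hεK
    · simp [hτ3, hlam3]
      field_simp
      linear_combination -hεK
  · intro h
    rw [h, AlgEquiv.one_apply, eq_mul_inv_iff_mul_eq₀ (hx 0)] at hτ1
    exact hsq 0 hτ1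
  · intro h
    rw [h, AlgEquiv.one_apply, eq_mul_inv_iff_mul_eq₀ (hx 2)] at hlam3
    exact hsq 2 hlam3
  · intro h
    rw [h, hlam2, eq_mul_inv_iff_mul_eq₀ (hx 1), map_mul, mul_assoc] at hτ2
    exact hsq 1 (mul_left_cancel₀ hε0 hτ2)
  · refine hext _ _ fun i => ?_
    fin_cases i <;> simp [pow_succ, hσ1, hσ2, hσ3]
  · intro h
    rw [h, AlgEquiv.one_apply] at hσ1
    refine hind.ne_zero_of_eval (X 0 - X 1) ![1, 0, 0] (by simp) ?_
    simp [hσ1]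

theorem AlgebraicIndependent.ne_zero_of_aeval_eq {f : Fin 3 → K} (h : AlgebraicIndependent k f)
    {y : K} (g : MvPolynomial (Fin 3) k) (v : Fin 3 → k) (hv : MvPolynomial.eval v g ≠ 0)
    (hy : MvPolynomial.aeval f g = y) : y ≠ 0 :=
  hy ▸ h.ne_zero_of_eval g v hv

theorem AlgebraicIndependent.masuda_ne_zero {f : Fin 3 → K} (h : AlgebraicIndependent k f) :
    masudaN (f 0) (f 1) (f 2) ≠ 0 ∧ f 0 ≠ f 1 ∧ f 0 ≠ f 2 := by
  refine ⟨?_, fun h1 => ?_, fun h2 => ?_⟩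
  · have := h.ne_zero_of_eval ((X 0 + X 1 + X 2) ^ 2 - 3 * (X 0 * X 1 + X 1 * X 2 + X 2 * X 0))
      ![1, 0, 0] (by simp)
    simpa [masudaN] using this
  · exact h.ne_zero_of_eval (X 0 - X 1) ![1, 0, 0] (by simp) (by simp [h1])
  · exact h.ne_zero_of_eval (X 0 - X 2) ![1, 0, 0] (by simp) (by simp [h2])

/-- The first of three invariants of the Klein four-group acting by `ε = 1`, with `c` for `a`. -/
def kleinInvariant (c x y z : K) : K :=
  (x * y * z + c * (x - y - z)) / (x * y + x * z - y * z - c)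

section
variable {c x y z : K}

theorem kleinInvariant_swap : kleinInvariant c x y z = kleinInvariant c x z y := by
  unfold kleinInvariant; congr 1 <;> ring

theorem kleinInvariant_inv (hc : c ≠ 0) (hx : x ≠ 0) (hy : y ≠ 0) :
    kleinInvariant c (c * x⁻¹) (c * y⁻¹) z = kleinInvariant c x y z := by
  have hu : -c * (x * y)⁻¹ ≠ 0 := by simp [hc, hx, hy]
  unfold kleinInvariant
  rw [← mul_div_mul_left _ (x * y + x * z - y * z - c) hu]
  congr 1 <;> field_simp <;> ring

theorem kleinInvariant_inv' (hc : c ≠ 0) (hy : y ≠ 0) (hz : z ≠ 0) :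
    kleinInvariant c x (c * y⁻¹) (c * z⁻¹) = kleinInvariant c x y z := by
  have hu : c * (y * z)⁻¹ ≠ 0 := by simp [hc, hy, hz]
  unfold kleinInvariant
  rw [← mul_div_mul_left _ (x * y + x * z - y * z - c) hu]
  congr 1 <;> field_simp <;> ring

theorem kleinInvariant_quadratic (h1 : x * y + x * z - y * z - c ≠ 0)
    (h2 : y * z + y * x - z * x - c ≠ 0)
    (h : kleinInvariant c x y z + kleinInvariant c y z x ≠ 0) :
    z ^ 2 + -(2 * (kleinInvariant c x y z * kleinInvariant c y z x + c) /
      (kleinInvariant c x y z + kleinInvariant c y z x)) * z + c = 0 := by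
  have hs : kleinInvariant c x y z * (x * y + x * z - y * z - c) = x * y * z + c * (x - y - z) :=
    div_mul_cancel₀ _ h1
  have ht : kleinInvariant c y z x * (y * z + y * x - z * x - c) = y * z * x + c * (y - z - x) :=
    div_mul_cancel₀ _ h2
  set s := kleinInvariant c x y z
  set t := kleinInvariant c y z x
  have key : (z ^ 2 + c) * (s + t) = 2 * (s * t + c) * z := by
    refine mul_left_cancel₀ (mul_ne_zero h1 h2) ?_
    linear_combination ((z ^ 2 + c) * (y * z + y * x - z * x - c) -
      2 * z * t * (y * z + y * x - z * x - c)) * hs +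
      ((z ^ 2 + c) * (x * y + x * z - y * z - c) -
      2 * z * (x * y * z + c * (x - y - z))) * ht
  field_simp
  linear_combination key

theorem kleinInvariant_linear (h1 : x * y + x * z - y * z - c ≠ 0) :
    y * (kleinInvariant c x y z * (x - z) - x * z + c) =
      c * (x - z) - kleinInvariant c x y z * (x * z - c) := by
  have hs : kleinInvariant c x y z * (x * y + x * z - y * z - c) = x * y * z + c * (x - y - z) :=
    div_mul_cancel₀ _ h1
  linear_combination hs
end

theorem DegLE.of_kleinInvariant {x : Fin 3 → K} (hind : AlgebraicIndependent k x)
    (hgen : ∀ B : IntermediateField k K, (∀ i, x i ∈ B) → B = ⊤) {a : k} (ha : a ≠ 0)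
    (h2 : (2 : k) ≠ 0) {F : IntermediateField k K}
    (ht1 : kleinInvariant (algebraMap k K a) (x 0) (x 1) (x 2) ∈ F)
    (ht2 : kleinInvariant (algebraMap k K a) (x 1) (x 2) (x 0) ∈ F)
    (ht3 : kleinInvariant (algebraMap k K a) (x 2) (x 0) (x 1) ∈ F) : DegLE F 4 := by
  set c := algebraMap k K a with hc
  have hcF : ∀ B : IntermediateField k K, c ∈ B := fun B => B.algebraMap_mem a
  have hden1 : x 0 * x 1 + x 0 * x 2 - x 1 * x 2 - c ≠ 0 := by
    refine hind.ne_zero_of_aeval_eq (X 0 * X 1 + X 0 * X 2 - X 1 * X 2 - MvPolynomial.C a) 0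
      (by simpa using ha) (by simp [hc])
  have hden2 : x 1 * x 2 + x 1 * x 0 - x 2 * x 0 - c ≠ 0 := by
    refine hind.ne_zero_of_aeval_eq (X 1 * X 2 + X 1 * X 0 - X 2 * X 0 - MvPolynomial.C a) 0
      (by simpa using ha) (by simp [hc])
  have hden3 : x 2 * x 0 + x 2 * x 1 - x 0 * x 1 - c ≠ 0 := by
    refine hind.ne_zero_of_aeval_eq (X 2 * X 0 + X 2 * X 1 - X 0 * X 1 - MvPolynomial.C a) 0
      (by simpa using ha) (by simp [hc])
  have h12 : kleinInvariant c (x 0) (x 1) (x 2) + kleinInvariant c (x 1) (x 2) (x 0) ≠ 0 := by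
    unfold kleinInvariant
    rw [div_add_div _ _ hden1 hden2]
    refine div_ne_zero ?_ (mul_ne_zero hden1 hden2)
    refine hind.ne_zero_of_aeval_eq
      ((X 0 * X 1 * X 2 + MvPolynomial.C a * (X 0 - X 1 - X 2)) *
        (X 1 * X 2 + X 1 * X 0 - X 2 * X 0 - MvPolynomial.C a) +
        (X 0 * X 1 + X 0 * X 2 - X 1 * X 2 - MvPolynomial.C a) *
        (X 1 * X 2 * X 0 + MvPolynomial.C a * (X 1 - X 2 - X 0))) ![0, 0, 1]
      (by simp [← two_mul, h2, ha]) (by simp [hc])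
  have h23 : kleinInvariant c (x 1) (x 2) (x 0) + kleinInvariant c (x 2) (x 0) (x 1) ≠ 0 := by
    unfold kleinInvariant
    rw [div_add_div _ _ hden2 hden3]
    refine div_ne_zero ?_ (mul_ne_zero hden2 hden3)
    refine hind.ne_zero_of_aeval_eq
      ((X 1 * X 2 * X 0 + MvPolynomial.C a * (X 1 - X 2 - X 0)) *
        (X 2 * X 0 + X 2 * X 1 - X 0 * X 1 - MvPolynomial.C a) +
        (X 1 * X 2 + X 1 * X 0 - X 2 * X 0 - MvPolynomial.C a) *
        (X 2 * X 0 * X 1 + MvPolynomial.C a * (X 2 - X 0 - X 1))) ![1, 0, 0]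
      (by simp [← two_mul, h2, ha]) (by simp [hc])
  have hlin : kleinInvariant c (x 0) (x 1) (x 2) * (x 0 - x 2) - x 0 * x 2 + c ≠ 0 := by
    unfold kleinInvariant
    rw [div_mul_eq_mul_div, div_sub' hden1, div_add' _ _ _ hden1]
    refine div_ne_zero ?_ hden1
    refine hind.ne_zero_of_aeval_eq
      ((X 0 * X 1 * X 2 + MvPolynomial.C a * (X 0 - X 1 - X 2)) * (X 0 - X 2) -
        (X 0 * X 1 + X 0 * X 2 - X 1 * X 2 - MvPolynomial.C a) * (X 0 * X 2) +
        MvPolynomial.C a * (X 0 * X 1 + X 0 * X 2 - X 1 * X 2 - MvPolynomial.C a)) 0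
      (by simp [ha]) (by simp [hc])
  have mem : ∀ (B : IntermediateField k K) {s t : K}, s ∈ B → t ∈ B →
      -(2 * (s * t + c) / (s + t)) ∈ B := by
    intro B s t hs ht
    have := hcF B
    apply_rules [add_mem, mul_mem, div_mem, neg_mem, ofNat_mem]
  refine DegLE.of_quadratic (n := 2) (x 2) _ c (mem F ht1 ht2) (hcF F)
    (kleinInvariant_quadratic hden1 hden2 h12) fun B hB hx2 => ?_
  refine DegLE.of_quadratic (n := 1) (x 0) _ c (mem B (hB ht2) (hB ht3)) (hcF B)
    (kleinInvariant_quadratic hden2 hden3 h23) fun B' hB' hx0 => ?_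
  rw [hgen B']
  · exact degLE_top
  replace hx2 := hB' hx2
  replace ht1 := hB' (hB ht1)
  have hx1 : x 1 ∈ B' := by
    rw [eq_div_of_mul_eq hlin (kleinInvariant_linear hden1)]
    have := hcF B'
    clear hB hB'
    apply_rules [add_mem, sub_mem, mul_mem, div_mem]
  intro i
  fin_cases i
  exacts [hx0, hx1, hx2]

theorem isRational_of_eps_eq_one (htr : Algebra.trdeg k K = 3) {x : Fin 3 → K}
    (hind : AlgebraicIndependent k x)
    (hgen : ∀ B : IntermediateField k K, (∀ i, x i ∈ B) → B = ⊤)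
    {a : k} (ha : a ≠ 0) (h2 : (2 : k) ≠ 0) {τ lam σ : K ≃ₐ[k] K}
    (hτ1 : τ (x 0) = algebraMap k K a * (x 0)⁻¹)
    (hτ2 : τ (x 1) = algebraMap k K a * (x 1)⁻¹)
    (hτ3 : τ (x 2) = x 2)
    (hlam1 : lam (x 0) = algebraMap k K a * (x 0)⁻¹)
    (hlam2 : lam (x 1) = x 1)
    (hlam3 : lam (x 2) = algebraMap k K a * (x 2)⁻¹)
    (hσ1 : σ (x 0) = x 1) (hσ2 : σ (x 1) = x 2) (hσ3 : σ (x 2) = x 0) :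
    IsRational k (IntermediateField.fixedField (Subgroup.closure {τ, lam, σ})) := by
  set c := algebraMap k K a with hc
  have hc0 : c ≠ 0 := by simpa [hc] using ha
  have hx : ∀ i, x i ≠ 0 := fun i => hind.ne_zero i
  set t : Fin 3 → K := ![kleinInvariant c (x 0) (x 1) (x 2), kleinInvariant c (x 1) (x 2) (x 0),
    kleinInvariant c (x 2) (x 0) (x 1)] with ht
  have hmap : ∀ (g : K ≃ₐ[k] K) (u v w : K),
      g (kleinInvariant c u v w) = kleinInvariant c (g u) (g v) (g w) := fun g u v w => by
    simp [kleinInvariant, hc]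
  have hτt : ∀ i, τ (t i) = t i := by
    intro i
    fin_cases i
    · simp only [ht]; simp only [Fin.zero_eta, Matrix.cons_val_zero]
      rw [hmap, hτ1, hτ2, hτ3, kleinInvariant_inv hc0 (hx 0) (hx 1)]
    · change τ (kleinInvariant c (x 1) (x 2) (x 0)) = kleinInvariant c (x 1) (x 2) (x 0)
      rw [hmap, hτ1, hτ2, hτ3, kleinInvariant_swap, kleinInvariant_inv hc0 (hx 1) (hx 0),
        kleinInvariant_swap]
    · change τ (kleinInvariant c (x 2) (x 0) (x 1)) = kleinInvariant c (x 2) (x 0) (x 1)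
      rw [hmap, hτ1, hτ2, hτ3, kleinInvariant_inv' hc0 (hx 0) (hx 1)]
  have hlamt : ∀ i, lam (t i) = t i := by
    intro i
    fin_cases i
    · change lam (kleinInvariant c (x 0) (x 1) (x 2)) = kleinInvariant c (x 0) (x 1) (x 2)
      rw [hmap, hlam1, hlam2, hlam3, kleinInvariant_swap, kleinInvariant_inv hc0 (hx 0) (hx 2),
        kleinInvariant_swap]
    · change lam (kleinInvariant c (x 1) (x 2) (x 0)) = kleinInvariant c (x 1) (x 2) (x 0)
      rw [hmap, hlam1, hlam2, hlam3, kleinInvariant_inv' hc0 (hx 2) (hx 0)]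
    · change lam (kleinInvariant c (x 2) (x 0) (x 1)) = kleinInvariant c (x 2) (x 0) (x 1)
      rw [hmap, hlam1, hlam2, hlam3, kleinInvariant_inv hc0 (hx 2) (hx 0)]
  have hσt : σ (t 0) = t 1 ∧ σ (t 1) = t 2 ∧ σ (t 2) = t 0 := by
    simp [ht, hmap, hσ1, hσ2, hσ3]
  have hFt : ∀ F : IntermediateField k K, t 0 ∈ F → t 1 ∈ F → t 2 ∈ F → DegLE F 4 :=
    fun F h0 h1 h2' => DegLE.of_kleinInvariant hind hgen ha h2 h0 h1 h2'
  clear_value t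
  have hindt : AlgebraicIndependent k t := by
    have hmem : ∀ i, t i ∈ IntermediateField.adjoin k (Set.range t) := fun i =>
      IntermediateField.subset_adjoin _ _ ⟨i, rfl⟩
    exact DegLE.algebraicIndependent htr (hFt _ (hmem 0) (hmem 1) (hmem 2))
  obtain ⟨hN, h01, h02⟩ := hindt.masuda_ne_zero
  refine isRational_of_monomial_action htr hind hgen ha (Or.inl rfl) hτ1 (by simpa using hτ2)
    (by simpa using hτ3) (by simpa using hlam1) (by simpa using hlam2) hlam3 hσ1 hσ2 hσ3
    ![t 0 + t 1 + t 2, masudaU (t 0) (t 1) (t 2), masudaV (t 0) (t 1) (t 2)] ?_ ?_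
  · have hcyc : masudaN (t 1) (t 2) (t 0) = masudaN (t 0) (t 1) (t 2) := by
      unfold masudaN; ring
    obtain ⟨hσ0, hσ1, hσ2⟩ := hσt
    intro i
    fin_cases i
    · simp [hτt, hlamt, hσ0, hσ1, hσ2]
      ring
    · simp [masudaU, masudaN, map_ofNat, hτt, hlamt, hσ0, hσ1, hσ2]
      congr 1; ring
    · simp [masudaV, masudaN, map_ofNat, hτt, hlamt, hσ0, hσ1, hσ2]
      congr 1; ring
  · have hmem := fun i => IntermediateField.subset_adjoin k
      (Set.range ![t 0 + t 1 + t 2, masudaU (t 0) (t 1) (t 2), masudaV (t 0) (t 1) (t 2)]) ⟨i, rfl⟩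
    exact DegLE.of_masuda (n := 4) hN h01 h02 (hmem 0) (hmem 1) (hmem 2)
      fun B _ h0 h1 h2 => hFt B h0 h1 h2

theorem norm_descent {c U V X y X1 y1 : K} (hU : U ≠ 0)
    (hP : c * (U ^ 2 + V ^ 2) + 2 ≠ 0) {D : K}
    (h : c * (X ^ 2 - (1 - (c * U * V) ^ 2) * y ^ 2) = (c * (U ^ 2 + V ^ 2) + 2) * D)
    (hX1 : U * (c * (U ^ 2 + V ^ 2) + 2) * X1 = X * (c * U ^ 2 + 1) - (1 - (c * U * V) ^ 2) * y)
    (hy1 : U * (c * (U ^ 2 + V ^ 2) + 2) * y1 = y * (c * U ^ 2 + 1) - X) :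
    X1 ^ 2 - (1 - (c * U * V) ^ 2) * y1 ^ 2 = D ∧
      c * U * X = X1 * (c * U ^ 2 + 1) + (1 - (c * U * V) ^ 2) * y1 ∧
      c * U * y = X1 + y1 * (c * U ^ 2 + 1) := by
  refine ⟨?_, ?_, ?_⟩
  · refine mul_left_cancel₀ (pow_ne_zero 2 (mul_ne_zero hU hP)) ?_
    generalize hp : c * (U ^ 2 + V ^ 2) + 2 = P at *
    linear_combination (U * P * X1 + (X * (c * U ^ 2 + 1) - (1 - (c * U * V) ^ 2) * y)) * hX1 -
      (1 - (c * U * V) ^ 2) * (U * P * y1 + (y * (c * U ^ 2 + 1) - X)) * hy1 + U ^ 2 * P * h +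
      c * U ^ 2 * (X ^ 2 - (1 - (c * U * V) ^ 2) * y ^ 2) * hp
  · refine mul_left_cancel₀ (mul_ne_zero hU hP) ?_
    linear_combination -(c * U ^ 2 + 1) * hX1 - (1 - (c * U * V) ^ 2) * hy1
  · refine mul_left_cancel₀ (mul_ne_zero hU hP) ?_
    linear_combination -hX1 - (c * U ^ 2 + 1) * hy1

theorem exists_conic_bundle (htr : Algebra.trdeg k K = 3) {κ : k} (hκ : κ ≠ 0) (h2 : (2 : k) ≠ 0)
    {s U V y : K} (hind : AlgebraicIndependent k ![s, U, V])
    (hy : y ^ 2 = s ^ 2 - 2 * (s * (U + V) - 3 * (U ^ 2 - U * V + V ^ 2)) -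
      algebraMap k K κ ^ 2 * (s * (U * V) - (U + V) * (U ^ 2 - U * V + V ^ 2)) ^ 2 +
      2 / algebraMap k K κ)
    (hfin : ∀ F : IntermediateField k K, s ∈ F → U ∈ F → V ∈ F → y ∈ F → DegLE F 12) :
    ∃ r z : K, (∀ F : IntermediateField k K, s ∈ F → U ∈ F → V ∈ F → y ∈ F → r ∈ F ∧ z ∈ F) ∧
      (∀ F : IntermediateField k K, U ∈ F → V ∈ F → r ∈ F → z ∈ F → s ∈ F ∧ y ∈ F) ∧
      (1 - algebraMap k K κ * U * V) * r ^ 2 +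
        2 * (algebraMap k K κ * (U ^ 2 - U * V + V ^ 2) - 1) * r + 2 =
        (1 + algebraMap k K κ * U * V) * z ^ 2 ∧ AlgebraicIndependent k ![U, V, r] ∧
      ∀ F : IntermediateField k K, U ∈ F → V ∈ F → r ∈ F → DegLE F (2 * 12) := by
  set c := algebraMap k K κ with hc
  have hcF : ∀ F : IntermediateField k K, c ∈ F := fun F => F.algebraMap_mem κ
  have hc0 : c ≠ 0 := by simpa [hc] using hκ
  have hU0 : U ≠ 0 := hind.ne_zero 1
  have hP0 : c * (U ^ 2 + V ^ 2) + 2 ≠ 0 := by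
    refine hind.ne_zero_of_aeval_eq (MvPolynomial.C κ * (X 1 ^ 2 + X 2 ^ 2) + 2) 0
      (by simp [h2, map_ofNat]) (by simp [hc, map_ofNat])
  have hm0 : 1 - c * U * V ≠ 0 := by
    refine hind.ne_zero_of_aeval_eq (1 - MvPolynomial.C κ * X 1 * X 2) 0 (by simp) (by simp [hc])
  have hp0 : 1 + c * U * V ≠ 0 := by
    refine hind.ne_zero_of_aeval_eq (1 + MvPolynomial.C κ * X 1 * X 2) 0 (by simp) (by simp [hc])
  have hmp : 1 - (c * U * V) ^ 2 ≠ 0 := by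
    rw [show 1 - (c * U * V) ^ 2 = (1 - c * U * V) * (1 + c * U * V) by ring]
    exact mul_ne_zero hm0 hp0
  set X : K := (1 - (c * U * V) ^ 2) * s +
    (U + V) * (c * U * V * (c * (U ^ 2 - U * V + V ^ 2)) - 1) with hX
  have hUP : U * (c * (U ^ 2 + V ^ 2) + 2) ≠ 0 := mul_ne_zero hU0 hP0
  set X1 : K := (X * (c * U ^ 2 + 1) - (1 - (c * U * V) ^ 2) * y) /
    (U * (c * (U ^ 2 + V ^ 2) + 2)) with hX1
  set z : K := (y * (c * U ^ 2 + 1) - X) / (U * (c * (U ^ 2 + V ^ 2) + 2)) with hz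
  set r : K := (X1 - (c * (U ^ 2 - U * V + V ^ 2) - 1)) / (1 - c * U * V) with hr
  have hnorm : c * (X ^ 2 - (1 - (c * U * V) ^ 2) * y ^ 2) = (c * (U ^ 2 + V ^ 2) + 2) *
      ((c * (U ^ 2 - U * V + V ^ 2) - 1) ^ 2 - 2 * (1 - c * U * V)) := by
    have hyc : c * y ^ 2 = c * (s ^ 2 - 2 * (s * (U + V) - 3 * (U ^ 2 - U * V + V ^ 2)) -
        c ^ 2 * (s * (U * V) - (U + V) * (U ^ 2 - U * V + V ^ 2)) ^ 2) + 2 := by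
      rw [hy]; field_simp
    rw [hX]
    linear_combination -(1 - (c * U * V) ^ 2) * hyc
  obtain ⟨h1, hXeq, hyeq⟩ := norm_descent hU0 hP0 hnorm (X1 := X1) (y1 := z)
    (by rw [hX1]; field_simp) (by rw [hz]; field_simp)
  have hrX : (1 - c * U * V) * r = X1 - (c * (U ^ 2 - U * V + V ^ 2) - 1) := by
    rw [hr]; field_simp
  have hE : (1 - c * U * V) * r ^ 2 + 2 * (c * (U ^ 2 - U * V + V ^ 2) - 1) * r + 2 =
      (1 + c * U * V) * z ^ 2 := by
    refine mul_left_cancel₀ hm0 ?_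
    linear_combination h1 + ((1 - c * U * V) * r + X1 + (c * (U ^ 2 - U * V + V ^ 2) - 1)) * hrX
  have hback : ∀ F : IntermediateField k K, U ∈ F → V ∈ F → r ∈ F → z ∈ F → s ∈ F ∧ y ∈ F := by
    intro F hU hV hr' hz'
    have hcF := hcF F
    have hX1F : X1 ∈ F := by
      rw [show X1 = (1 - c * U * V) * r + (c * (U ^ 2 - U * V + V ^ 2) - 1) by rw [hrX]; ring]
      clear_value r z X1 X
      apply_rules [add_mem, sub_mem, mul_mem, pow_mem, one_mem]
    have hXF : X ∈ F := by
      rw [eq_div_of_mul_eq (mul_ne_zero hc0 hU0) ((mul_comm _ _).trans hXeq)]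
      clear_value r z X1 X
      apply_rules [add_mem, sub_mem, mul_mem, pow_mem, one_mem, div_mem]
    have hyF : y ∈ F := by
      rw [eq_div_of_mul_eq (mul_ne_zero hc0 hU0) ((mul_comm _ _).trans hyeq)]
      clear_value r z X1 X
      apply_rules [add_mem, sub_mem, mul_mem, pow_mem, one_mem, div_mem]
    refine ⟨?_, hyF⟩
    rw [show s = (X - (U + V) * (c * U * V * (c * (U ^ 2 - U * V + V ^ 2)) - 1)) /
      (1 - (c * U * V) ^ 2) by rw [eq_div_iff hmp, hX]; ring]
    clear_value r z X1 X
    apply_rules [add_mem, sub_mem, mul_mem, pow_mem, one_mem, div_mem]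
  have hdeg : ∀ F : IntermediateField k K, U ∈ F → V ∈ F → r ∈ F → DegLE F (2 * 12) := by
    intro F hU hV hr'
    clear_value r z
    refine DegLE.of_quadratic z 0 (-(((1 - c * U * V) * r ^ 2 +
      2 * (c * (U ^ 2 - U * V + V ^ 2) - 1) * r + 2) / (1 + c * U * V))) (zero_mem F) ?_ ?_ ?_
    · have hcF := hcF F
      apply_rules [neg_mem, add_mem, sub_mem, mul_mem, pow_mem, one_mem, div_mem, ofNat_mem]
    · rw [hE]; field_simp; ring
    · intro B hB hzB
      obtain ⟨hs, hy⟩ := hback B (hB hU) (hB hV) (hB hr') hzB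
      exact hfin B hs (hB hU) (hB hV) hy
  refine ⟨r, z, fun F hs hU hV hy => ?_, hback, hE, ?_, hdeg⟩
  · have hcF := hcF F
    have hXF : X ∈ F := by
      rw [hX]
      apply_rules [add_mem, sub_mem, mul_mem, pow_mem, one_mem]
    clear_value X
    constructor
    · rw [hr, hX1]
      apply_rules [add_mem, sub_mem, mul_mem, pow_mem, one_mem, div_mem, ofNat_mem] <;> assumption
    · rw [hz]
      apply_rules [add_mem, sub_mem, mul_mem, pow_mem, one_mem, div_mem, ofNat_mem]
  · have hmem : ∀ i, ![U, V, r] i ∈ IntermediateField.adjoin k (Set.range ![U, V, r]) := fun i =>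
      IntermediateField.subset_adjoin _ _ ⟨i, rfl⟩
    exact DegLE.algebraicIndependent htr (hdeg _ (hmem 0) (hmem 1) (hmem 2))

theorem exists_generators_of_sqrt_neg_one {κ i : k} (hκ : κ ≠ 0) (h2 : (2 : k) ≠ 0)
    (hi : i ^ 2 = -1) {U V r y : K} (hind : AlgebraicIndependent k ![U, V, r])
    (hE : (1 - algebraMap k K κ * U * V) * r ^ 2 +
      2 * (algebraMap k K κ * (U ^ 2 - U * V + V ^ 2) - 1) * r + 2 =
      (1 + algebraMap k K κ * U * V) * y ^ 2) :
    ∃ f : Fin 3 → K,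
      (∀ F : IntermediateField k K, U ∈ F → V ∈ F → r ∈ F → y ∈ F → ∀ j, f j ∈ F) ∧
      ∀ F : IntermediateField k K, (∀ j, f j ∈ F) → U ∈ F ∧ V ∈ F ∧ r ∈ F ∧ y ∈ F := by
  have hcF : ∀ F : IntermediateField k K, algebraMap k K κ ∈ F := fun F => F.algebraMap_mem κ
  have hiF : ∀ F : IntermediateField k K, algebraMap k K i ∈ F := fun F => F.algebraMap_mem i
  have hK2 : (2 : K) ≠ 0 := by
    simpa [map_ofNat] using (map_ne_zero (algebraMap k K)).2 h2
  have hp0 : 1 + algebraMap k K κ * U * V ≠ 0 := by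
    refine hind.ne_zero_of_aeval_eq (1 + MvPolynomial.C κ * X 0 * X 1) 0 (by simp) (by simp)
  have hr0 : r ≠ 0 := hind.ne_zero 2
  have hμ : r ^ 2 + y ^ 2 ≠ 0 := by
    have h : 2 * r ^ 2 + 2 * (algebraMap k K κ * (U ^ 2 - U * V + V ^ 2) - 1) * r + 2 ≠ 0 :=
      hind.ne_zero_of_aeval_eq (2 * X 2 ^ 2 +
        2 * (MvPolynomial.C κ * (X 0 ^ 2 - X 0 * X 1 + X 1 ^ 2) - 1) * X 2 + 2) 0
        (by simp [h2, map_ofNat]) (by simp [map_ofNat])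
    intro h0
    exact h (by linear_combination hE + (1 + algebraMap k K κ * U * V) * h0)
  have hμ2 : 2 * r - (r ^ 2 + y ^ 2) ≠ 0 := by
    have h : 2 * r ^ 2 + 2 * (algebraMap k K κ * (U ^ 2 - U * V + V ^ 2) - 1) * r + 2 -
        2 * r * (1 + algebraMap k K κ * U * V) ≠ 0 :=
      hind.ne_zero_of_aeval_eq (2 * X 2 ^ 2 +
        2 * (MvPolynomial.C κ * (X 0 ^ 2 - X 0 * X 1 + X 1 ^ 2) - 1) * X 2 + 2 -
        2 * X 2 * (1 + MvPolynomial.C κ * X 0 * X 1)) 0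
        (by simp [h2, map_ofNat]) (by simp [map_ofNat])
    intro h0
    exact h (by linear_combination hE - (1 + algebraMap k K κ * U * V) * h0)
  have hN0 : (2 * r - (r ^ 2 + y ^ 2)) * (U + V) ^ 2 +
      (6 * r + (r ^ 2 + y ^ 2)) * (U - V) ^ 2 ≠ 0 := by
    have h := hind.ne_zero_of_aeval_eq (y := (2 * r * (1 + algebraMap k K κ * U * V) - (2 * r ^ 2 +
        2 * (algebraMap k K κ * (U ^ 2 - U * V + V ^ 2) - 1) * r + 2)) * (U + V) ^ 2 +
        (6 * r * (1 + algebraMap k K κ * U * V) + (2 * r ^ 2 +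
        2 * (algebraMap k K κ * (U ^ 2 - U * V + V ^ 2) - 1) * r + 2)) * (U - V) ^ 2)
      ((2 * X 2 * (1 + MvPolynomial.C κ * X 0 * X 1) - (2 * X 2 ^ 2 +
        2 * (MvPolynomial.C κ * (X 0 ^ 2 - X 0 * X 1 + X 1 ^ 2) - 1) * X 2 + 2)) *
        (X 0 + X 1) ^ 2 +
        (6 * X 2 * (1 + MvPolynomial.C κ * X 0 * X 1) + (2 * X 2 ^ 2 +
        2 * (MvPolynomial.C κ * (X 0 ^ 2 - X 0 * X 1 + X 1 ^ 2) - 1) * X 2 + 2)) *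
        (X 0 - X 1) ^ 2) ![1, 0, 1]
        (by
          have h8 : (2 : k) ^ 3 ≠ 0 := pow_ne_zero 3 h2
          convert h8 using 1
          simp [map_ofNat]
          ring) (by simp [map_ofNat])
    intro h0
    refine h ?_
    linear_combination (1 + algebraMap k K κ * U * V) * h0 +
      ((U - V) ^ 2 - (U + V) ^ 2) * hE
  obtain ⟨c, hc⟩ : ∃ c, c = algebraMap k K κ := ⟨_, rfl⟩
  obtain ⟨j, hj⟩ : ∃ j, j = algebraMap k K i := ⟨_, rfl⟩
  have hc0 : c ≠ 0 := by simpa [hc] using hκ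
  have hj2 : j ^ 2 = -1 := by rw [hj, ← map_pow, hi]; simp
  have hj0 : j ≠ 0 := by rintro rfl; simp at hj2
  simp only [← hc, ← hj] at *
  clear hκ h2 hi hind hp0 hc hj
  obtain ⟨m, hm⟩ : ∃ m, m = (r ^ 2 + y ^ 2) / r := ⟨_, rfl⟩
  have hmr : m * r = r ^ 2 + y ^ 2 := by rw [hm]; field_simp
  rw [← hmr] at hμ hμ2 hN0
  have hm0 : m ≠ 0 := left_ne_zero_of_mul hμ
  have hm2 : 2 - m ≠ 0 := fun h => hμ2 (by linear_combination r * h)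
  obtain ⟨t, ht⟩ : ∃ t, t = y / r := ⟨_, rfl⟩
  have hy : y = t * r := by rw [ht]; field_simp
  have hrt : (1 + t ^ 2) * r = m := by
    apply mul_right_cancel₀ hr0; rw [hmr, hy]; ring
  have hE' : c * r * ((2 - m) * (U + V) ^ 2 + (m + 6) * (U - V) ^ 2) =
      -4 * (2 * r ^ 2 - 2 * r + 2 - m * r) := by
    linear_combination 4 * hE - 4 * (1 + c * U * V) * hmr
  have hwp : 1 + j * t ≠ 0 := fun h => hm0 (by
    rw [← hrt]; linear_combination r * (1 - j * t) * h + r * t ^ 2 * hj2)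
  have hwm : 1 - j * t ≠ 0 := fun h => hm0 (by
    rw [← hrt]; linear_combination r * (1 + j * t) * h + r * t ^ 2 * hj2)
  have hw0 : 1 + t ^ 2 ≠ 0 := fun h => hm0 (by rw [← hrt, h, zero_mul])
  obtain ⟨W, hW⟩ : ∃ W, W = 4 * (1 + t ^ 2) - m * (m + 2) := ⟨_, rfl⟩
  obtain ⟨Q, hQ⟩ : ∃ Q, Q = (m - 2) * (m + 6) := ⟨_, rfl⟩
  have hE2 : 2 * c * m * (1 + t ^ 2) * ((2 - m) ^ 2 * (U + V) ^ 2 - Q * (U - V) ^ 2) =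
      -(2 - m) * (W ^ 2 - Q * m ^ 2) := by
    rw [hQ, hW]
    linear_combination 2 * (2 - m) * (1 + t ^ 2) ^ 2 * hE' - (2 * c * (1 + t ^ 2) * (2 - m) *
      ((2 - m) * (U + V) ^ 2 + (m + 6) * (U - V) ^ 2) + 8 * (2 - m) *
      (2 * ((1 + t ^ 2) * r + m) - 2 * (1 + t ^ 2) - m * (1 + t ^ 2))) * hrt
  have hN : W ^ 2 - Q * m ^ 2 ≠ 0 := by
    have h2r : (2 - m) * (U + V) ^ 2 + (m + 6) * (U - V) ^ 2 ≠ 0 := fun h =>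
      hN0 (by linear_combination r * h)
    have h : 2 * c * m * (1 + t ^ 2) * ((2 - m) *
        ((2 - m) * (U + V) ^ 2 + (m + 6) * (U - V) ^ 2)) ≠ 0 := by
      simp only [ne_eq, mul_eq_zero, not_or]
      tauto
    intro h0
    apply h
    rw [hQ] at hE2
    rw [hQ] at h0
    linear_combination hE2 - (2 - m) * h0
  obtain ⟨A, hA⟩ : ∃ A, A = ((2 - m) * (U + V) * W + Q * (U - V) * m) / (W ^ 2 - Q * m ^ 2) :=
    ⟨_, rfl⟩
  obtain ⟨B, hB⟩ : ∃ B, B = ((2 - m) * (U + V) * m + (U - V) * W) / (W ^ 2 - Q * m ^ 2) :=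
    ⟨_, rfl⟩
  have hA' : A * (W ^ 2 - Q * m ^ 2) = (2 - m) * (U + V) * W + Q * (U - V) * m := by
    rw [hA, div_mul_cancel₀ _ hN]
  have hB' : B * (W ^ 2 - Q * m ^ 2) = (2 - m) * (U + V) * m + (U - V) * W := by
    rw [hB, div_mul_cancel₀ _ hN]
  have hσ : (2 - m) * (U + V) = A * W - Q * B * m := by
    apply mul_right_cancel₀ hN
    linear_combination -W * hA' + Q * m * hB'
  have hD : U - V = B * W - A * m := by
    apply mul_right_cancel₀ hN
    linear_combination -W * hB' + m * hA'
  have hAB : 2 * c * m * (1 + t ^ 2) * (A ^ 2 - Q * B ^ 2) = -(2 - m) := by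
    apply mul_right_cancel₀ hN
    rw [← hE2, hD]
    linear_combination (-2 * c * m * (1 + t ^ 2)) * ((2 - m) * (U + V) + (A * W - Q * B * m)) * hσ
  have hmF : ∀ F : IntermediateField k K, r ∈ F → y ∈ F → m ∈ F ∧ t ∈ F := by
    intro F hr hy'
    rw [hm, ht]
    constructor <;> apply_rules [add_mem, pow_mem, div_mem]
  have hQWF : ∀ F : IntermediateField k K, m ∈ F → Q ∈ F := by
    intro F hm
    rw [hQ]
    apply_rules [add_mem, sub_mem, mul_mem, ofNat_mem]
  have hWF : ∀ F : IntermediateField k K, m ∈ F → t ∈ F → W ∈ F := by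
    intro F hm ht
    rw [hW]
    apply_rules [add_mem, sub_mem, mul_mem, ofNat_mem, one_mem, pow_mem]
  refine ⟨![m, A * (1 + j * t), B * (1 + j * t)], ?_, ?_⟩
  · intro F hU hV hr hyF
    obtain ⟨hmF, htF⟩ := hmF F hr hyF
    have hQF := hQWF F hmF
    have hWF := hWF F hmF htF
    have hjF := hiF F
    have hAF : A ∈ F := by
      rw [hA]
      apply_rules [add_mem, sub_mem, mul_mem, ofNat_mem, pow_mem, div_mem]
    have hBF : B ∈ F := by
      rw [hB]
      apply_rules [add_mem, sub_mem, mul_mem, ofNat_mem, pow_mem, div_mem]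
    have h1 : 1 + j * t ∈ F := add_mem (one_mem F) (mul_mem hjF htF)
    intro l
    fin_cases l
    exacts [hmF, mul_mem hAF h1, mul_mem hBF h1]
  · intro F hF
    have hmF : m ∈ F := hF 0
    have hG : A * (1 + j * t) ∈ F := hF 1
    have hH : B * (1 + j * t) ∈ F := hF 2
    have hQF := hQWF F hmF
    have hjF := hiF F
    have hcF := hcF F
    have hψ : (1 + j * t) / (1 - j * t) = -2 * c * m * ((A * (1 + j * t)) ^ 2 -
        Q * (B * (1 + j * t)) ^ 2) / (2 - m) := by
      rw [div_eq_div_iff hwm hm2]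
      linear_combination (1 + j * t) * hAB -
        2 * (1 + j * t) * c * m * (A ^ 2 - Q * B ^ 2) * t ^ 2 * hj2
    obtain ⟨ψ, hψ'⟩ : ∃ ψ, ψ = (1 + j * t) / (1 - j * t) := ⟨_, rfl⟩
    rw [← hψ'] at hψ
    have hψF : ψ ∈ F := by
      rw [hψ]
      generalize A * (1 + j * t) = G at *
      generalize B * (1 + j * t) = H at *
      apply_rules [neg_mem, sub_mem, mul_mem, ofNat_mem, pow_mem, div_mem]
    have hψ1 : ψ * (1 - j * t) = 1 + j * t := by rw [hψ', div_mul_cancel₀ _ hwm]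
    have hψ0 : ψ + 1 ≠ 0 := fun h => hK2 (by linear_combination (1 - j * t) * h - hψ1)
    have htF : t ∈ F := by
      rw [show t = (ψ - 1) / (j * (ψ + 1)) by
        rw [eq_div_iff (mul_ne_zero hj0 hψ0)]; linear_combination -hψ1]
      apply_rules [add_mem, sub_mem, mul_mem, one_mem, div_mem]
    have hWF := hWF F hmF htF
    have h1 : 1 + j * t ∈ F := add_mem (one_mem F) (mul_mem hjF htF)
    have hAF : A ∈ F := by
      rw [← mul_div_cancel_right₀ A hwp]; exact div_mem hG h1
    have hBF : B ∈ F := by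
      rw [← mul_div_cancel_right₀ B hwp]; exact div_mem hH h1
    have hrF : r ∈ F := by
      rw [eq_div_of_mul_eq hw0 ((mul_comm _ _).trans hrt)]
      apply_rules [add_mem, one_mem, pow_mem, div_mem]
    have hσF : U + V ∈ F := by
      rw [eq_div_of_mul_eq hm2 ((mul_comm _ _).trans hσ)]
      apply_rules [sub_mem, mul_mem, div_mem, ofNat_mem]
    have hDF : U - V ∈ F := by
      rw [hD]
      apply_rules [sub_mem, mul_mem]
    refine ⟨?_, ?_, hrF, hy ▸ mul_mem htF hrF⟩
    · rw [show U = ((U + V) + (U - V)) / 2 by field_simp; ring]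
      exact div_mem (add_mem hσF hDF) (ofNat_mem F 2)
    · rw [show V = ((U + V) - (U - V)) / 2 by field_simp; ring]
      exact div_mem (sub_mem hσF hDF) (ofNat_mem F 2)

theorem exists_cubic_coordinates (htr : Algebra.trdeg k K = 3) (h2 : (2 : k) ≠ 0) {U V r y : K}
    (hind : AlgebraicIndependent k ![U, V, r]) {n : ℕ}
    (hfin : ∀ F : IntermediateField k K, U ∈ F → V ∈ F → r ∈ F → DegLE F n)
    (hE : (1 - U * V) * r ^ 2 + 2 * (U ^ 2 - U * V + V ^ 2 - 1) * r + 2 = (1 + U * V) * y ^ 2) :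
    ∃ t w ξ : K, (∀ F : IntermediateField k K, U ∈ F → V ∈ F → t ∈ F ∧ w ∈ F) ∧
      (∀ F : IntermediateField k K, t ∈ F → w ∈ F → U ∈ F ∧ V ∈ F) ∧
      AlgebraicIndependent k ![t, w, r] ∧ w ^ 2 + t ^ 2 + 3 = ξ * w ∧
      (2 * t * r - ξ - 2 * t) ^ 2 =
        (ξ ^ 2 + 2 * t * ξ - 8) * y ^ 2 - 2 * (t * ξ + 4) * r ^ 2 := by
  have hK2 : (2 : K) ≠ 0 := by
    simpa [map_ofNat] using (map_ne_zero (algebraMap k K)).2 h2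
  have hD : U - V ≠ 0 :=
    hind.ne_zero_of_aeval_eq (X 0 - X 1) ![1, 0, 0] (by simp) (by simp)
  have hv : U + V - 2 - (U ^ 2 - U * V + V ^ 2 - 1) ≠ 0 :=
    hind.ne_zero_of_aeval_eq (X 0 + X 1 - 2 - (X 0 ^ 2 - X 0 * X 1 + X 1 ^ 2 - 1)) 0
      (by simp only [map_add, map_sub, map_mul, map_pow, map_ofNat, map_one, MvPolynomial.eval_X,
            Pi.zero_apply]
          norm_num) (by simp [map_ofNat])
  obtain ⟨t, ht⟩ : ∃ t, t = (U ^ 2 - U * V + V ^ 2 - 1) / (U - V) := ⟨_, rfl⟩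
  obtain ⟨w, hw⟩ : ∃ w, w = (U + V - 2) / (U - V) - t := ⟨_, rfl⟩
  have ht' : t * (U - V) = U ^ 2 - U * V + V ^ 2 - 1 := by rw [ht, div_mul_cancel₀ _ hD]
  have hw' : (w + t) * (U - V) = U + V - 2 := by rw [hw, sub_add_cancel, div_mul_cancel₀ _ hD]
  have hw0 : w ≠ 0 := by
    rintro rfl
    exact hv (by linear_combination ht' - hw')
  have hDw : (U - V) * ((w + t) ^ 2 + 3) = -4 * w := by
    apply mul_left_cancel₀ hD
    linear_combination ((w + t) * (U - V) + (U + V - 2)) * hw' + 4 * hw' - 4 * ht'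
  have hv3 : (w + t) ^ 2 + 3 ≠ 0 := by
    intro h
    rw [h, mul_zero, eq_comm, neg_mul, neg_eq_zero, mul_eq_zero] at hDw
    rcases hDw with h4 | h4
    · exact hK2 (by
        have : (2 : K) ^ 2 = 0 := by linear_combination h4
        simpa using this)
    · exact hw0 h4
  have hF : ∀ F : IntermediateField k K, t ∈ F → w ∈ F → U ∈ F ∧ V ∈ F := by
    intro F htF hwF
    have hDF : U - V ∈ F := by
      rw [eq_div_of_mul_eq hv3 hDw]
      apply_rules [add_mem, mul_mem, neg_mem, pow_mem, div_mem, ofNat_mem]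
    have hσF : U + V ∈ F := by
      rw [show U + V = (w + t) * (U - V) + 2 by rw [hw']; ring]
      generalize U - V = D at *
      apply_rules [add_mem, mul_mem, ofNat_mem]
    constructor
    · rw [show U = ((U + V) + (U - V)) / 2 by field_simp; ring]
      exact div_mem (add_mem hσF hDF) (ofNat_mem F 2)
    · rw [show V = ((U + V) - (U - V)) / 2 by field_simp; ring]
      exact div_mem (sub_mem hσF hDF) (ofNat_mem F 2)
  have hmem : ∀ i, ![t, w, r] i ∈ IntermediateField.adjoin k (Set.range ![t, w, r]) := fun i =>
    IntermediateField.subset_adjoin _ _ ⟨i, rfl⟩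
  refine ⟨t, w, (w ^ 2 + t ^ 2 + 3) / w, ?_, hF, ?_, ?_, ?_⟩
  · intro F hU hV
    have htF : t ∈ F := by
      rw [ht]
      apply_rules [add_mem, sub_mem, mul_mem, pow_mem, div_mem, one_mem]
    refine ⟨htF, ?_⟩
    rw [hw]
    apply_rules [add_mem, sub_mem, mul_mem, pow_mem, div_mem, ofNat_mem]
  · have hUV := hF _ (hmem 0) (hmem 1)
    exact DegLE.algebraicIndependent htr (hfin _ hUV.1 hUV.2 (hmem 2))
  · field_simp
  · obtain ⟨ξ, hξ⟩ : ∃ ξ, ξ = (w ^ 2 + t ^ 2 + 3) / w := ⟨_, rfl⟩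
    have hξ' : w ^ 2 + t ^ 2 + 3 = ξ * w := by rw [hξ, div_mul_cancel₀ _ hw0]
    rw [← hξ]
    have hDξ : (U - V) * (ξ + 2 * t) = -4 := by
      apply mul_right_cancel₀ hw0
      linear_combination hDw - (U - V) * hξ'
    apply mul_left_cancel₀ (pow_ne_zero 2 hD)
    linear_combination (((U - V) * (ξ + 2 * t) + 4) - 2 * (2 * t * r * (U - V) + 4) -
      y ^ 2 * (((U - V) * (ξ + 2 * t) + 4) - 8 - 2 * t * (U - V)) + 2 * t * (U - V) * r ^ 2) *
      hDξ + (16 * r - 8 * y ^ 2 - 8 * r ^ 2) * ht' + 8 * hE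

theorem exists_norm_solution (h2 : (2 : K) ≠ 0) {t w ξ r y : K} (hw0 : w ≠ 0)
    (he : 1 - t ^ 2 ≠ 0) (hA : ξ ^ 2 + 2 * t * ξ - 8 ≠ 0) (hL : t * ξ + 6 - 2 * t ^ 2 ≠ 0)
    (hX : ξ + 2 * t ≠ 0) (hδ : (ξ ^ 2 + 2 * t * ξ - 8) * y -
      ((2 * t * r - ξ - 2 * t) * (2 * w - ξ) + r * (2 * ξ + 8 * t)) ≠ 0)
    (hξ : w ^ 2 + t ^ 2 + 3 = ξ * w)
    (hE : (2 * t * r - ξ - 2 * t) ^ 2 =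
        (ξ ^ 2 + 2 * t * ξ - 8) * y ^ 2 - 2 * (t * ξ + 4) * r ^ 2) :
    ∃ x z : K,
      (∀ F : IntermediateField k K, t ∈ F → w ∈ F → r ∈ F → y ∈ F → x ∈ F ∧ z ∈ F) ∧
      (∀ F : IntermediateField k K, t ∈ F → w ∈ F → x ∈ F → z ∈ F → r ∈ F ∧ y ∈ F) ∧
      x ^ 2 - (1 - t ^ 2) * z ^ 2 = 4 * (t * ξ + 6 - 2 * t ^ 2) * (t * ξ + 4) := by
  obtain ⟨b, hb⟩ : ∃ b, b = t * ξ + 4 := ⟨_, rfl⟩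
  obtain ⟨L, hLd⟩ : ∃ L, L = t * ξ + 6 - 2 * t ^ 2 := ⟨_, rfl⟩
  obtain ⟨A, hAd⟩ : ∃ A, A = ξ ^ 2 + 2 * t * ξ - 8 := ⟨_, rfl⟩
  obtain ⟨χ, hχ⟩ : ∃ χ, χ = 2 * w - ξ := ⟨_, rfl⟩
  obtain ⟨S, hS⟩ : ∃ S, S = 2 * t * r - ξ - 2 * t := ⟨_, rfl⟩
  obtain ⟨G, hG⟩ : ∃ G, G = 2 * ξ + 8 * t := ⟨_, rfl⟩
  rw [← hLd] at hL
  rw [← hAd] at hA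
  rw [← hAd, ← hS, ← hb] at hE
  rw [← hAd, ← hS, ← hχ, ← hG] at hδ
  rw [← hLd, ← hb]
  have hLb : L - b = 2 * (1 - t ^ 2) := by rw [hLd, hb]; ring
  have hK : G ^ 2 + 2 * b * χ ^ 2 = 2 * A * L := by
    rw [hG, hb, hχ, hAd, hLd]
    linear_combination 8 * (t * ξ + 4) * hξ
  have hF : ∀ F : IntermediateField k K, t ∈ F → w ∈ F →
      ξ ∈ F ∧ b ∈ F ∧ L ∈ F ∧ A ∈ F ∧ χ ∈ F ∧ G ∈ F := by
    intro F ht hw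
    have hξF : ξ ∈ F := by
      rw [eq_div_of_mul_eq hw0 hξ.symm]
      apply_rules [add_mem, pow_mem, div_mem, ofNat_mem]
    rw [hb, hLd, hAd, hχ, hG]
    refine ⟨hξF, ?_, ?_, ?_, ?_, ?_⟩ <;>
      apply_rules [add_mem, sub_mem, mul_mem, pow_mem, ofNat_mem]
  clear hLd hAd hχ hG hb
  obtain ⟨R, hR⟩ : ∃ R, R = S * χ + r * G := ⟨_, rfl⟩
  obtain ⟨T, hT⟩ : ∃ T, T = S * G - 2 * b * r * χ := ⟨_, rfl⟩
  obtain ⟨d, hd⟩ : ∃ d, d = A * y - R := ⟨_, rfl⟩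
  rw [← hR, ← hd] at hδ
  have hT2 : 2 * L * (A * y) ^ 2 - 2 * b * R ^ 2 = T ^ 2 := by
    rw [hR, hT]
    linear_combination -(G ^ 2 + 2 * b * χ ^ 2) * hE - A * y ^ 2 * hK
  have hS' : G * T + 2 * b * χ * R = S * (2 * A * L) := by
    rw [hR, hT]; linear_combination S * hK
  have hr' : G * R - χ * T = r * (2 * A * L) := by
    rw [hR, hT]; linear_combination r * hK
  have hAL : 2 * A * L ≠ 0 := mul_ne_zero (mul_ne_zero h2 hA) hL
  have h4e : 4 * (1 - t ^ 2) ≠ 0 := by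
    rw [show (4 : K) = 2 * 2 by norm_num]
    exact mul_ne_zero (mul_ne_zero h2 h2) he
  have hx : (2 * (L * (A * y) - b * R) / d) * d = 2 * (L * (A * y) - b * R) :=
    div_mul_cancel₀ _ hδ
  have hz : (2 * T / d) * d = 2 * T := div_mul_cancel₀ _ hδ
  refine ⟨2 * (L * (A * y) - b * R) / d, 2 * T / d, ?_, ?_, ?_⟩
  · intro F ht hw hr hy
    obtain ⟨hξF, hbF, hLF, hAF, hχF, hGF⟩ := hF F ht hw
    have hSF : S ∈ F := by
      rw [hS]
      apply_rules [sub_mem, mul_mem, ofNat_mem]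
    have hRF : R ∈ F := by
      rw [hR]
      apply_rules [add_mem, mul_mem]
    have hTF : T ∈ F := by
      rw [hT]
      apply_rules [sub_mem, mul_mem, ofNat_mem]
    have hdF : d ∈ F := by
      rw [hd]
      apply_rules [sub_mem, mul_mem]
    constructor <;> apply_rules [sub_mem, mul_mem, div_mem, ofNat_mem]
  · intro F ht hw
    generalize 2 * (L * (A * y) - b * R) / d = x at *
    generalize 2 * T / d = z at *
    intro hxF hzF
    obtain ⟨hξF, hbF, hLF, hAF, hχF, hGF⟩ := hF F ht hw
    obtain ⟨ρ, hρ⟩ : ∃ ρ, ρ = (x - 2 * L) / (4 * (1 - t ^ 2)) := ⟨_, rfl⟩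
    obtain ⟨η, hη⟩ : ∃ η, η = (x - 2 * b) / (4 * (1 - t ^ 2)) := ⟨_, rfl⟩
    have hρF : ρ ∈ F := by
      rw [hρ]
      apply_rules [sub_mem, mul_mem, div_mem, ofNat_mem, one_mem, pow_mem]
    have hηF : η ∈ F := by
      rw [hη]
      apply_rules [sub_mem, mul_mem, div_mem, ofNat_mem, one_mem, pow_mem]
    have hRd : R = ρ * d := by
      rw [hρ, div_mul_eq_mul_div, eq_div_iff h4e]
      linear_combination -hx - 2 * R * hLb + 2 * L * hd
    have hYd : A * y = η * d := by
      rw [hη, div_mul_eq_mul_div, eq_div_iff h4e]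
      linear_combination -hx - 2 * (A * y) * hLb + 2 * b * hd
    obtain ⟨α, hα⟩ : ∃ α, α = (G * (z / 2) + 2 * b * χ * ρ) / (2 * A * L) := ⟨_, rfl⟩
    obtain ⟨β, hβ⟩ : ∃ β, β = (G * ρ - χ * (z / 2)) / (2 * A * L) := ⟨_, rfl⟩
    have hTd : T = z / 2 * d := by field_simp; linear_combination -hz
    have hSd : S = α * d := by
      rw [hα, div_mul_eq_mul_div, eq_div_iff hAL]
      linear_combination -hS' + G * hTd + 2 * b * χ * hRd
    have hrd : r = β * d := by
      rw [hβ, div_mul_eq_mul_div, eq_div_iff hAL]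
      linear_combination -hr' - χ * hTd + G * hRd
    have hαF : α ∈ F := by
      rw [hα]
      apply_rules [add_mem, mul_mem, div_mem, ofNat_mem]
    have hβF : β ∈ F := by
      rw [hβ]
      apply_rules [sub_mem, mul_mem, div_mem, ofNat_mem]
    have hdαβ : d * (2 * t * β - α) = ξ + 2 * t := by
      linear_combination -hS + hSd - 2 * t * hrd
    have hαβ : 2 * t * β - α ≠ 0 := fun h => hX (by rw [← hdαβ, h, mul_zero])
    have hdF : d ∈ F := by
      rw [eq_div_of_mul_eq hαβ hdαβ]
      apply_rules [add_mem, sub_mem, mul_mem, div_mem, ofNat_mem]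
    refine ⟨hrd ▸ mul_mem hβF hdF, ?_⟩
    rw [eq_div_of_mul_eq hA ((mul_comm _ _).trans hYd)]
    exact div_mem (mul_mem hηF hdF) hAF
  · apply mul_right_cancel₀ (pow_ne_zero 2 hδ)
    generalize 2 * (L * (A * y) - b * R) / d = x at *
    generalize 2 * T / d = z at *
    linear_combination (x * d + 2 * (L * (A * y) - b * R)) * hx -
      (1 - t ^ 2) * (z * d + 2 * T) * hz + 4 * (1 - t ^ 2) * hT2 +
      2 * (2 * L * (A * y) ^ 2 - 2 * b * R ^ 2) * hLb - 4 * L * b * (d + A * y - R) * hd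

theorem exists_twisted_norm_solution (h2 : (2 : K) ≠ 0) {t w ξ x₀ z₀ : K} (ht0 : t ≠ 0)
    (hw0 : w ≠ 0) (hL : t * ξ + 6 - 2 * t ^ 2 ≠ 0) (hξ : w ^ 2 + t ^ 2 + 3 = ξ * w)
    (hnorm : x₀ ^ 2 - (1 - t ^ 2) * z₀ ^ 2 = 4 * (t * ξ + 6 - 2 * t ^ 2) * (t * ξ + 4)) :
    ∃ x z : K,
      (∀ F : IntermediateField k K, t ∈ F → w ∈ F → x₀ ∈ F → z₀ ∈ F → x ∈ F ∧ z ∈ F) ∧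
      (∀ F : IntermediateField k K, t ∈ F → w ∈ F → x ∈ F → z ∈ F → x₀ ∈ F ∧ z₀ ∈ F) ∧
      x ^ 2 - (1 - t ^ 2) * z ^ 2 = (t * w + 2) ^ 2 - (1 - t ^ 2) * (t ^ 2 + 4) := by
  obtain ⟨L, hLd⟩ : ∃ L, L = t * ξ + 6 - 2 * t ^ 2 := ⟨_, rfl⟩
  rw [← hLd] at hL hnorm
  obtain ⟨f, hfd⟩ : ∃ f, f = t * w + 3 - t ^ 2 := ⟨_, rfl⟩
  obtain ⟨x, hx⟩ : ∃ x, x = (x₀ * f - 3 * (1 - t ^ 2) * z₀) / (2 * L) := ⟨_, rfl⟩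
  obtain ⟨z, hz⟩ : ∃ z, z = (z₀ * f - 3 * x₀) / (2 * L) := ⟨_, rfl⟩
  have hx' : x * (2 * L) = x₀ * f - 3 * (1 - t ^ 2) * z₀ := by
    rw [hx, div_mul_cancel₀ _ (mul_ne_zero h2 hL)]
  have hz' : z * (2 * L) = z₀ * f - 3 * x₀ := by
    rw [hz, div_mul_cancel₀ _ (mul_ne_zero h2 hL)]
  have hf : f ^ 2 - 9 * (1 - t ^ 2) = t * w * L := by
    rw [hLd, hfd]; linear_combination t ^ 2 * hξ
  have hx₁ : x₀ = 2 * (x * f + 3 * (1 - t ^ 2) * z) / (t * w) := by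
    rw [eq_div_iff (mul_ne_zero ht0 hw0)]
    apply mul_right_cancel₀ hL
    linear_combination -f * hx' - 3 * (1 - t ^ 2) * hz' - x₀ * hf
  have hz₁ : z₀ = 2 * (z * f + 3 * x) / (t * w) := by
    rw [eq_div_iff (mul_ne_zero ht0 hw0)]
    apply mul_right_cancel₀ hL
    linear_combination -f * hz' - 3 * hx' - z₀ * hf
  have hF : ∀ F : IntermediateField k K, t ∈ F → w ∈ F → f ∈ F ∧ L ∈ F := by
    intro F ht hw
    have hξF : ξ ∈ F := by
      rw [eq_div_of_mul_eq hw0 hξ.symm]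
      apply_rules [add_mem, pow_mem, div_mem, ofNat_mem]
    rw [hfd, hLd]
    constructor <;> apply_rules [add_mem, sub_mem, mul_mem, pow_mem, ofNat_mem]
  refine ⟨x, z, ?_, ?_, ?_⟩
  · intro F ht hw hx₀ hz₀
    obtain ⟨hfF, hLF⟩ := hF F ht hw
    rw [hx, hz]
    constructor <;>
      apply_rules [add_mem, sub_mem, mul_mem, ofNat_mem, div_mem, one_mem, pow_mem]
  · intro F ht hw hxF hzF
    obtain ⟨hfF, hLF⟩ := hF F ht hw
    rw [hx₁, hz₁]
    constructor <;>
      apply_rules [add_mem, sub_mem, mul_mem, ofNat_mem, div_mem, one_mem, pow_mem]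
  · apply mul_right_cancel₀ (pow_ne_zero 2 (mul_ne_zero h2 hL))
    linear_combination (x * (2 * L) + (x₀ * f - 3 * (1 - t ^ 2) * z₀)) * hx' -
      (1 - t ^ 2) * (z * (2 * L) + (z₀ * f - 3 * x₀)) * hz' +
      (f ^ 2 - 9 * (1 - t ^ 2)) * hnorm + 4 * L * (t * ξ + 4) * hf - 4 * L ^ 2 * t ^ 2 * hξ

theorem exists_norm_equation (h2 : (2 : k) ≠ 0) {t w ξ r y : K}
    (hind : AlgebraicIndependent k ![t, w, r]) (hξ : w ^ 2 + t ^ 2 + 3 = ξ * w)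
    (hE : (2 * t * r - ξ - 2 * t) ^ 2 =
        (ξ ^ 2 + 2 * t * ξ - 8) * y ^ 2 - 2 * (t * ξ + 4) * r ^ 2) :
    ∃ x z : K,
      (∀ F : IntermediateField k K, t ∈ F → w ∈ F → r ∈ F → y ∈ F → x ∈ F ∧ z ∈ F) ∧
      (∀ F : IntermediateField k K, t ∈ F → w ∈ F → x ∈ F → z ∈ F → r ∈ F ∧ y ∈ F) ∧
      x ^ 2 - (1 - t ^ 2) * z ^ 2 = (t * w + 2) ^ 2 - (1 - t ^ 2) * (t ^ 2 + 4) := by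
  have hK2 : (2 : K) ≠ 0 := by
    simpa [map_ofNat] using (map_ne_zero (algebraMap k K)).2 h2
  have ht0 : t ≠ 0 := hind.ne_zero 0
  have hw0 : w ≠ 0 := hind.ne_zero 1
  have h4 : (2 : k) ^ 2 ≠ 0 := pow_ne_zero 2 h2
  have h8 : (2 : k) ^ 3 ≠ 0 := pow_ne_zero 3 h2
  have he : 1 - t ^ 2 ≠ 0 := hind.ne_zero_of_aeval_eq (1 - X 0 ^ 2) 0 (by simp) (by simp)
  have hA : ξ ^ 2 + 2 * t * ξ - 8 ≠ 0 := by
    have h := hind.ne_zero_of_aeval_eq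
      (y := (w ^ 2 + t ^ 2 + 3) ^ 2 + 2 * t * (w ^ 2 + t ^ 2 + 3) * w - 8 * w ^ 2)
      ((X 1 ^ 2 + X 0 ^ 2 + 3) ^ 2 + 2 * X 0 * (X 1 ^ 2 + X 0 ^ 2 + 3) * X 1 - 8 * X 1 ^ 2)
      ![1, 0, 0] (by
        convert pow_ne_zero 4 h2 using 1
        simp [map_ofNat]; norm_num) (by simp [map_ofNat])
    intro h0
    exact h (by rw [hξ]; linear_combination w ^ 2 * h0)
  have hL : t * ξ + 6 - 2 * t ^ 2 ≠ 0 := by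
    have h := hind.ne_zero_of_aeval_eq (y := t * (w ^ 2 + t ^ 2 + 3) + (6 - 2 * t ^ 2) * w)
      (X 0 * (X 1 ^ 2 + X 0 ^ 2 + 3) + (6 - 2 * X 0 ^ 2) * X 1)
      ![1, 0, 0] (by
        convert h4 using 1
        simp [map_ofNat]; norm_num) (by simp [map_ofNat])
    intro h0
    exact h (by rw [hξ]; linear_combination w * h0)
  have hX : ξ + 2 * t ≠ 0 := by
    have h := hind.ne_zero_of_aeval_eq (y := (w ^ 2 + t ^ 2 + 3) + 2 * t * w)
      ((X 1 ^ 2 + X 0 ^ 2 + 3) + 2 * X 0 * X 1)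
      ![1, 0, 0] (by
        convert h4 using 1
        simp [map_ofNat]; norm_num) (by simp [map_ofNat])
    intro h0
    exact h (by rw [hξ]; linear_combination w * h0)
  have hδ : (ξ ^ 2 + 2 * t * ξ - 8) * y - ((2 * t * r - ξ - 2 * t) * (2 * w - ξ) +
      r * (2 * ξ + 8 * t)) ≠ 0 := by
    have h := hind.ne_zero_of_aeval_eq
      ((2 * X 0 * (X 1 ^ 2 + X 0 ^ 2 + 3) + 4 * X 1 + 4 * X 0 ^ 2 * X 1) *
        (2 * X 0 * X 2 * X 1 - (X 1 ^ 2 + X 0 ^ 2 + 3) - 2 * X 0 * X 1) ^ 2 +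
        2 * ((X 1 ^ 2 + X 0 ^ 2 + 3) ^ 2 + 2 * X 0 * (X 1 ^ 2 + X 0 ^ 2 + 3) * X 1 -
          8 * X 1 ^ 2) * (X 0 * (X 1 ^ 2 + X 0 ^ 2 + 3) + 4 * X 1) * X 2 ^ 2 -
        2 * (2 * X 0 * X 2 * X 1 - (X 1 ^ 2 + X 0 ^ 2 + 3) - 2 * X 0 * X 1) *
          (2 * X 1 ^ 2 - (X 1 ^ 2 + X 0 ^ 2 + 3)) * X 2 *
          (2 * (X 1 ^ 2 + X 0 ^ 2 + 3) + 8 * X 0 * X 1) -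
        X 2 ^ 2 * X 1 * (2 * (X 1 ^ 2 + X 0 ^ 2 + 3) + 8 * X 0 * X 1) ^ 2)
      ![1, 0, 0] (by
        convert pow_ne_zero 7 h2 using 1
        simp [map_ofNat]; norm_num) rfl
    intro h0
    apply h
    simp only [map_add, map_sub, map_mul, map_pow, map_ofNat, MvPolynomial.aeval_X,
      Matrix.cons_val_zero, Matrix.cons_val_one, Matrix.cons_val, Fin.isValue]
    rw [hξ]
    linear_combination w ^ 3 * ((ξ ^ 2 + 2 * t * ξ - 8) * hE +
      ((ξ ^ 2 + 2 * t * ξ - 8) * y + ((2 * t * r - ξ - 2 * t) * (2 * w - ξ) +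
        r * (2 * ξ + 8 * t))) * h0 + 4 * (2 * t * r - ξ - 2 * t) ^ 2 * hξ)
  obtain ⟨x₀, z₀, hfwd, hbwd, hnorm⟩ := exists_norm_solution (k := k) hK2 hw0 he hA hL hX hδ hξ hE
  obtain ⟨x, z, hfwd', hbwd', hnorm'⟩ :=
    exists_twisted_norm_solution (k := k) hK2 ht0 hw0 hL hξ hnorm
  refine ⟨x, z, fun F ht hw hr hy => ?_, fun F ht hw hx hz => ?_, hnorm'⟩
  · have h := hfwd F ht hw hr hy
    exact hfwd' F ht hw h.1 h.2
  · have h := hbwd' F ht hw hx hz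
    exact hbwd F ht hw h.1 h.2

theorem exists_generators_of_one (htr : Algebra.trdeg k K = 3) (h2 : (2 : k) ≠ 0) {U V r y : K}
    (hind : AlgebraicIndependent k ![U, V, r]) {n : ℕ}
    (hfin : ∀ F : IntermediateField k K, U ∈ F → V ∈ F → r ∈ F → DegLE F n)
    (hE : (1 - U * V) * r ^ 2 + 2 * (U ^ 2 - U * V + V ^ 2 - 1) * r + 2 = (1 + U * V) * y ^ 2) :
    ∃ f : Fin 3 → K,
      (∀ F : IntermediateField k K, U ∈ F → V ∈ F → r ∈ F → y ∈ F → ∀ j, f j ∈ F) ∧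
      ∀ F : IntermediateField k K, (∀ j, f j ∈ F) → U ∈ F ∧ V ∈ F ∧ r ∈ F ∧ y ∈ F := by
  obtain ⟨t, w, ξ, hfwd, hbwd, hind', hξ, hE'⟩ := exists_cubic_coordinates htr h2 hind hfin hE
  obtain ⟨x, z, hfwd', hbwd', hnorm⟩ := exists_norm_equation h2 hind' hξ hE'
  have ht0 : t ≠ 0 := hind'.ne_zero 0
  have he : 1 - t ^ 2 ≠ 0 := hind'.ne_zero_of_aeval_eq (1 - X 0 ^ 2) 0 (by simp) (by simp)
  have hindz : AlgebraicIndependent k ![t, w, z] := by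
    have hdeg : ∀ F : IntermediateField k K, t ∈ F → w ∈ F → z ∈ F → DegLE F (2 * n) := by
      intro F ht hw hz
      refine DegLE.of_quadratic x 0 (-((1 - t ^ 2) * z ^ 2 +
        ((t * w + 2) ^ 2 - (1 - t ^ 2) * (t ^ 2 + 4)))) (zero_mem _) ?_
        (by linear_combination hnorm) ?_
      · apply_rules [neg_mem, add_mem, sub_mem, mul_mem, pow_mem, one_mem, ofNat_mem]
      · intro B hB hx
        obtain ⟨hr, -⟩ := hbwd' B (hB ht) (hB hw) hx (hB hz)
        obtain ⟨hU, hV⟩ := hbwd B (hB ht) (hB hw)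
        exact hfin B hU hV hr
    have hmem : ∀ i, ![t, w, z] i ∈ IntermediateField.adjoin k (Set.range ![t, w, z]) := fun i =>
      IntermediateField.subset_adjoin _ _ ⟨i, rfl⟩
    exact DegLE.algebraicIndependent htr (hdeg _ (hmem 0) (hmem 1) (hmem 2))
  have hz : z ^ 2 - t ^ 2 - 4 ≠ 0 := hindz.ne_zero_of_aeval_eq (X 2 ^ 2 - X 0 ^ 2 - 4) 0
    (by
      convert neg_ne_zero.2 (pow_ne_zero 2 h2) using 1
      simp [map_ofNat]; norm_num) (by simp [map_ofNat])
  have hxg : (x + (t * w + 2)) * (x - (t * w + 2)) = (1 - t ^ 2) * (z ^ 2 - t ^ 2 - 4) := by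
    linear_combination hnorm
  have hg : x - (t * w + 2) ≠ 0 := fun h => mul_ne_zero he hz (by rw [← hxg, h, mul_zero])
  refine ⟨![t, z, x - (t * w + 2)], ?_, ?_⟩
  · intro F hU hV hr hy
    obtain ⟨ht, hw⟩ := hfwd F hU hV
    obtain ⟨hx, hz⟩ := hfwd' F ht hw hr hy
    intro l
    fin_cases l
    exacts [ht, hz, sub_mem hx (add_mem (mul_mem ht hw) (ofNat_mem F 2))]
  · intro F hF
    have ht : t ∈ F := hF 0
    have hz : z ∈ F := hF 1
    have hgF : x - (t * w + 2) ∈ F := hF 2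
    have hxp : x + (t * w + 2) ∈ F := by
      rw [eq_div_of_mul_eq hg hxg]
      generalize x - (t * w + 2) = g at *
      apply_rules [sub_mem, mul_mem, pow_mem, one_mem, ofNat_mem, div_mem]
    have hK2 : (2 : K) ≠ 0 := by
      simpa [map_ofNat] using (map_ne_zero (algebraMap k K)).2 h2
    have hx : x ∈ F := by
      rw [show x = ((x + (t * w + 2)) + (x - (t * w + 2))) / 2 by field_simp; ring]
      exact div_mem (add_mem hxp hgF) (ofNat_mem F 2)
    have hw : w ∈ F := by
      rw [show w = ((x + (t * w + 2)) - x - 2) / t by field_simp; ring]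
      exact div_mem (sub_mem (sub_mem hxp hx) (ofNat_mem F 2)) ht
    obtain ⟨hU, hV⟩ := hbwd F ht hw
    obtain ⟨hr, hy⟩ := hbwd' F ht hw hx hz
    exact ⟨hU, hV, hr, hy⟩

def circleD (P₁ Q₁ Q₂ P₃ : K) : K := P₁ * P₃ + Q₁ * Q₂ + Q₂ * P₃

def circleN (c P₁ Q₁ P₂ Q₂ P₃ Q₃ : K) : K := P₁ * Q₂ * Q₃ + Q₁ * P₂ * P₃ + c * (P₂ + Q₃)

theorem circle_norm {c P₁ Q₁ P₂ Q₂ P₃ Q₃ : K} (h₁ : P₁ ^ 2 + Q₁ ^ 2 = c)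
    (h₂ : P₂ ^ 2 + Q₂ ^ 2 = c) (h₃ : P₃ ^ 2 + Q₃ ^ 2 = c) :
    circleN c P₁ Q₁ P₂ Q₂ P₃ Q₃ ^ 2 + c * circleD P₁ Q₁ Q₂ P₃ ^ 2 =
    2 * ((P₂ * Q₃ + c) * (P₃ * Q₁ + c) * (P₁ * Q₂ + c)) := by
  unfold circleN circleD
  grind

theorem circle_re {c P₁ Q₁ P₂ Q₂ P₃ Q₃ : K} (h₁ : P₁ ^ 2 + Q₁ ^ 2 = c)
    (h₂ : P₂ ^ 2 + Q₂ ^ 2 = c) (h₃ : P₃ ^ 2 + Q₃ ^ 2 = c) :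
    circleN c P₁ Q₁ P₂ Q₂ P₃ Q₃ * circleN c P₂ Q₂ P₃ Q₃ P₁ Q₁ -
    c * (circleD P₁ Q₁ Q₂ P₃ * circleD P₂ Q₂ Q₃ P₁) =
    2 * ((P₂ * Q₃ + c) * (P₃ * Q₁ + c)) * (Q₁ * P₂) := by
  unfold circleN circleD
  grind

theorem circle_im {c P₁ Q₁ P₂ Q₂ P₃ Q₃ : K} (h₁ : P₁ ^ 2 + Q₁ ^ 2 = c)
    (h₂ : P₂ ^ 2 + Q₂ ^ 2 = c) (h₃ : P₃ ^ 2 + Q₃ ^ 2 = c) :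
    circleN c P₁ Q₁ P₂ Q₂ P₃ Q₃ * circleD P₂ Q₂ Q₃ P₁ +
    circleN c P₂ Q₂ P₃ Q₃ P₁ Q₁ * circleD P₁ Q₁ Q₂ P₃ =
    2 * ((P₂ * Q₃ + c) * (P₃ * Q₁ + c)) * (P₁ + Q₂) := by
  unfold circleN circleD
  grind

theorem circle_sum {c P₁ Q₁ P₂ Q₂ P₃ Q₃ : K} (h₁ : P₁ ^ 2 + Q₁ ^ 2 = c)
    (h₂ : P₂ ^ 2 + Q₂ ^ 2 = c) (h₃ : P₃ ^ 2 + Q₃ ^ 2 = c) :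
    c * (circleD P₁ Q₁ Q₂ P₃ ^ 2 + circleD P₂ Q₂ Q₃ P₁ ^ 2 +
    circleD P₃ Q₃ Q₁ P₂ ^ 2) = (P₁ * P₂ * P₃ - Q₁ * Q₂ * Q₃) ^ 2 +
    2 * ((P₂ * Q₃ + c) * (P₃ * Q₁ + c) * (P₁ * Q₂ + c)) := by
  unfold circleD
  grind

theorem circle_prod {c P₁ Q₁ P₂ Q₂ P₃ Q₃ : K} (h₁ : P₁ ^ 2 + Q₁ ^ 2 = c)
    (h₂ : P₂ ^ 2 + Q₂ ^ 2 = c) (h₃ : P₃ ^ 2 + Q₃ ^ 2 = c) :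
    circleN c P₃ Q₃ P₁ Q₁ P₂ Q₂ * (Q₁ * P₂) -
    c * circleD P₃ Q₃ Q₁ P₂ * (P₁ + Q₂) =
    -(P₁ * P₂ * P₃ + Q₁ * Q₂ * Q₃) * (P₁ * Q₂ + c) := by
  unfold circleN circleD
  grind

structure CircleTriple (c P₁ Q₁ P₂ Q₂ P₃ Q₃ : K) : Prop where
  eq₁ : P₁ ^ 2 + Q₁ ^ 2 = c
  eq₂ : P₂ ^ 2 + Q₂ ^ 2 = c
  eq₃ : P₃ ^ 2 + Q₃ ^ 2 = c
  P₁_ne : P₁ ≠ 0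
  P₂_ne : P₂ ≠ 0
  P₃_ne : P₃ ≠ 0
  Q₁_ne : Q₁ ≠ 0
  Q₂_ne : Q₂ ≠ 0
  Q₃_ne : Q₃ ≠ 0
  H₁_ne : P₂ * Q₃ + c ≠ 0
  H₂_ne : P₃ * Q₁ + c ≠ 0
  H₃_ne : P₁ * Q₂ + c ≠ 0
  D₁_ne : circleD P₁ Q₁ Q₂ P₃ ≠ 0
  D₂_ne : circleD P₂ Q₂ Q₃ P₁ ≠ 0
  D₃_ne : circleD P₃ Q₃ Q₁ P₂ ≠ 0
  W_ne : ((P₃ + Q₁) * (P₂ * Q₃ + c) * (P₁ * Q₂ + c) - (P₂ + Q₃) * Q₁ * P₂ * (P₃ * Q₁ + c)) *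
    (Q₁ * Q₃) + P₁ * P₂ * P₃ ^ 2 * (P₁ + Q₂) * (P₃ * Q₁ + c) ≠ 0

theorem CircleTriple.mem {c P₁ Q₁ P₂ Q₂ P₃ Q₃ : K} (h : CircleTriple c P₁ Q₁ P₂ Q₂ P₃ Q₃)
    {B : IntermediateField k K} (hc : c ∈ B)
    {S₁ C₁ S₂ C₂ S₃ C₃ l : K}
    (hS₁ : S₁ * (P₂ * Q₃ + c) = P₂ + Q₃) (hC₁ : C₁ * (P₂ * Q₃ + c) = Q₂ * P₃)
    (hS₂ : S₂ * (P₃ * Q₁ + c) = P₃ + Q₁) (hC₂ : C₂ * (P₃ * Q₁ + c) = Q₃ * P₁)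
    (hS₃ : S₃ * (P₁ * Q₂ + c) = P₁ + Q₂) (hC₃ : C₃ * (P₁ * Q₂ + c) = Q₁ * P₂)
    (hl : l * (Q₁ * Q₂ * Q₃) = C₁ * C₂ * C₃ * (P₁ * P₂ * P₃))
    (hS₁B : S₁ ∈ B) (hC₁B : C₁ ∈ B) (hS₂B : S₂ ∈ B) (hC₂B : C₂ ∈ B)
    (hS₃B : S₃ ∈ B) (hC₃B : C₃ ∈ B) (hlB : l ∈ B) :
    (P₁ ∈ B ∧ Q₁ ∈ B) ∧ (P₂ ∈ B ∧ Q₂ ∈ B) ∧ P₃ ∈ B ∧ Q₃ ∈ B := by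
  obtain ⟨eq₁, eq₂, eq₃, P₁_ne, P₂_ne, P₃_ne, Q₁_ne, Q₂_ne, Q₃_ne, H₁_ne, H₂_ne, H₃_ne, -, -, -,
    W_ne⟩ := h
  have ne_of {x y z : K} (hy : y ≠ 0) (h : x * z = y) : x ≠ 0 := by
    rintro rfl; exact hy (by rw [← h, zero_mul])
  have hC₁0 := ne_of (mul_ne_zero Q₂_ne P₃_ne) hC₁
  have hC₂0 := ne_of (mul_ne_zero Q₃_ne P₁_ne) hC₂
  have hC₃0 := ne_of (mul_ne_zero Q₁_ne P₂_ne) hC₃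
  have hu₁ : (1 - S₁ * Q₃) * (P₂ * Q₃ + c) = P₃ ^ 2 := by linear_combination -Q₃ * hS₁ - eq₃
  have hu₂ : (1 - S₂ * Q₁) * (P₃ * Q₁ + c) = P₁ ^ 2 := by linear_combination -Q₁ * hS₂ - eq₁
  have hu₃ : (1 - S₃ * Q₂) * (P₁ * Q₂ + c) = P₂ ^ 2 := by linear_combination -Q₂ * hS₃ - eq₂
  have hu₁0 := ne_of (pow_ne_zero 2 P₃_ne) hu₁
  have hu₂0 := ne_of (pow_ne_zero 2 P₁_ne) hu₂
  have hu₃0 := ne_of (pow_ne_zero 2 P₂_ne) hu₃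
  have hP₂ : P₂ * (1 - S₁ * Q₃) = c * S₁ - Q₃ := by
    apply mul_right_cancel₀ H₁_ne
    linear_combination P₂ * hu₁ + P₂ * eq₃ - c * hS₁
  have hQ₂ : Q₂ * (1 - S₁ * Q₃) = C₁ * P₃ := by
    apply mul_right_cancel₀ H₁_ne
    linear_combination Q₂ * hu₁ - P₃ * hC₁
  have hP₁ : P₁ * (1 - S₃ * Q₂) = c * S₃ - Q₂ := by
    apply mul_right_cancel₀ H₃_ne
    linear_combination P₁ * hu₃ + P₁ * eq₂ - c * hS₃
  have hQ₁ : Q₁ * (1 - S₃ * Q₂) = C₃ * P₂ := by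
    apply mul_right_cancel₀ H₃_ne
    linear_combination Q₁ * hu₃ - P₂ * hC₃
  have hP₃ : P₃ * (1 - S₂ * Q₁) = c * S₂ - Q₁ := by
    apply mul_right_cancel₀ H₂_ne
    linear_combination P₃ * hu₂ + P₃ * eq₁ - c * hS₂
  have hQ₃ : Q₃ * (1 - S₂ * Q₁) = C₂ * P₁ := by
    apply mul_right_cancel₀ H₂_ne
    linear_combination Q₃ * hu₂ - P₁ * hC₂
  have hlu : l = (1 - S₁ * Q₃) * (1 - S₂ * Q₁) * (1 - S₃ * Q₂) := by
    apply mul_right_cancel₀ (mul_ne_zero (mul_ne_zero Q₁_ne Q₂_ne) Q₃_ne)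
    rw [hl, show (1 - S₁ * Q₃) * (1 - S₂ * Q₁) * (1 - S₃ * Q₂) * (Q₁ * Q₂ * Q₃) =
      (Q₂ * (1 - S₁ * Q₃)) * (Q₃ * (1 - S₂ * Q₁)) * (Q₁ * (1 - S₃ * Q₂)) by ring, hQ₁, hQ₂, hQ₃]
    ring
  have hl₁ : l = 1 - S₁ * Q₃ - S₃ * C₁ * P₃ - S₂ * C₃ * (c * S₁ - Q₃) := by
    linear_combination hlu - S₂ * (1 - S₁ * Q₃) * hQ₁ - S₃ * hQ₂ - S₂ * C₃ * hP₂
  have hl₃ : l * Q₃ = C₂ * (c * S₃ * (1 - S₁ * Q₃) - C₁ * P₃) := by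
    rw [← hQ₂]
    linear_combination Q₃ * hlu + (1 - S₁ * Q₃) * (1 - S₃ * Q₂) * hQ₃ +
      C₂ * (1 - S₁ * Q₃) * hP₁
  have hP₃' : P₃ * (C₁ * C₂) = c * C₂ * S₃ - (l + c * C₂ * S₁ * S₃) * Q₃ := by
    linear_combination hl₃
  have hCS : C₃ ^ 2 + c * S₃ ^ 2 = 1 := by
    apply mul_right_cancel₀ (pow_ne_zero 2 H₃_ne)
    linear_combination (C₃ * (P₁ * Q₂ + c) + Q₁ * P₂) * hC₃ +
      c * (S₃ * (P₁ * Q₂ + c) + (P₁ + Q₂)) * hS₃ + P₂ ^ 2 * eq₁ + (c - P₁ ^ 2) * eq₂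
  have hden : Q₃ * (C₂ * C₃ * (S₂ - S₁ * C₃) + l * S₃) =
      C₂ * (l - C₃ ^ 2 + c * S₁ * S₂ * C₃) := by
    linear_combination -C₂ * hl₁ + S₃ * hP₃' + (C₂ - C₂ * S₁ * Q₃) * hCS
  have hden0 : C₂ * C₃ * (S₂ - S₁ * C₃) + l * S₃ ≠ 0 := by
    intro h0
    have hV : (S₂ - S₁ * C₃) * (Q₁ * Q₂ * Q₃) + C₁ * S₃ * (P₁ * P₂ * P₃) = 0 := by
      apply mul_left_cancel₀ (mul_ne_zero hC₂0 hC₃0)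
      linear_combination Q₁ * Q₂ * Q₃ * h0 - S₃ * hl
    refine W_ne ((mul_eq_zero.1 ?_).resolve_left Q₂_ne)
    linear_combination (P₂ * Q₃ + c) * (P₃ * Q₁ + c) * (P₁ * Q₂ + c) * hV -
      Q₁ * Q₂ * Q₃ * (P₂ * Q₃ + c) * (P₁ * Q₂ + c) * hS₂ +
      Q₁ * Q₂ * Q₃ * (P₃ * Q₁ + c) * (S₁ * (P₂ * Q₃ + c) * hC₃ + Q₁ * P₂ * hS₁) -
      P₁ * P₂ * P₃ * (P₃ * Q₁ + c) * (C₁ * (P₂ * Q₃ + c) * hS₃ + (P₁ + Q₂) * hC₁)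
  have hQ₃B : Q₃ ∈ B := by
    rw [eq_div_of_mul_eq hden0 hden]
    apply_rules [add_mem, sub_mem, mul_mem, pow_mem, div_mem]
  have hP₃B : P₃ ∈ B := by
    rw [eq_div_of_mul_eq (mul_ne_zero hC₁0 hC₂0) hP₃']
    apply_rules [add_mem, sub_mem, mul_mem, div_mem]
  have hP₂B : P₂ ∈ B := by
    rw [eq_div_of_mul_eq hu₁0 hP₂]
    apply_rules [sub_mem, mul_mem, div_mem, one_mem]
  have hQ₂B : Q₂ ∈ B := by
    rw [eq_div_of_mul_eq hu₁0 hQ₂]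
    apply_rules [sub_mem, mul_mem, div_mem, one_mem]
  have hP₁B : P₁ ∈ B := by
    rw [eq_div_of_mul_eq hu₃0 hP₁]
    apply_rules [sub_mem, mul_mem, div_mem, one_mem]
  have hQ₁B : Q₁ ∈ B := by
    rw [eq_div_of_mul_eq hu₃0 hQ₁]
    apply_rules [sub_mem, mul_mem, div_mem, one_mem]
  exact ⟨⟨hP₁B, hQ₁B⟩, ⟨hP₂B, hQ₂B⟩, hP₃B, hQ₃B⟩

def circleA (c P₁ Q₁ P₂ Q₂ P₃ Q₃ : K) : K :=
  circleN c P₁ Q₁ P₂ Q₂ P₃ Q₃ / (c * circleD P₁ Q₁ Q₂ P₃)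

def circleY (c P₁ Q₁ P₂ Q₂ P₃ Q₃ : K) : K :=
  2 * ((P₂ * Q₃ + c) * (P₃ * Q₁ + c) * (P₁ * Q₂ + c)) * (P₁ * P₂ * P₃ - Q₁ * Q₂ * Q₃) /
    (c ^ 2 * (circleD P₁ Q₁ Q₂ P₃ * circleD P₂ Q₂ Q₃ P₁ * circleD P₃ Q₃ Q₁ P₂))

theorem sq_eq_of_circle {c n₁ d₁ n₂ d₂ n₃ d₃ Λ p : K} (hc : c ≠ 0) (hd₁ : d₁ ≠ 0) (hd₂ : d₂ ≠ 0)
    (hd₃ : d₃ ≠ 0) (h₁ : n₁ ^ 2 + c * d₁ ^ 2 = Λ) (h₂ : n₂ ^ 2 + c * d₂ ^ 2 = Λ)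
    (h₃ : n₃ ^ 2 + c * d₃ ^ 2 = Λ) (h : c * (d₁ ^ 2 + d₂ ^ 2 + d₃ ^ 2) = p ^ 2 + Λ) :
    (Λ * p / (c ^ 2 * (d₁ * d₂ * d₃))) ^ 2 =
      (n₁ / (c * d₁)) ^ 2 + (n₂ / (c * d₂)) ^ 2 + (n₃ / (c * d₃)) ^ 2 -
        c ^ 2 * (n₁ / (c * d₁) * (n₂ / (c * d₂)) * (n₃ / (c * d₃))) ^ 2 + 2 / c := by
  have e₁ : n₁ ^ 2 = Λ - c * d₁ ^ 2 := by linear_combination h₁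
  have e₂ : n₂ ^ 2 = Λ - c * d₂ ^ 2 := by linear_combination h₂
  have e₃ : n₃ ^ 2 = Λ - c * d₃ ^ 2 := by linear_combination h₃
  have e : p ^ 2 = c * (d₁ ^ 2 + d₂ ^ 2 + d₃ ^ 2) - Λ := by linear_combination -h
  simp only [div_pow, mul_pow, e₁, e₂, e₃, e]
  field_simp
  ring

theorem re_div_of_circle {c n₁ d₁ n₂ d₂ h₁ h₂ h₃ q : K} (h2 : (2 : K) ≠ 0) (hc : c ≠ 0)
    (hd₁ : d₁ ≠ 0) (hd₂ : d₂ ≠ 0) (hh₁ : h₁ ≠ 0) (hh₂ : h₂ ≠ 0) (hh₃ : h₃ ≠ 0)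
    (h : n₁ * n₂ - c * (d₁ * d₂) = 2 * (h₁ * h₂) * q) :
    (c ^ 2 * (n₁ / (c * d₁)) * (n₂ / (c * d₂)) - c) * (d₁ * d₂ / (2 * (h₁ * h₂ * h₃))) * h₃ =
      q := by
  field_simp
  linear_combination h

theorem im_div_of_circle {c n₁ d₁ n₂ d₂ h₁ h₂ h₃ q : K} (h2 : (2 : K) ≠ 0) (hc : c ≠ 0)
    (hd₁ : d₁ ≠ 0) (hd₂ : d₂ ≠ 0) (hh₁ : h₁ ≠ 0) (hh₂ : h₂ ≠ 0) (hh₃ : h₃ ≠ 0)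
    (h : n₁ * d₂ + n₂ * d₁ = 2 * (h₁ * h₂) * q) :
    c * (n₁ / (c * d₁) + n₂ / (c * d₂)) * (d₁ * d₂ / (2 * (h₁ * h₂ * h₃))) * h₃ = q := by
  field_simp
  linear_combination h

theorem sum_sub_prod_of_circle {c n₁ d₁ n₂ d₂ n₃ d₃ h₁ h₂ h₃ p q q' : K} (hc : c ≠ 0)
    (hd₁ : d₁ ≠ 0) (hd₂ : d₂ ≠ 0) (hd₃ : d₃ ≠ 0)
    (hre : n₁ * n₂ - c * (d₁ * d₂) = 2 * (h₁ * h₂) * q)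
    (him : n₁ * d₂ + n₂ * d₁ = 2 * (h₁ * h₂) * q')
    (h : n₃ * q - c * d₃ * q' = -p * h₃) :
    n₁ / (c * d₁) + n₂ / (c * d₂) + n₃ / (c * d₃) -
      c * (n₁ / (c * d₁) * (n₂ / (c * d₂)) * (n₃ / (c * d₃))) =
      2 * (h₁ * h₂ * h₃) * p / (c ^ 2 * (d₁ * d₂ * d₃)) := by
  field_simp
  linear_combination -n₃ * hre + c * d₃ * him - 2 * h₁ * h₂ * h

theorem CircleTriple.circleY_sq {c P₁ Q₁ P₂ Q₂ P₃ Q₃ : K} (h : CircleTriple c P₁ Q₁ P₂ Q₂ P₃ Q₃)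
    (hc : c ≠ 0) : circleY c P₁ Q₁ P₂ Q₂ P₃ Q₃ ^ 2 =
      circleA c P₁ Q₁ P₂ Q₂ P₃ Q₃ ^ 2 + circleA c P₂ Q₂ P₃ Q₃ P₁ Q₁ ^ 2 +
        circleA c P₃ Q₃ P₁ Q₁ P₂ Q₂ ^ 2 -
        c ^ 2 * (circleA c P₁ Q₁ P₂ Q₂ P₃ Q₃ * circleA c P₂ Q₂ P₃ Q₃ P₁ Q₁ *
          circleA c P₃ Q₃ P₁ Q₁ P₂ Q₂) ^ 2 + 2 / c := by
  refine sq_eq_of_circle hc h.D₁_ne h.D₂_ne h.D₃_ne (circle_norm h.eq₁ h.eq₂ h.eq₃) ?_ ?_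
    (circle_sum h.eq₁ h.eq₂ h.eq₃)
  · rw [circle_norm h.eq₂ h.eq₃ h.eq₁]; ring
  · rw [circle_norm h.eq₃ h.eq₁ h.eq₂]; ring

theorem CircleTriple.degLE {κ : k} {P₁ Q₁ P₂ Q₂ P₃ Q₃ : K}
    (h : CircleTriple (algebraMap k K κ) P₁ Q₁ P₂ Q₂ P₃ Q₃) (hκ : κ ≠ 0) (h2 : (2 : K) ≠ 0)
    (hgen : ∀ B : IntermediateField k K, P₁ ∈ B → Q₁ ∈ B → P₂ ∈ B → Q₂ ∈ B → P₃ ∈ B → Q₃ ∈ B →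
      B = ⊤) {F : IntermediateField k K}
    (ha₁ : circleA (algebraMap k K κ) P₁ Q₁ P₂ Q₂ P₃ Q₃ ∈ F)
    (ha₂ : circleA (algebraMap k K κ) P₂ Q₂ P₃ Q₃ P₁ Q₁ ∈ F)
    (ha₃ : circleA (algebraMap k K κ) P₃ Q₃ P₁ Q₁ P₂ Q₂ ∈ F)
    (hy : circleY (algebraMap k K κ) P₁ Q₁ P₂ Q₂ P₃ Q₃ ∈ F) : DegLE F 4 := by
  have hcF : ∀ F : IntermediateField k K, algebraMap k K κ ∈ F := fun F => F.algebraMap_mem κ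
  have hc0 : algebraMap k K κ ≠ 0 := by simpa using hκ
  generalize algebraMap k K κ = c at *
  have n₁ := circle_norm h.eq₁ h.eq₂ h.eq₃
  have n₂ := circle_norm h.eq₂ h.eq₃ h.eq₁
  have n₃ := circle_norm h.eq₃ h.eq₁ h.eq₂
  have r₃ := circle_re h.eq₁ h.eq₂ h.eq₃
  have r₁ := circle_re h.eq₂ h.eq₃ h.eq₁
  have r₂ := circle_re h.eq₃ h.eq₁ h.eq₂
  have i₃ := circle_im h.eq₁ h.eq₂ h.eq₃
  have i₁ := circle_im h.eq₂ h.eq₃ h.eq₁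
  have i₂ := circle_im h.eq₃ h.eq₁ h.eq₂
  have hC₃ := re_div_of_circle h2 hc0 h.D₁_ne h.D₂_ne h.H₁_ne h.H₂_ne h.H₃_ne r₃
  have hC₁ := re_div_of_circle h2 hc0 h.D₂_ne h.D₃_ne h.H₂_ne h.H₃_ne h.H₁_ne r₁
  have hC₂ := re_div_of_circle h2 hc0 h.D₃_ne h.D₁_ne h.H₃_ne h.H₁_ne h.H₂_ne r₂
  have hS₃ := im_div_of_circle h2 hc0 h.D₁_ne h.D₂_ne h.H₁_ne h.H₂_ne h.H₃_ne i₃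
  have hS₁ := im_div_of_circle h2 hc0 h.D₂_ne h.D₃_ne h.H₂_ne h.H₃_ne h.H₁_ne i₁
  have hS₂ := im_div_of_circle h2 hc0 h.D₃_ne h.D₁_ne h.H₃_ne h.H₁_ne h.H₂_ne i₂
  have hg := sum_sub_prod_of_circle hc0 h.D₁_ne h.D₂_ne h.D₃_ne r₃ i₃
    (circle_prod h.eq₁ h.eq₂ h.eq₃)
  have hmem := @CircleTriple.mem k K _ _ _ c P₁ Q₁ P₂ Q₂ P₃ Q₃ h
  have hD₁ := h.D₁_ne
  have hD₂ := h.D₂_ne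
  have hD₃ := h.D₃_ne
  have hH₁ := h.H₁_ne
  have hH₂ := h.H₂_ne
  have hH₃ := h.H₃_ne
  have hQQQ := mul_ne_zero (mul_ne_zero h.Q₁_ne h.Q₂_ne) h.Q₃_ne
  simp only [circleA, circleY] at ha₁ ha₂ ha₃ hy
  generalize circleN c P₁ Q₁ P₂ Q₂ P₃ Q₃ = N₁ at *
  generalize circleN c P₂ Q₂ P₃ Q₃ P₁ Q₁ = N₂ at *
  generalize circleN c P₃ Q₃ P₁ Q₁ P₂ Q₂ = N₃ at *
  generalize circleD P₁ Q₁ Q₂ P₃ = D₁ at *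
  generalize circleD P₂ Q₂ Q₃ P₁ = D₂ at *
  generalize circleD P₃ Q₃ Q₁ P₂ = D₃ at *
  clear r₁ r₂ r₃ i₁ i₂ i₃ h
  obtain ⟨Λ, hΛ⟩ : ∃ Λ, Λ = 2 * ((P₂ * Q₃ + c) * (P₃ * Q₁ + c) * (P₁ * Q₂ + c)) := ⟨_, rfl⟩
  have hΛ₁ : 2 * ((P₃ * Q₁ + c) * (P₁ * Q₂ + c) * (P₂ * Q₃ + c)) = Λ := by rw [hΛ]; ring
  have hΛ₂ : 2 * ((P₁ * Q₂ + c) * (P₂ * Q₃ + c) * (P₃ * Q₁ + c)) = Λ := by rw [hΛ]; ring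
  rw [hΛ₁] at hC₁ hS₁ n₂
  rw [hΛ₂] at hC₂ hS₂ n₃
  rw [← hΛ] at hC₃ hS₃ hg hy n₁
  have hΛ0 : Λ ≠ 0 := hΛ ▸ mul_ne_zero h2 (mul_ne_zero (mul_ne_zero hH₁ hH₂) hH₃)
  clear hΛ hΛ₁ hΛ₂
  have hb₁ : (c ^ 2 * (N₁ / (c * D₁)) ^ 2 + c) * D₁ ^ 2 = Λ := by
    field_simp; linear_combination n₁
  have hb₂ : (c ^ 2 * (N₂ / (c * D₂)) ^ 2 + c) * D₂ ^ 2 = Λ := by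
    field_simp; linear_combination n₂
  have hb₃ : (c ^ 2 * (N₃ / (c * D₃)) ^ 2 + c) * D₃ ^ 2 = Λ := by
    field_simp; linear_combination n₃
  clear n₁ n₂ n₃
  generalize N₁ / (c * D₁) = a₁ at *
  generalize N₂ / (c * D₂) = a₂ at *
  generalize N₃ / (c * D₃) = a₃ at *
  obtain ⟨y, hyd⟩ : ∃ y, y = Λ * (P₁ * P₂ * P₃ - Q₁ * Q₂ * Q₃) / (c ^ 2 * (D₁ * D₂ * D₃)) :=
    ⟨_, rfl⟩
  rw [← hyd] at hy
  obtain ⟨g, hgd⟩ : ∃ g, g = a₁ + a₂ + a₃ - c * (a₁ * a₂ * a₃) := ⟨_, rfl⟩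
  rw [← hgd] at hg
  have hM : c ^ 2 * (D₁ * D₂ * D₃) ≠ 0 :=
    mul_ne_zero (pow_ne_zero 2 hc0) (mul_ne_zero (mul_ne_zero hD₁ hD₂) hD₃)
  have hsub : (g - y) * (c ^ 2 * (D₁ * D₂ * D₃)) = 2 * Λ * (Q₁ * Q₂ * Q₃) := by
    rw [hg, hyd]; field_simp; ring
  have hadd : (g + y) * (c ^ 2 * (D₁ * D₂ * D₃)) = 2 * Λ * (P₁ * P₂ * P₃) := by
    rw [hg, hyd]; field_simp; ring
  have hgy : g - y ≠ 0 := by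
    intro h0
    rw [h0, zero_mul] at hsub
    exact mul_ne_zero (mul_ne_zero h2 hΛ0) hQQQ hsub.symm
  have hl (t : K) : t * ((g + y) / (g - y)) * (Q₁ * Q₂ * Q₃) = t * (P₁ * P₂ * P₃) := by
    rw [mul_assoc]
    congr 1
    rw [div_mul_eq_mul_div, div_eq_iff hgy]
    apply mul_left_cancel₀ (mul_ne_zero (mul_ne_zero h2 hΛ0) hM)
    linear_combination -2 * Λ * (P₁ * P₂ * P₃) * hsub + 2 * Λ * (Q₁ * Q₂ * Q₃) * hadd
  clear hg hyd hM hsub hadd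
  have hb₁0 : c ^ 2 * a₁ ^ 2 + c ≠ 0 := left_ne_zero_of_mul (hb₁ ▸ hΛ0)
  have hb₂0 : c ^ 2 * a₂ ^ 2 + c ≠ 0 := left_ne_zero_of_mul (hb₂ ▸ hΛ0)
  have hb₃0 : c ^ 2 * a₃ ^ 2 + c ≠ 0 := left_ne_zero_of_mul (hb₃ ▸ hΛ0)
  refine DegLE.of_quadratic (n := 2 * 1) (D₂ * D₃ / Λ) 0
    (-(1 / ((c ^ 2 * a₂ ^ 2 + c) * (c ^ 2 * a₃ ^ 2 + c)))) (zero_mem F) ?_ ?_ ?_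
  · have hcF := hcF F
    clear hl
    apply_rules [neg_mem, add_mem, mul_mem, pow_mem, one_mem, div_mem]
  · rw [zero_mul, add_zero, ← sub_eq_add_neg, sub_eq_zero, div_pow, div_eq_div_iff
      (pow_ne_zero 2 hΛ0) (mul_ne_zero hb₂0 hb₃0)]
    linear_combination D₃ ^ 2 * (c ^ 2 * a₃ ^ 2 + c) * hb₂ + Λ * hb₃
  intro F₁ hF₁ he₁
  refine DegLE.of_quadratic (D₃ * D₁ / Λ) 0
    (-(1 / ((c ^ 2 * a₃ ^ 2 + c) * (c ^ 2 * a₁ ^ 2 + c)))) (zero_mem F₁) ?_ ?_ ?_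
  · have hcF := hcF F₁
    replace ha₁ := hF₁ ha₁
    replace ha₃ := hF₁ ha₃
    clear hl hF₁
    apply_rules [neg_mem, add_mem, mul_mem, pow_mem, one_mem, div_mem]
  · rw [zero_mul, add_zero, ← sub_eq_add_neg, sub_eq_zero, div_pow, div_eq_div_iff
      (pow_ne_zero 2 hΛ0) (mul_ne_zero hb₃0 hb₁0)]
    linear_combination D₁ ^ 2 * (c ^ 2 * a₁ ^ 2 + c) * hb₃ + Λ * hb₁
  intro B hB he₂
  replace ha₁ := hB (hF₁ ha₁)
  replace ha₂ := hB (hF₁ ha₂)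
  replace ha₃ := hB (hF₁ ha₃)
  replace hy := hB (hF₁ hy)
  replace he₁ := hB he₁
  have hcB := hcF B
  have he₃ : D₁ * D₂ / Λ ∈ B := by
    rw [show D₁ * D₂ / Λ = D₂ * D₃ / Λ * (D₃ * D₁ / Λ) * (c ^ 2 * a₃ ^ 2 + c) by
      field_simp; linear_combination -hb₃]
    generalize D₂ * D₃ / Λ = e₁ at *
    generalize D₃ * D₁ / Λ = e₂ at *
    clear hB hF₁ hl
    apply_rules [add_mem, mul_mem, pow_mem]
  have hgB : g ∈ B := by
    rw [hgd]
    clear hB hF₁ hl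
    apply_rules [add_mem, sub_mem, mul_mem]
  generalize D₂ * D₃ / Λ = e₁ at *
  generalize D₃ * D₁ / Λ = e₂ at *
  generalize D₁ * D₂ / Λ = e₃ at *
  clear hB hF₁
  obtain ⟨h₁, h₂, h₃⟩ := hmem hcB hS₁ hC₁ hS₂ hC₂ hS₃ hC₃ (hl _)
    (by apply_rules [add_mem, sub_mem, mul_mem, pow_mem])
    (by apply_rules [add_mem, sub_mem, mul_mem, pow_mem])
    (by apply_rules [add_mem, sub_mem, mul_mem, pow_mem])
    (by apply_rules [add_mem, sub_mem, mul_mem, pow_mem])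
    (by apply_rules [add_mem, sub_mem, mul_mem, pow_mem])
    (by apply_rules [add_mem, sub_mem, mul_mem, pow_mem])
    (by
      refine mul_mem (mul_mem (mul_mem ?_ ?_) ?_) (div_mem (add_mem hgB hy) (sub_mem hgB hy)) <;>
        apply_rules [add_mem, sub_mem, mul_mem, pow_mem])
  rw [hgen B h₁.1 h₁.2 h₂.1 h₂.2 h₃.1 h₃.2]
  exact degLE_top

theorem algebraicIndependent_of_degLE_vec (htr : Algebra.trdeg k K = 3) {u v w : K} {n : ℕ}
    (h : ∀ F : IntermediateField k K, u ∈ F → v ∈ F → w ∈ F → DegLE F n) :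
    AlgebraicIndependent k ![u, v, w] := by
  have hmem (j : Fin 3) : ![u, v, w] j ∈ IntermediateField.adjoin k (Set.range ![u, v, w]) :=
    IntermediateField.subset_adjoin _ _ ⟨j, rfl⟩
  exact DegLE.algebraicIndependent htr (h _ (hmem 0) (hmem 1) (hmem 2))

/-- The intermediate field of elements fixed by `φ`. -/
def fixedBy (φ : K ≃ₐ[k] K) : IntermediateField k K :=
  (AlgHom.equalizer (φ : K →ₐ[k] K) (AlgHom.id k K)).toIntermediateField fun x hx => by
    rw [AlgHom.mem_equalizer] at hx ⊢
    rw [map_inv₀, map_inv₀, hx]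

theorem exists_invariant_generators (htr : Algebra.trdeg k K = 3) {κ : k} (hκ : κ ≠ 0)
    (h2 : (2 : k) ≠ 0) {a₁ a₂ a₃ y : K}
    (hy : y ^ 2 = a₁ ^ 2 + a₂ ^ 2 + a₃ ^ 2 - algebraMap k K κ ^ 2 * (a₁ * a₂ * a₃) ^ 2 +
      2 / algebraMap k K κ)
    (hdeg : ∀ F : IntermediateField k K, a₁ ∈ F → a₂ ∈ F → a₃ ∈ F → y ∈ F → DegLE F 4)
    (hconic : ∀ U V r z : K, AlgebraicIndependent k ![U, V, r] →
      (∀ F : IntermediateField k K, U ∈ F → V ∈ F → r ∈ F → DegLE F (2 * 12)) →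
      (1 - algebraMap k K κ * U * V) * r ^ 2 +
        2 * (algebraMap k K κ * (U ^ 2 - U * V + V ^ 2) - 1) * r + 2 =
        (1 + algebraMap k K κ * U * V) * z ^ 2 →
      ∃ f : Fin 3 → K,
        (∀ F : IntermediateField k K, U ∈ F → V ∈ F → r ∈ F → z ∈ F → ∀ j, f j ∈ F) ∧
        ∀ F : IntermediateField k K, (∀ j, f j ∈ F) → U ∈ F ∧ V ∈ F ∧ r ∈ F ∧ z ∈ F) :
    ∃ f : Fin 3 → K, (∀ φ : K ≃ₐ[k] K, φ (a₁ + a₂ + a₃) = a₁ + a₂ + a₃ →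
      φ (masudaU a₁ a₂ a₃) = masudaU a₁ a₂ a₃ → φ (masudaV a₁ a₂ a₃) = masudaV a₁ a₂ a₃ →
      φ y = y → ∀ j, φ (f j) = f j) ∧
      DegLE (IntermediateField.adjoin k (Set.range f)) 12 := by
  have hcF : ∀ F : IntermediateField k K, algebraMap k K κ ∈ F := fun F => F.algebraMap_mem κ
  have hinda : AlgebraicIndependent k ![a₁, a₂, a₃] := by
    refine algebraicIndependent_of_degLE_vec htr (n := 2 * 4) fun F h₁ h₂ h₃ => ?_
    refine DegLE.of_quadratic y 0 (-(a₁ ^ 2 + a₂ ^ 2 + a₃ ^ 2 -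
      algebraMap k K κ ^ 2 * (a₁ * a₂ * a₃) ^ 2 + 2 / algebraMap k K κ)) (zero_mem F) ?_
      (by linear_combination hy) fun B hB hyB => hdeg B (hB h₁) (hB h₂) (hB h₃) hyB
    have := hcF F
    apply_rules [add_mem, sub_mem, mul_mem, pow_mem, div_mem, neg_mem, ofNat_mem]
  obtain ⟨hN, hab, hac⟩ := hinda.masuda_ne_zero
  simp only [Matrix.cons_val] at hN hab hac
  have he₂ := masuda_e2 hN
  have he₃ := masuda_e3 hN
  have hfin : ∀ F : IntermediateField k K, a₁ + a₂ + a₃ ∈ F → masudaU a₁ a₂ a₃ ∈ F →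
      masudaV a₁ a₂ a₃ ∈ F → y ∈ F → DegLE F (3 * 4) := fun F hs hU hV hyF =>
    DegLE.of_masuda hN hab hac hs hU hV fun B hB h₁ h₂ h₃ => hdeg B h₁ h₂ h₃ (hB hyF)
  obtain ⟨s, hs⟩ : ∃ s, s = a₁ + a₂ + a₃ := ⟨_, rfl⟩
  obtain ⟨e, he⟩ : ∃ e, e = a₁ * a₂ + a₂ * a₃ + a₃ * a₁ := ⟨_, rfl⟩
  obtain ⟨p, hp⟩ : ∃ p, p = a₁ * a₂ * a₃ := ⟨_, rfl⟩
  have hy' : y ^ 2 = s ^ 2 - 2 * e - algebraMap k K κ ^ 2 * p ^ 2 + 2 / algebraMap k K κ := by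
    rw [hy, hs, he, hp]; ring
  rw [← hs] at he₂ he₃ hfin ⊢
  rw [← he] at he₂
  rw [← hp] at he₃
  generalize masudaU a₁ a₂ a₃ = U at *
  generalize masudaV a₁ a₂ a₃ = V at *
  rw [he₂, he₃] at hy'
  have hindU : AlgebraicIndependent k ![s, U, V] := by
    refine algebraicIndependent_of_degLE_vec htr (n := 2 * 12) fun F h₁ h₂ h₃ => ?_
    refine DegLE.of_quadratic y 0 (-(s ^ 2 - 2 * (s * (U + V) - 3 * (U ^ 2 - U * V + V ^ 2)) -
      algebraMap k K κ ^ 2 * (s * (U * V) - (U + V) * (U ^ 2 - U * V + V ^ 2)) ^ 2 +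
      2 / algebraMap k K κ)) (zero_mem F) ?_
      (by linear_combination hy') fun B hB hyB => hfin B (hB h₁) (hB h₂) (hB h₃) hyB
    have := hcF F
    apply_rules [add_mem, sub_mem, mul_mem, pow_mem, div_mem, neg_mem, ofNat_mem]; assumption
  obtain ⟨r, z, hrz, hsy, hE, hind, hdeg'⟩ := exists_conic_bundle htr hκ h2 hindU hy' hfin
  obtain ⟨f, hf, hf'⟩ := hconic U V r z hind hdeg' hE
  refine ⟨f, fun φ h₁ h₂ h₃ h₄ => ?_, ?_⟩
  · obtain ⟨hr, hz⟩ := hrz (fixedBy φ) h₁ h₂ h₃ h₄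
    exact hf (fixedBy φ) h₂ h₃ hr hz
  · obtain ⟨hU, hV, hr, hz⟩ := hf' (IntermediateField.adjoin k (Set.range f)) fun j =>
      IntermediateField.subset_adjoin k _ ⟨j, rfl⟩
    obtain ⟨hs, hy⟩ := hsy _ hU hV hr hz
    exact hfin _ hs hU hV hy

theorem circleA_sign {s₁ s₂ s₃ : K} (h₁ : s₁ ^ 2 = 1) (h₂ : s₂ ^ 2 = 1)
    (h : s₁ * s₂ * s₃ = 1) (c P₁ Q₁ P₂ Q₂ P₃ Q₃ : K) :
    circleA c (s₁ * P₁) (s₃ * Q₁) (s₂ * P₂) (s₁ * Q₂) (s₃ * P₃) (s₂ * Q₃) =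
      circleA c P₁ Q₁ P₂ Q₂ P₃ Q₃ := by
  have hs : s₁ * s₃ = s₂ := by linear_combination s₂ * h - s₁ * s₃ * h₂
  have hs' : s₂ ≠ 0 := by rintro rfl; simp at h
  have hN : circleN c (s₁ * P₁) (s₃ * Q₁) (s₂ * P₂) (s₁ * Q₂) (s₃ * P₃) (s₂ * Q₃) =
      s₂ * circleN c P₁ Q₁ P₂ Q₂ P₃ Q₃ := by
    unfold circleN
    have h₃ : s₃ ^ 2 = 1 := by
      linear_combination (s₁ * s₃ + s₂) * hs + h₂ - s₃ ^ 2 * h₁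
    linear_combination s₂ * P₁ * Q₂ * Q₃ * h₁ + s₂ * Q₁ * P₂ * P₃ * h₃
  have hD : circleD (s₁ * P₁) (s₃ * Q₁) (s₁ * Q₂) (s₃ * P₃) = s₂ * circleD P₁ Q₁ Q₂ P₃ := by
    unfold circleD
    linear_combination (P₁ * P₃ + Q₁ * Q₂ + Q₂ * P₃) * hs
  rw [circleA, circleA, hN, hD, mul_left_comm, mul_div_mul_left _ _ hs']

theorem circleY_sign {s₁ s₂ s₃ : K} (h₁ : s₁ ^ 2 = 1) (h₂ : s₂ ^ 2 = 1)
    (h : s₁ * s₂ * s₃ = 1) (c P₁ Q₁ P₂ Q₂ P₃ Q₃ : K) :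
    circleY c (s₁ * P₁) (s₃ * Q₁) (s₂ * P₂) (s₁ * Q₂) (s₃ * P₃) (s₂ * Q₃) =
      circleY c P₁ Q₁ P₂ Q₂ P₃ Q₃ := by
  have hs : s₁ * s₃ = s₂ := by linear_combination s₂ * h - s₁ * s₃ * h₂
  have h₃ : s₃ ^ 2 = 1 := by
    linear_combination (s₁ * s₃ + s₂) * hs + h₂ - s₃ ^ 2 * h₁
  have hH {s P Q : K} (hs : s ^ 2 = 1) : s * P * (s * Q) = P * Q := by
    linear_combination P * Q * hs
  unfold circleY
  congr 1
  · rw [hH h₂, hH h₃, hH h₁]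
    congr 1
    linear_combination (P₁ * P₂ * P₃ - Q₁ * Q₂ * Q₃) * h
  · congr 1
    unfold circleD
    have hD₁ : s₁ * P₁ * (s₃ * P₃) + s₃ * Q₁ * (s₁ * Q₂) + s₁ * Q₂ * (s₃ * P₃) =
        s₁ * s₃ * (P₁ * P₃ + Q₁ * Q₂ + Q₂ * P₃) := by ring
    have hD₂ : s₂ * P₂ * (s₁ * P₁) + s₁ * Q₂ * (s₂ * Q₃) + s₂ * Q₃ * (s₁ * P₁) =
        s₁ * s₂ * (P₂ * P₁ + Q₂ * Q₃ + Q₃ * P₁) := by ring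
    have hD₃ : s₃ * P₃ * (s₂ * P₂) + s₂ * Q₃ * (s₃ * Q₁) + s₃ * Q₁ * (s₂ * P₂) =
        s₂ * s₃ * (P₃ * P₂ + Q₃ * Q₁ + Q₁ * P₂) := by ring
    rw [hD₁, hD₂, hD₃]
    linear_combination (P₁ * P₃ + Q₁ * Q₂ + Q₂ * P₃) * (P₂ * P₁ + Q₂ * Q₃ + Q₃ * P₁) *
      (P₃ * P₂ + Q₃ * Q₁ + Q₁ * P₂) * (s₁ * s₂ * s₃ + 1) * h

theorem circleY_cycle (c P₁ Q₁ P₂ Q₂ P₃ Q₃ : K) :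
    circleY c P₂ Q₂ P₃ Q₃ P₁ Q₁ = circleY c P₁ Q₁ P₂ Q₂ P₃ Q₃ := by
  unfold circleY
  congr 1 <;> ring

theorem masudaU_cycle (a b c : K) : masudaU b c a = masudaU a b c := by
  unfold masudaU masudaN
  congr 1 <;> ring

theorem masudaV_cycle (a b c : K) : masudaV b c a = masudaV a b c := by
  unfold masudaV masudaN
  congr 1 <;> ring

theorem map_circleA (φ : K ≃ₐ[k] K) (κ : k) (P₁ Q₁ P₂ Q₂ P₃ Q₃ : K) :
    φ (circleA (algebraMap k K κ) P₁ Q₁ P₂ Q₂ P₃ Q₃) =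
      circleA (algebraMap k K κ) (φ P₁) (φ Q₁) (φ P₂) (φ Q₂) (φ P₃) (φ Q₃) := by
  simp [circleA, circleN, circleD]

theorem map_circleY (φ : K ≃ₐ[k] K) (κ : k) (P₁ Q₁ P₂ Q₂ P₃ Q₃ : K) :
    φ (circleY (algebraMap k K κ) P₁ Q₁ P₂ Q₂ P₃ Q₃) =
      circleY (algebraMap k K κ) (φ P₁) (φ Q₁) (φ P₂) (φ Q₂) (φ P₃) (φ Q₃) := by
  simp [circleY, circleD, map_ofNat]

theorem map_masudaU (φ : K ≃ₐ[k] K) (a b c : K) :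
    φ (masudaU a b c) = masudaU (φ a) (φ b) (φ c) := by
  simp [masudaU, masudaN, map_ofNat]

theorem map_masudaV (φ : K ≃ₐ[k] K) (a b c : K) :
    φ (masudaV a b c) = masudaV (φ a) (φ b) (φ c) := by
  simp [masudaV, masudaN, map_ofNat]

theorem CircleTriple.exists_fixed_generators (htr : Algebra.trdeg k K = 3) {κ : k} (hκ : κ ≠ 0)
    (h2 : (2 : k) ≠ 0) {P₁ Q₁ P₂ Q₂ P₃ Q₃ : K}
    (h : CircleTriple (algebraMap k K κ) P₁ Q₁ P₂ Q₂ P₃ Q₃)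
    (hgen : ∀ B : IntermediateField k K, P₁ ∈ B → Q₁ ∈ B → P₂ ∈ B → Q₂ ∈ B → P₃ ∈ B → Q₃ ∈ B →
      B = ⊤)
    (hconic : ∀ U V r z : K, AlgebraicIndependent k ![U, V, r] →
      (∀ F : IntermediateField k K, U ∈ F → V ∈ F → r ∈ F → DegLE F (2 * 12)) →
      (1 - algebraMap k K κ * U * V) * r ^ 2 +
        2 * (algebraMap k K κ * (U ^ 2 - U * V + V ^ 2) - 1) * r + 2 =
        (1 + algebraMap k K κ * U * V) * z ^ 2 →
      ∃ f : Fin 3 → K,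
        (∀ F : IntermediateField k K, U ∈ F → V ∈ F → r ∈ F → z ∈ F → ∀ j, f j ∈ F) ∧
        ∀ F : IntermediateField k K, (∀ j, f j ∈ F) → U ∈ F ∧ V ∈ F ∧ r ∈ F ∧ z ∈ F) :
    ∃ f : Fin 3 → K, DegLE (IntermediateField.adjoin k (Set.range f)) 12 ∧
      (∀ (φ : K ≃ₐ[k] K) (s₁ s₂ s₃ : K), s₁ ^ 2 = 1 → s₂ ^ 2 = 1 → s₁ * s₂ * s₃ = 1 →
        φ P₁ = s₁ * P₁ → φ Q₁ = s₃ * Q₁ → φ P₂ = s₂ * P₂ → φ Q₂ = s₁ * Q₂ → φ P₃ = s₃ * P₃ →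
        φ Q₃ = s₂ * Q₃ → ∀ j, φ (f j) = f j) ∧
      ∀ φ : K ≃ₐ[k] K, φ P₁ = P₂ → φ Q₁ = Q₂ → φ P₂ = P₃ → φ Q₂ = Q₃ → φ P₃ = P₁ → φ Q₃ = Q₁ →
        ∀ j, φ (f j) = f j := by
  have hK2 : (2 : K) ≠ 0 := by
    simpa [map_ofNat] using (map_ne_zero (algebraMap k K)).2 h2
  have hc0 : algebraMap k K κ ≠ 0 := by simpa using hκ
  obtain ⟨f, hf, hdeg⟩ := exists_invariant_generators htr hκ h2 (h.circleY_sq hc0)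
    (fun F => h.degLE hκ hK2 hgen) hconic
  refine ⟨f, hdeg, fun φ s₁ s₂ s₃ h₁ h₂ hs hP₁ hQ₁ hP₂ hQ₂ hP₃ hQ₃ => ?_,
    fun φ hP₁ hQ₁ hP₂ hQ₂ hP₃ hQ₃ => ?_⟩
  · have h₃ : s₃ ^ 2 = 1 := by
      linear_combination (s₁ * s₂ * s₃ + 1) * hs - s₃ ^ 2 * s₂ ^ 2 * h₁ - s₃ ^ 2 * h₂
    have hs' : s₂ * s₃ * s₁ = 1 := by linear_combination hs
    have hs'' : s₃ * s₁ * s₂ = 1 := by linear_combination hs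
    refine hf φ ?_ ?_ ?_ ?_ <;>
      simp only [map_add, map_masudaU, map_masudaV, map_circleA, map_circleY, hP₁, hQ₁, hP₂, hQ₂,
        hP₃, hQ₃, circleA_sign h₁ h₂ hs, circleA_sign h₂ h₃ hs', circleA_sign h₃ h₁ hs'',
        circleY_sign h₁ h₂ hs]
  · refine hf φ ?_ ?_ ?_ ?_ <;>
      simp only [map_add, map_masudaU, map_masudaV, map_circleA, map_circleY, hP₁, hQ₁, hP₂, hQ₂,
        hP₃, hQ₃]
    · ring
    · exact masudaU_cycle _ _ _
    · exact masudaV_cycle _ _ _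
    · exact circleY_cycle _ _ _ _ _ _ _

section
variable {E : Type u} [Field E] [Algebra k E]

/-- The element `z` of `k(x₁, x₂, x₃)` is defined at the point `p`, with value `e`. -/
def HasValueAt (k : Type u) {K E : Type u} [Field k] [Field K] [Algebra k K] [Field E]
    [Algebra k E] (x : Fin 3 → K) (p : Fin 3 → E) (z : K) (e : E) : Prop :=
  ∃ n d : MvPolynomial (Fin 3) k, MvPolynomial.aeval p d ≠ 0 ∧
    MvPolynomial.aeval x d * z = MvPolynomial.aeval x n ∧
    MvPolynomial.aeval p d * e = MvPolynomial.aeval p n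

variable {x : Fin 3 → K} {p : Fin 3 → E} {z w : K} {e e' : E}

theorem HasValueAt.ne_zero (h : HasValueAt k x p z e) (hx : AlgebraicIndependent k x)
    (he : e ≠ 0) : z ≠ 0 := by
  rintro rfl
  obtain ⟨n, d, hd, h₁, h₂⟩ := h
  have : n = 0 := hx (by rw [← h₁, mul_zero, map_zero])
  rw [this, map_zero] at h₂
  exact mul_ne_zero hd he h₂

theorem HasValueAt.var (j : Fin 3) : HasValueAt k x p (x j) (p j) :=
  ⟨X j, 1, by simp, by simp, by simp⟩

theorem HasValueAt.const (r : k) :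
    HasValueAt k x p (algebraMap k K r) (algebraMap k E r) :=
  ⟨MvPolynomial.C r, 1, by simp, by simp, by simp⟩

theorem HasValueAt.add (hz : HasValueAt k x p z e) (hw : HasValueAt k x p w e') :
    HasValueAt k x p (z + w) (e + e') := by
  obtain ⟨n₁, d₁, hd₁, h₁, h₁'⟩ := hz
  obtain ⟨n₂, d₂, hd₂, h₂, h₂'⟩ := hw
  refine ⟨n₁ * d₂ + n₂ * d₁, d₁ * d₂, by simp [hd₁, hd₂], ?_, ?_⟩ <;>
    simp only [map_add, map_mul, ← h₁, ← h₂, ← h₁', ← h₂'] <;> ring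

theorem HasValueAt.mul (hz : HasValueAt k x p z e) (hw : HasValueAt k x p w e') :
    HasValueAt k x p (z * w) (e * e') := by
  obtain ⟨n₁, d₁, hd₁, h₁, h₁'⟩ := hz
  obtain ⟨n₂, d₂, hd₂, h₂, h₂'⟩ := hw
  refine ⟨n₁ * n₂, d₁ * d₂, by simp [hd₁, hd₂], ?_, ?_⟩ <;>
    simp only [map_mul, ← h₁, ← h₂, ← h₁', ← h₂'] <;> ring

theorem HasValueAt.sub (hz : HasValueAt k x p z e) (hw : HasValueAt k x p w e') :
    HasValueAt k x p (z - w) (e - e') := by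
  obtain ⟨n₁, d₁, hd₁, h₁, h₁'⟩ := hz
  obtain ⟨n₂, d₂, hd₂, h₂, h₂'⟩ := hw
  refine ⟨n₁ * d₂ - n₂ * d₁, d₁ * d₂, by simp [hd₁, hd₂], ?_, ?_⟩ <;>
    simp only [map_sub, map_mul, ← h₁, ← h₂, ← h₁', ← h₂'] <;> ring

theorem HasValueAt.div (hx : AlgebraicIndependent k x) (hz : HasValueAt k x p z e)
    (hw : HasValueAt k x p w e') (he' : e' ≠ 0) : HasValueAt k x p (z / w) (e / e') := by
  have hw0 := hw.ne_zero hx he'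
  obtain ⟨n₁, d₁, hd₁, h₁, h₁'⟩ := hz
  obtain ⟨n₂, d₂, hd₂, h₂, h₂'⟩ := hw
  refine ⟨n₁ * d₂, d₁ * n₂, by simp [hd₁, ← h₂', hd₂, he'], ?_, ?_⟩ <;>
    simp only [map_mul, ← h₁, ← h₂, ← h₁', ← h₂'] <;> field_simp

theorem CircleTriple.of_hasValueAt (hx : AlgebraicIndependent k x) {κ : k} (hκ : κ ≠ 0)
    {P₁ Q₁ P₂ Q₂ P₃ Q₃ : K} (eq₁ : P₁ ^ 2 + Q₁ ^ 2 = algebraMap k K κ)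
    (eq₂ : P₂ ^ 2 + Q₂ ^ 2 = algebraMap k K κ) (eq₃ : P₃ ^ 2 + Q₃ ^ 2 = algebraMap k K κ)
    (hQ₁ : Q₁ ≠ 0) (hQ₂ : Q₂ ≠ 0) (hQ₃ : Q₃ ≠ 0) (he : e ≠ 0)
    (sP₁ : HasValueAt k x p P₁ e) (sP₂ : HasValueAt k x p P₂ e)
    (sP₃ : HasValueAt k x p P₃ e) (sQ₁ : HasValueAt k x p Q₁ 0)
    (sQ₂ : HasValueAt k x p Q₂ 0) (sQ₃ : HasValueAt k x p Q₃ 0) :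
    CircleTriple (algebraMap k K κ) P₁ Q₁ P₂ Q₂ P₃ Q₃ := by
  have sc := HasValueAt.const (x := x) (p := p) κ
  have hκE : algebraMap k E κ ≠ 0 := by simpa using hκ
  have hD {P P' Q Q' : K} (hP : HasValueAt k x p P e) (hP' : HasValueAt k x p P' e)
      (hQ : HasValueAt k x p Q 0) (hQ' : HasValueAt k x p Q' 0) : circleD P Q Q' P' ≠ 0 :=
    (((hP.mul hP').add (hQ.mul hQ')).add (hQ'.mul hP')).ne_zero hx (by simp [he])
  have hH {P Q : K} (hP : HasValueAt k x p P e) (hQ : HasValueAt k x p Q 0) :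
      P * Q + algebraMap k K κ ≠ 0 :=
    ((hP.mul hQ).add sc).ne_zero hx (by simp [hκ])
  refine ⟨eq₁, eq₂, eq₃, sP₁.ne_zero hx he, sP₂.ne_zero hx he, sP₃.ne_zero hx he, hQ₁, hQ₂, hQ₃,
    hH sP₂ sQ₃, hH sP₃ sQ₁, hH sP₁ sQ₂, hD sP₁ sP₃ sQ₁ sQ₂, hD sP₂ sP₁ sQ₂ sQ₃,
    hD sP₃ sP₂ sQ₃ sQ₁, ?_⟩
  rw [pow_two P₃]
  refine ((((((sP₃.add sQ₁).mul ((sP₂.mul sQ₃).add sc)).mul ((sP₁.mul sQ₂).add sc)).sub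
    ((((sP₂.add sQ₃).mul sQ₁).mul sP₂).mul ((sP₃.mul sQ₁).add sc))).mul (sQ₁.mul sQ₃)).add
    ((((sP₁.mul sP₂).mul (sP₃.mul sP₃)).mul (sP₁.add sQ₂)).mul ((sP₃.mul sQ₁).add sc))).ne_zero hx
    ?_
  simp [he, hκ]

end

theorem exists_fixed_generators_of_sqrt (htr : Algebra.trdeg k K = 3) {a r : k} (ha : a ≠ 0)
    (h2 : (2 : k) ≠ 0) (hr : r ^ 2 = a) {x₁ x₂ x₃ : K}
    (hx : AlgebraicIndependent k ![x₁, x₂, x₃])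
    (hgen : ∀ B : IntermediateField k K, x₁ ∈ B → x₂ ∈ B → x₃ ∈ B → B = ⊤) :
    ∃ f : Fin 3 → K, DegLE (IntermediateField.adjoin k (Set.range f)) 12 ∧
      (∀ φ : K ≃ₐ[k] K, φ x₁ = algebraMap k K a * x₁⁻¹ → φ x₂ = -algebraMap k K a * x₂⁻¹ →
        φ x₃ = -x₃ → ∀ j, φ (f j) = f j) ∧
      (∀ φ : K ≃ₐ[k] K, φ x₁ = -algebraMap k K a * x₁⁻¹ → φ x₂ = -x₂ →
        φ x₃ = algebraMap k K a * x₃⁻¹ → ∀ j, φ (f j) = f j) ∧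
      (∀ φ : K ≃ₐ[k] K, φ x₁ = -x₁ → φ x₂ = algebraMap k K a * x₂⁻¹ →
        φ x₃ = -algebraMap k K a * x₃⁻¹ → ∀ j, φ (f j) = f j) ∧
      ∀ φ : K ≃ₐ[k] K, φ x₁ = x₂ → φ x₂ = x₃ → φ x₃ = x₁ → ∀ j, φ (f j) = f j := by
  have hK2 : (2 : K) ≠ 0 := by
    simpa [map_ofNat] using (map_ne_zero (algebraMap k K)).2 h2
  have hc0 : algebraMap k K a ≠ 0 := by simpa using ha
  have hr0 : algebraMap k K r ≠ 0 := by
    rw [_root_.map_ne_zero]; rintro rfl; exact ha (by simpa using hr.symm)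
  have hrc : algebraMap k K r ^ 2 = algebraMap k K a := by rw [← map_pow, hr]
  have hx₀ (j : Fin 3) : ![x₁, x₂, x₃] j ≠ 0 := hx.ne_zero j
  have hd (j : Fin 3) : ![x₁, x₂, x₃] j ^ 2 + algebraMap k K a ≠ 0 :=
    hx.ne_zero_of_aeval_eq (X j ^ 2 + MvPolynomial.C a) 0 (by simpa using ha) (by simp)
  obtain ⟨P, hP⟩ : ∃ P : K → K, P = fun t => (t ^ 2 - algebraMap k K a) /
    (t ^ 2 + algebraMap k K a) := ⟨_, rfl⟩
  obtain ⟨Q, hQ⟩ : ∃ Q : K → K, Q = fun t => 2 * algebraMap k K r * t /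
    (t ^ 2 + algebraMap k K a) := ⟨_, rfl⟩
  have hPQ (j : Fin 3) : P (![x₁, x₂, x₃] j) ^ 2 + Q (![x₁, x₂, x₃] j) ^ 2 = algebraMap k K 1 := by
    have := hd j
    rw [hP, hQ, map_one]
    field_simp
    linear_combination 4 * ![x₁, x₂, x₃] j ^ 2 * hrc
  have hQ0 (j : Fin 3) : Q (![x₁, x₂, x₃] j) ≠ 0 := by
    rw [hQ]
    exact div_ne_zero (mul_ne_zero (mul_ne_zero hK2 hr0) (hx₀ j)) (hd j)
  have sd (j : Fin 3) := (HasValueAt.mul (.var j) (.var j)).add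
    (HasValueAt.const (x := ![x₁, x₂, x₃]) (p := (0 : Fin 3 → k)) a)
  have sP (j : Fin 3) : HasValueAt k ![x₁, x₂, x₃] (0 : Fin 3 → k) (P (![x₁, x₂, x₃] j)) (-1) := by
    have := HasValueAt.div hx ((HasValueAt.mul (.var j) (.var j)).sub (.const a)) (sd j)
      (by simpa using ha)
    simpa [hP, pow_two, neg_div, ha] using this
  have sQ (j : Fin 3) : HasValueAt k ![x₁, x₂, x₃] (0 : Fin 3 → k) (Q (![x₁, x₂, x₃] j)) 0 := by
    have := HasValueAt.div hx (HasValueAt.mul (.const (2 * r)) (.var j)) (sd j)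
      (by simpa using ha)
    simpa [hQ, pow_two, map_ofNat] using this
  have hT : CircleTriple (algebraMap k K 1) (P x₁) (Q x₁) (P x₂) (Q x₂) (P x₃) (Q x₃) :=
    .of_hasValueAt hx one_ne_zero (hPQ 0) (hPQ 1) (hPQ 2) (hQ0 0) (hQ0 1) (hQ0 2)
      (neg_ne_zero.2 one_ne_zero) (sP 0) (sP 1) (sP 2) (sQ 0) (sQ 1) (sQ 2)
  have hmem (B : IntermediateField k K) (j : Fin 3) (hPB : P (![x₁, x₂, x₃] j) ∈ B)
      (hQB : Q (![x₁, x₂, x₃] j) ∈ B) : ![x₁, x₂, x₃] j ∈ B := by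
    have hrB : algebraMap k K r ∈ B := B.algebraMap_mem r
    have : ![x₁, x₂, x₃] j = algebraMap k K r * (1 + P (![x₁, x₂, x₃] j)) /
        Q (![x₁, x₂, x₃] j) := by
      rw [eq_div_iff (hQ0 j), hP, hQ]
      have := hd j
      field_simp
      ring
    rw [this]
    apply_rules [div_mem, mul_mem, add_mem, one_mem]
  obtain ⟨f, hdeg, hsign, hcyc⟩ := hT.exists_fixed_generators htr one_ne_zero h2
    (fun B h₁ h₁' h₂ h₂' h₃ h₃' => hgen B (hmem B 0 h₁ h₁') (hmem B 1 h₂ h₂') (hmem B 2 h₃ h₃'))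
    (fun U V r z hind hfin hE => exists_generators_of_one htr h2 hind hfin (by simpa using hE))
  have inv (φ : K ≃ₐ[k] K) (j : Fin 3)
      (h : φ (![x₁, x₂, x₃] j) = algebraMap k K a * (![x₁, x₂, x₃] j)⁻¹) :
      φ (P (![x₁, x₂, x₃] j)) = -1 * P (![x₁, x₂, x₃] j) ∧
        φ (Q (![x₁, x₂, x₃] j)) = 1 * Q (![x₁, x₂, x₃] j) := by
    have := hd j
    have := hx₀ j
    have : algebraMap k K a + ![x₁, x₂, x₃] j ^ 2 ≠ 0 := by rw [add_comm]; exact hd j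
    constructor <;> simp [hP, hQ, h, map_ofNat] <;> field_simp <;> ring
  have neg_inv (φ : K ≃ₐ[k] K) (j : Fin 3)
      (h : φ (![x₁, x₂, x₃] j) = -algebraMap k K a * (![x₁, x₂, x₃] j)⁻¹) :
      φ (P (![x₁, x₂, x₃] j)) = -1 * P (![x₁, x₂, x₃] j) ∧
        φ (Q (![x₁, x₂, x₃] j)) = -1 * Q (![x₁, x₂, x₃] j) := by
    have := hd j
    have := hx₀ j
    have : algebraMap k K a + ![x₁, x₂, x₃] j ^ 2 ≠ 0 := by rw [add_comm]; exact hd j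
    constructor <;> simp [hP, hQ, h, map_ofNat] <;> field_simp <;> ring
  have neg (φ : K ≃ₐ[k] K) (j : Fin 3) (h : φ (![x₁, x₂, x₃] j) = -![x₁, x₂, x₃] j) :
      φ (P (![x₁, x₂, x₃] j)) = 1 * P (![x₁, x₂, x₃] j) ∧
        φ (Q (![x₁, x₂, x₃] j)) = -1 * Q (![x₁, x₂, x₃] j) := by
    constructor <;> simp [hP, hQ, h, map_ofNat, neg_div]
  refine ⟨f, hdeg, fun φ h₁ h₂ h₃ => ?_, fun φ h₁ h₂ h₃ => ?_, fun φ h₁ h₂ h₃ => ?_,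
    fun φ h₁ h₂ h₃ => ?_⟩
  · obtain ⟨hP₁, hQ₁⟩ := inv φ 0 h₁
    obtain ⟨hP₂, hQ₂⟩ := neg_inv φ 1 h₂
    obtain ⟨hP₃, hQ₃⟩ := neg φ 2 h₃
    exact hsign φ (-1) (-1) 1 (by norm_num) (by norm_num) (by norm_num) hP₁ hQ₁ hP₂ hQ₂ hP₃ hQ₃
  · obtain ⟨hP₁, hQ₁⟩ := neg_inv φ 0 h₁
    obtain ⟨hP₂, hQ₂⟩ := neg φ 1 h₂
    obtain ⟨hP₃, hQ₃⟩ := inv φ 2 h₃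
    exact hsign φ (-1) 1 (-1) (by norm_num) (by norm_num) (by norm_num) hP₁ hQ₁ hP₂ hQ₂ hP₃ hQ₃
  · obtain ⟨hP₁, hQ₁⟩ := neg φ 0 h₁
    obtain ⟨hP₂, hQ₂⟩ := inv φ 1 h₂
    obtain ⟨hP₃, hQ₃⟩ := neg_inv φ 2 h₃
    exact hsign φ 1 (-1) (-1) (by norm_num) (by norm_num) (by norm_num) hP₁ hQ₁ hP₂ hQ₂ hP₃ hQ₃
  · refine hcyc φ ?_ ?_ ?_ ?_ ?_ ?_ <;> simp [hP, hQ, h₁, h₂, h₃, map_ofNat]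

theorem exists_fixed_generators_of_sqrt_neg_one (htr : Algebra.trdeg k K = 3) {a i : k}
    (ha : a ≠ 0) (h2 : (2 : k) ≠ 0) (hi : i ^ 2 = -1) {x₁ x₂ x₃ : K}
    (hx : AlgebraicIndependent k ![x₁, x₂, x₃])
    (hgen : ∀ B : IntermediateField k K, x₁ ∈ B → x₂ ∈ B → x₃ ∈ B → B = ⊤) :
    ∃ f : Fin 3 → K, DegLE (IntermediateField.adjoin k (Set.range f)) 12 ∧
      (∀ φ : K ≃ₐ[k] K, φ x₁ = algebraMap k K a * x₁⁻¹ → φ x₂ = -algebraMap k K a * x₂⁻¹ →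
        φ x₃ = -x₃ → ∀ j, φ (f j) = f j) ∧
      (∀ φ : K ≃ₐ[k] K, φ x₁ = -algebraMap k K a * x₁⁻¹ → φ x₂ = -x₂ →
        φ x₃ = algebraMap k K a * x₃⁻¹ → ∀ j, φ (f j) = f j) ∧
      ∀ φ : K ≃ₐ[k] K, φ x₁ = x₂ → φ x₂ = x₃ → φ x₃ = x₁ → ∀ j, φ (f j) = f j := by
  have hK2 : (2 : K) ≠ 0 := by
    simpa [map_ofNat] using (map_ne_zero (algebraMap k K)).2 h2
  have hi0 : algebraMap k K i ≠ 0 := by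
    rw [_root_.map_ne_zero]; rintro rfl; simp at hi
  have hic : algebraMap k K i ^ 2 = -1 := by rw [← map_pow, hi, map_neg, map_one]
  have hx₀ (j : Fin 3) : ![x₁, x₂, x₃] j ≠ 0 := hx.ne_zero j
  have hd (j : Fin 3) : ![x₁, x₂, x₃] j ^ 2 - algebraMap k K a ≠ 0 :=
    hx.ne_zero_of_aeval_eq (X j ^ 2 - MvPolynomial.C a) 0 (by simpa using ha) (by simp)
  obtain ⟨P, hP⟩ : ∃ P : K → K, P = fun t => (t ^ 2 + algebraMap k K a) / (2 * t) := ⟨_, rfl⟩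
  obtain ⟨Q, hQ⟩ : ∃ Q : K → K, Q = fun t => algebraMap k K i * (t ^ 2 - algebraMap k K a) /
    (2 * t) := ⟨_, rfl⟩
  have hPQ (j : Fin 3) : P (![x₁, x₂, x₃] j) ^ 2 + Q (![x₁, x₂, x₃] j) ^ 2 = algebraMap k K a := by
    have := hx₀ j
    rw [hP, hQ]
    field_simp
    linear_combination (![x₁, x₂, x₃] j ^ 2 - algebraMap k K a) ^ 2 * hic
  have hQ0 (j : Fin 3) : Q (![x₁, x₂, x₃] j) ≠ 0 := by
    rw [hQ]
    exact div_ne_zero (mul_ne_zero hi0 (hd j)) (mul_ne_zero hK2 (hx₀ j))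
  obtain ⟨t, ht⟩ := IsAlgClosed.exists_pow_nat_eq (algebraMap k (AlgebraicClosure k) a) two_pos
  have ht0 : t ≠ 0 := by rintro rfl; exact ha (by simpa using ht.symm)
  have hE2 : (2 : AlgebraicClosure k) ≠ 0 := by
    simpa [map_ofNat] using (map_ne_zero (algebraMap k (AlgebraicClosure k))).2 h2
  have sd (j : Fin 3) := HasValueAt.mul (.const 2)
    (.var (k := k) (x := ![x₁, x₂, x₃]) (p := fun _ => t) j)
  have sP (j : Fin 3) : HasValueAt k ![x₁, x₂, x₃] (fun _ => t) (P (![x₁, x₂, x₃] j)) t := by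
    have := HasValueAt.div hx ((HasValueAt.mul (.var j) (.var j)).add (.const a)) (sd j)
      (by simp [map_ofNat, hE2, ht0])
    have he : (t * t + algebraMap k (AlgebraicClosure k) a) / (2 * t) = t := by
      rw [← ht]; field_simp; ring
    simpa [hP, pow_two, map_ofNat, he] using this
  have sQ (j : Fin 3) : HasValueAt k ![x₁, x₂, x₃] (fun _ => t) (Q (![x₁, x₂, x₃] j)) 0 := by
    have := HasValueAt.div hx (HasValueAt.mul (.const i)
      ((HasValueAt.mul (.var j) (.var j)).sub (.const a))) (sd j) (by simp [map_ofNat, hE2, ht0])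
    simpa [hQ, pow_two, map_ofNat, ← ht] using this
  have hT : CircleTriple (algebraMap k K a) (P x₁) (Q x₁) (P x₂) (Q x₂) (P x₃) (Q x₃) :=
    .of_hasValueAt hx ha (hPQ 0) (hPQ 1) (hPQ 2) (hQ0 0) (hQ0 1) (hQ0 2)
      ht0 (sP 0) (sP 1) (sP 2) (sQ 0) (sQ 1) (sQ 2)
  have hmem (B : IntermediateField k K) (j : Fin 3) (hPB : P (![x₁, x₂, x₃] j) ∈ B)
      (hQB : Q (![x₁, x₂, x₃] j) ∈ B) : ![x₁, x₂, x₃] j ∈ B := by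
    have hiB : algebraMap k K i ∈ B := B.algebraMap_mem i
    have : ![x₁, x₂, x₃] j = P (![x₁, x₂, x₃] j) - algebraMap k K i * Q (![x₁, x₂, x₃] j) := by
      rw [hP, hQ]
      have := hx₀ j
      field_simp
      linear_combination (![x₁, x₂, x₃] j ^ 2 - algebraMap k K a) * hic
    rw [this]
    exact sub_mem hPB (mul_mem hiB hQB)
  obtain ⟨f, hdeg, hsign, hcyc⟩ := hT.exists_fixed_generators htr ha h2
    (fun B h₁ h₁' h₂ h₂' h₃ h₃' => hgen B (hmem B 0 h₁ h₁') (hmem B 1 h₂ h₂') (hmem B 2 h₃ h₃'))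
    (fun U V r z hind _ hE => exists_generators_of_sqrt_neg_one ha h2 hi hind hE)
  have hc0 : algebraMap k K a ≠ 0 := by simpa using ha
  have inv (φ : K ≃ₐ[k] K) (j : Fin 3)
      (h : φ (![x₁, x₂, x₃] j) = algebraMap k K a * (![x₁, x₂, x₃] j)⁻¹) :
      φ (P (![x₁, x₂, x₃] j)) = 1 * P (![x₁, x₂, x₃] j) ∧
        φ (Q (![x₁, x₂, x₃] j)) = -1 * Q (![x₁, x₂, x₃] j) := by
    have := hx₀ j
    constructor <;> simp [hP, hQ, h, map_ofNat] <;> field_simp <;> ring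
  have neg_inv (φ : K ≃ₐ[k] K) (j : Fin 3)
      (h : φ (![x₁, x₂, x₃] j) = -algebraMap k K a * (![x₁, x₂, x₃] j)⁻¹) :
      φ (P (![x₁, x₂, x₃] j)) = -1 * P (![x₁, x₂, x₃] j) ∧
        φ (Q (![x₁, x₂, x₃] j)) = 1 * Q (![x₁, x₂, x₃] j) := by
    have := hx₀ j
    constructor <;> simp [hP, hQ, h, map_ofNat] <;> field_simp <;> ring
  have neg (φ : K ≃ₐ[k] K) (j : Fin 3) (h : φ (![x₁, x₂, x₃] j) = -![x₁, x₂, x₃] j) :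
      φ (P (![x₁, x₂, x₃] j)) = -1 * P (![x₁, x₂, x₃] j) ∧
        φ (Q (![x₁, x₂, x₃] j)) = -1 * Q (![x₁, x₂, x₃] j) := by
    constructor <;> simp [hP, hQ, h, map_ofNat, div_neg]
  refine ⟨f, hdeg, fun φ h₁ h₂ h₃ => ?_, fun φ h₁ h₂ h₃ => ?_, fun φ h₁ h₂ h₃ => ?_⟩
  · obtain ⟨hP₁, hQ₁⟩ := inv φ 0 h₁
    obtain ⟨hP₂, hQ₂⟩ := neg_inv φ 1 h₂
    obtain ⟨hP₃, hQ₃⟩ := neg φ 2 h₃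
    exact hsign φ 1 (-1) (-1) (by norm_num) (by norm_num) (by norm_num) hP₁ hQ₁ hP₂ hQ₂ hP₃ hQ₃
  · obtain ⟨hP₁, hQ₁⟩ := neg_inv φ 0 h₁
    obtain ⟨hP₂, hQ₂⟩ := neg φ 1 h₂
    obtain ⟨hP₃, hQ₃⟩ := inv φ 2 h₃
    exact hsign φ (-1) (-1) 1 (by norm_num) (by norm_num) (by norm_num) hP₁ hQ₁ hP₂ hQ₂ hP₃ hQ₃
  · refine hcyc φ ?_ ?_ ?_ ?_ ?_ ?_ <;> simp [hP, hQ, h₁, h₂, h₃, map_ofNat]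

theorem exists_sqrt_of_finrank_le_two {a : k} {L : Type*} [Field L] [Algebra k L]
    [FiniteDimensional k L] (h2 : (2 : k) ≠ 0) (h : Module.finrank k L ≤ 2) {α β : L}
    (hα : α ^ 2 = algebraMap k L a) (hβ : β ^ 2 = -1) :
    (∃ i : k, i ^ 2 = -1) ∨ (∃ r : k, r ^ 2 = a) ∨ ∃ r : k, r ^ 2 = -a := by
  refine or_iff_not_imp_left.2 fun hi => ?_
  have hinj := (algebraMap k L).injective
  have hβk (u : k) : algebraMap k L u ≠ β := by
    rintro rfl
    exact hi ⟨u, hinj (by simpa using hβ)⟩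
  have hli : LinearIndependent k ![1, β] := by
    rw [LinearIndependent.pair_iff' one_ne_zero]
    intro u hu
    exact hβk u (by rw [← hu, Algebra.algebraMap_eq_smul_one])
  have hspan := hli.span_eq_top_of_card_eq_finrank
    (le_antisymm (by simpa using hli.fintype_card_le_finrank) (by simpa using h))
  have hαs : α ∈ Submodule.span k (Set.range ![1, β]) := hspan ▸ Submodule.mem_top
  rw [Matrix.range_cons_cons_empty, Submodule.mem_span_pair] at hαs
  obtain ⟨u, v, huv⟩ := hαs
  rw [Algebra.smul_def, Algebra.smul_def, mul_one] at huv
  have hsq : algebraMap k L (2 * u * v) * β = algebraMap k L (a - u ^ 2 + v ^ 2) := by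
    simp only [map_mul, map_add, map_sub, map_pow, map_ofNat]
    linear_combination hα - algebraMap k L v ^ 2 * hβ +
      (α + algebraMap k L u + algebraMap k L v * β) * huv
  have huv0 : 2 * u * v = 0 := by
    by_contra h0
    refine hβk ((a - u ^ 2 + v ^ 2) / (2 * u * v)) ?_
    rw [map_div₀, ← hsq, mul_div_cancel_left₀ _ (by simpa using h0)]
  rw [huv0, map_zero, zero_mul, eq_comm, map_eq_zero] at hsq
  rcases mul_eq_zero.1 huv0 with hu | rfl
  · obtain rfl : u = 0 := by simpa [h2] using hu
    exact Or.inr ⟨v, by linear_combination hsq⟩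
  · exact Or.inl ⟨u, by linear_combination -hsq⟩

theorem exists_roots_splittingField (a : k) :
    ∃ α β : ((Polynomial.X ^ 2 - Polynomial.C a) * (Polynomial.X ^ 2 + 1)).SplittingField,
      α ^ 2 = algebraMap k _ a ∧ β ^ 2 = -1 := by
  have hs := SplittingField.splits ((Polynomial.X ^ 2 - Polynomial.C a) * (Polynomial.X ^ 2 + 1))
  rw [Polynomial.map_mul] at hs
  have hd₁ : (Polynomial.X ^ 2 - Polynomial.C a : Polynomial k).degree = 2 :=
    degree_X_pow_sub_C two_pos a
  have hd₂ : (Polynomial.X ^ 2 + 1 : Polynomial k).degree = 2 := by compute_degree!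
  have hne {q : Polynomial k} (hq : q.degree = 2) : q ≠ 0 := by rintro rfl; simp at hq
  obtain ⟨h₁, h₂⟩ := (splits_mul (Polynomial.map_ne_zero (hne hd₁))
    (Polynomial.map_ne_zero (hne hd₂))).1 hs
  obtain ⟨α, hα⟩ := h₁.exists_eval_eq_zero (by simp [-Polynomial.map_sub, hd₁])
  obtain ⟨β, hβ⟩ := h₂.exists_eval_eq_zero (by simp [-Polynomial.map_add, hd₂])
  exact ⟨α, β, by simpa [sub_eq_zero] using hα, by simpa [add_eq_zero_iff_eq_neg] using hβ⟩

theorem isRational_of_eps_eq_neg_one (htr : Algebra.trdeg k K = 3) {x : Fin 3 → K}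
    (hind : AlgebraicIndependent k x)
    (hgen : ∀ B : IntermediateField k K, (∀ i, x i ∈ B) → B = ⊤)
    {a : k} (ha : a ≠ 0) (h2 : (2 : k) ≠ 0)
    (hsq : (∃ i : k, i ^ 2 = -1) ∨ (∃ r : k, r ^ 2 = a) ∨ ∃ r : k, r ^ 2 = -a)
    {τ lam σ : K ≃ₐ[k] K}
    (hτ1 : τ (x 0) = algebraMap k K a * (x 0)⁻¹)
    (hτ2 : τ (x 1) = algebraMap k K (-1 * a) * (x 1)⁻¹)
    (hτ3 : τ (x 2) = algebraMap k K (-1) * x 2)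
    (hlam1 : lam (x 0) = algebraMap k K (-1 * a) * (x 0)⁻¹)
    (hlam2 : lam (x 1) = algebraMap k K (-1) * x 1)
    (hlam3 : lam (x 2) = algebraMap k K a * (x 2)⁻¹)
    (hσ1 : σ (x 0) = x 1) (hσ2 : σ (x 1) = x 2) (hσ3 : σ (x 2) = x 0) :
    IsRational k (IntermediateField.fixedField (Subgroup.closure {τ, lam, σ})) := by
  suffices h : ∃ f : Fin 3 → K, DegLE (IntermediateField.adjoin k (Set.range f)) 12 ∧
      ∀ j, τ (f j) = f j ∧ lam (f j) = f j ∧ σ (f j) = f j by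
    obtain ⟨f, hdeg, hf⟩ := h
    exact isRational_of_monomial_action htr hind hgen ha (Or.inr rfl) hτ1 hτ2 hτ3 hlam1 hlam2
      hlam3 hσ1 hσ2 hσ3 f hf hdeg
  have hx : AlgebraicIndependent k ![x 0, x 1, x 2] := by
    convert hind using 1
    ext j; fin_cases j <;> rfl
  have hgen' (B : IntermediateField k K) (h₀ : x 0 ∈ B) (h₁ : x 1 ∈ B) (h₂ : x 2 ∈ B) : B = ⊤ :=
    hgen B fun j => by fin_cases j <;> assumption
  simp only [map_neg, map_one, neg_mul, one_mul] at hτ2 hτ3 hlam1 hlam2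
  rcases hsq with ⟨i, hi⟩ | ⟨r, hr⟩ | ⟨r, hr⟩
  · obtain ⟨f, hdeg, hfτ, hflam, hfσ⟩ :=
      exists_fixed_generators_of_sqrt_neg_one htr ha h2 hi hx hgen'
    exact ⟨f, hdeg, fun j => ⟨hfτ τ hτ1 (by rw [hτ2, neg_mul]) hτ3 j,
      hflam lam (by rw [hlam1, neg_mul]) hlam2 hlam3 j, hfσ σ hσ1 hσ2 hσ3 j⟩⟩
  · obtain ⟨f, hdeg, hfτ, hflam, -, hfσ⟩ :=
      exists_fixed_generators_of_sqrt htr ha h2 hr hx hgen'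
    exact ⟨f, hdeg, fun j => ⟨hfτ τ hτ1 (by rw [hτ2, neg_mul]) hτ3 j,
      hflam lam (by rw [hlam1, neg_mul]) hlam2 hlam3 j, hfσ σ hσ1 hσ2 hσ3 j⟩⟩
  · have hx' : AlgebraicIndependent k ![x 1, x 0, x 2] := by
      convert hind.comp _ (Equiv.swap (0 : Fin 3) 1).injective using 1
      ext j; fin_cases j <;> rfl
    obtain ⟨f, hdeg, hfτ, -, hflam, hfσ⟩ := exists_fixed_generators_of_sqrt htr
      (neg_ne_zero.2 ha) h2 hr hx' fun B h₁ h₀ h₂ => hgen' B h₀ h₁ h₂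
    refine ⟨f, hdeg, fun j => ⟨hfτ τ ?_ ?_ hτ3 j, hflam lam hlam2 ?_ ?_ j, ?_⟩⟩
    · rw [hτ2, map_neg, neg_mul]
    · rw [hτ1, map_neg, neg_neg]
    · rw [hlam1, map_neg, neg_mul]
    · rw [hlam3, map_neg, neg_neg]
    · have h (y z : K) (hyz : σ y = z) : σ.symm z = y := σ.symm_apply_eq.2 hyz.symm
      exact (σ.symm_apply_eq.1 (hfσ σ.symm (h _ _ hσ1) (h _ _ hσ3) (h _ _ hσ2) j)).symm

theorem eq_top_of_forall_X_mem (B : IntermediateField k (FractionRing (MvPolynomial (Fin 3) k)))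
    (h : ∀ i, algebraMap (MvPolynomial (Fin 3) k) _ (X i) ∈ B) : B = ⊤ := by
  refine eq_top_iff.2 fun z _ => ?_
  have hp (p : MvPolynomial (Fin 3) k) : algebraMap _ (FractionRing _) p ∈ B := by
    induction p using MvPolynomial.induction_on with
    | C r =>
      rw [← MvPolynomial.algebraMap_eq, ← IsScalarTower.algebraMap_apply]
      exact B.algebraMap_mem r
    | add p q hp hq => rw [map_add]; exact add_mem hp hq
    | mul_X p i hp => rw [map_mul]; exact mul_mem hp (h i)
  obtain ⟨p, q, -, rfl⟩ := IsFractionRing.div_surjective (A := MvPolynomial (Fin 3) k) z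
  exact div_mem (hp p) (hp q)

theorem algebraicIndependent_X_fractionRing : AlgebraicIndependent k
    fun i => algebraMap (MvPolynomial (Fin 3) k) (FractionRing (MvPolynomial (Fin 3) k)) (X i) :=
  (MvPolynomial.algebraicIndependent_X (Fin 3) k).map'
    (f := IsScalarTower.toAlgHom k (MvPolynomial (Fin 3) k) _)
    (IsFractionRing.injective (MvPolynomial (Fin 3) k) _)

end

/-- **Hoshi–Kitayama–Yamasaki.** Let `k` be a field, `char k ≠ 2`, `a ∈ kˣ`, `ε = ±1`, and let
`G = ⟨τ, λ, σ⟩ ≅ A₄` act on `k(x₁,x₂,x₃)` by `τ : x₁ ↦ a/x₁, x₂ ↦ εa/x₂, x₃ ↦ εx₃`,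
`λ : x₁ ↦ εa/x₁, x₂ ↦ εx₂, x₃ ↦ a/x₃`, `σ : x₁ ↦ x₂ ↦ x₃ ↦ x₁`. Then:
(1) if `ε = 1` then `k(x₁,x₂,x₃)^G` is `k`-rational;
(2) if `ε = -1` and `[k(√a, √-1) : k] ≤ 2` (the splitting field of `(X²-a)(X²+1)` has degree
at most `2` over `k`) then `k(x₁,x₂,x₃)^G` is `k`-rational. -/
theorem monomial_A4_rational
    (k : Type*) [Field k] (hchar : ringChar k ≠ 2) (a : k) (ha : a ≠ 0)
    (ε : k) (hε : ε = 1 ∨ ε = -1)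
    (τ lam σ : FractionRing (MvPolynomial (Fin 3) k) ≃ₐ[k] FractionRing (MvPolynomial (Fin 3) k))
    (hτ1 : τ (algebraMap (MvPolynomial (Fin 3) k) _ (X 0)) =
      algebraMap k _ a * (algebraMap (MvPolynomial (Fin 3) k) _ (X 0))⁻¹)
    (hτ2 : τ (algebraMap (MvPolynomial (Fin 3) k) _ (X 1)) =
      algebraMap k _ (ε * a) * (algebraMap (MvPolynomial (Fin 3) k) _ (X 1))⁻¹)
    (hτ3 : τ (algebraMap (MvPolynomial (Fin 3) k) _ (X 2)) =
      algebraMap k _ ε * algebraMap (MvPolynomial (Fin 3) k) _ (X 2))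
    (hlam1 : lam (algebraMap (MvPolynomial (Fin 3) k) _ (X 0)) =
      algebraMap k _ (ε * a) * (algebraMap (MvPolynomial (Fin 3) k) _ (X 0))⁻¹)
    (hlam2 : lam (algebraMap (MvPolynomial (Fin 3) k) _ (X 1)) =
      algebraMap k _ ε * algebraMap (MvPolynomial (Fin 3) k) _ (X 1))
    (hlam3 : lam (algebraMap (MvPolynomial (Fin 3) k) _ (X 2)) =
      algebraMap k _ a * (algebraMap (MvPolynomial (Fin 3) k) _ (X 2))⁻¹)
    (hσ1 : σ (algebraMap (MvPolynomial (Fin 3) k) _ (X 0)) =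
      algebraMap (MvPolynomial (Fin 3) k) _ (X 1))
    (hσ2 : σ (algebraMap (MvPolynomial (Fin 3) k) _ (X 1)) =
      algebraMap (MvPolynomial (Fin 3) k) _ (X 2))
    (hσ3 : σ (algebraMap (MvPolynomial (Fin 3) k) _ (X 2)) =
      algebraMap (MvPolynomial (Fin 3) k) _ (X 0)) :
    (ε = 1 → IsRational k (IntermediateField.fixedField (Subgroup.closure {τ, lam, σ}))) ∧
    (ε = -1 →
      Module.finrank k
        (((Polynomial.X ^ 2 - Polynomial.C a) * (Polynomial.X ^ 2 + 1)).SplittingField) ≤ 2 →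
      IsRational k (IntermediateField.fixedField (Subgroup.closure {τ, lam, σ}))) := by
  have h2 : (2 : k) ≠ 0 := Ring.two_ne_zero hchar
  have htr : Algebra.trdeg k (FractionRing (MvPolynomial (Fin 3) k)) = 3 := trdeg_fractionRing
  obtain ⟨x, hx⟩ : ∃ x : Fin 3 → FractionRing (MvPolynomial (Fin 3) k),
    ∀ i, algebraMap (MvPolynomial (Fin 3) k) _ (X i) = x i := ⟨_, fun _ => rfl⟩
  have hind : AlgebraicIndependent k x := by
    rw [← funext hx]; exact algebraicIndependent_X_fractionRing
  have hgen (B : IntermediateField k (FractionRing (MvPolynomial (Fin 3) k)))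
      (h : ∀ i, x i ∈ B) : B = ⊤ :=
    eq_top_of_forall_X_mem B fun i => hx i ▸ h i
  simp only [hx] at hτ1 hτ2 hτ3 hlam1 hlam2 hlam3 hσ1 hσ2 hσ3
  refine ⟨?_, ?_⟩
  · rintro rfl
    simp only [one_mul, map_one] at hτ2 hτ3 hlam1 hlam2
    exact isRational_of_eps_eq_one htr hind hgen ha h2 hτ1 hτ2 hτ3 hlam1 hlam2 hlam3 hσ1 hσ2 hσ3
  · rintro rfl hfin
    obtain ⟨α, β, hα, hβ⟩ := exists_roots_splittingField a
    exact isRational_of_eps_eq_neg_one htr hind hgen ha h2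
      (exists_sqrt_of_finrank_le_two h2 hfin hα hβ) hτ1 hτ2 hτ3 hlam1 hlam2 hlam3 hσ1 hσ2 hσ3
end
end

section
/- Let k be a field with char k ≠ 2, let a ∈ k^× be a non-square, and K = k(√a). Let G = ⟨σ⟩ act on the rational function field K(u,v) by σ: √a ↦ −√a, u ↦ 1/u, v ↦ −1/v. Then K(u,v)^G is k-rational if and only if there exists a Galois field extension L/k with k ⊆ k(√a) ⊆ L and Gal(L/k) isomorphic to the cyclic group C4 of order 4. -/
open MvPolynomial

noncomputable section

/-- If `α ^ 2` lies in the base ring `R`, then every element of `R[α]` has the form `x + y α`. -/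
theorem exists_eq_add_mul_of_mem_adjoin {R A : Type*} [CommRing R] [CommRing A] [Algebra R A]
    {α : A} {a : R} (hα : α ^ 2 = algebraMap R A a) {z : A} (hz : z ∈ Algebra.adjoin R {α}) :
    ∃ x y : R, z = algebraMap R A x + algebraMap R A y * α := by
  induction hz using Algebra.adjoin_induction with
  | mem z hz => exact ⟨0, 1, by rw [Set.mem_singleton_iff.mp hz]; simp⟩
  | algebraMap r => exact ⟨r, 0, by simp⟩
  | add z w _ _ hz hw =>
    obtain ⟨x, y, rfl⟩ := hz
    obtain ⟨x', y', rfl⟩ := hw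
    exact ⟨x + x', y + y', by simp only [map_add]; ring⟩
  | mul z w _ _ hz hw =>
    obtain ⟨x, y, rfl⟩ := hz
    obtain ⟨x', y', rfl⟩ := hw
    refine ⟨x * x' + y * y' * a, x * y' + y * x', ?_⟩
    simp only [map_add, map_mul, ← hα]
    ring

theorem mem_fixedField_zpowers_iff {k Ω : Type*} [Field k] [Field Ω] [Algebra k Ω]
    (σ : Ω ≃ₐ[k] Ω) (z : Ω) :
    z ∈ IntermediateField.fixedField (Subgroup.zpowers σ) ↔ σ z = z := by
  rw [IntermediateField.mem_fixedField_iff]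
  refine ⟨fun h => h σ (Subgroup.mem_zpowers σ), fun h => ?_⟩
  have hle : Subgroup.zpowers σ ≤ MulAction.stabilizer (Ω ≃ₐ[k] Ω) z := by
    simpa [Subgroup.zpowers_le, MulAction.mem_stabilizer_iff] using h
  intro f hf
  simpa [MulAction.mem_stabilizer_iff] using hle hf

/-- A solution of `P² - a Q² + R² = 0` in polynomials with `R ≠ 0` yields a nontrivial solution
in the coefficient ring. -/
theorem exists_isotropic_of_mvPolynomial {R : Type*} [CommRing R] {n : ℕ} {a : R}
    {p q r : MvPolynomial (Fin n) R} (hr : r ≠ 0) (h : p ^ 2 - C a * q ^ 2 + r ^ 2 = 0) :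
    ∃ x y z : R, (x ≠ 0 ∨ y ≠ 0 ∨ z ≠ 0) ∧ x ^ 2 - a * y ^ 2 + z ^ 2 = 0 := by
  classical
  let m : MonomialOrder (Fin n) := MonomialOrder.lex
  obtain ⟨d, hd, hmax⟩ := Finset.exists_max_image (p.support ∪ q.support ∪ r.support) m.toSyn (by
    obtain ⟨e, he⟩ := MvPolynomial.support_nonempty.mpr hr
    exact ⟨e, by simp [Finset.mem_union, he]⟩)
  simp only [Finset.mem_union] at hd hmax
  have hp : m.toSyn (m.degree p) ≤ m.toSyn d :=
    m.degree_le_iff.mpr fun c hc => hmax c (.inl (.inl hc))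
  have hq : m.toSyn (m.degree q) ≤ m.toSyn d :=
    m.degree_le_iff.mpr fun c hc => hmax c (.inl (.inr hc))
  have hr' : m.toSyn (m.degree r) ≤ m.toSyn d :=
    m.degree_le_iff.mpr fun c hc => hmax c (.inr hc)
  refine ⟨p.coeff d, q.coeff d, r.coeff d, ?_, ?_⟩
  · simpa only [MvPolynomial.mem_support_iff, or_assoc] using hd
  · have h2 := congrArg (MvPolynomial.coeff (d + d)) h
    simp only [pow_two, coeff_add, coeff_sub, coeff_C_mul, coeff_zero] at h2
    rw [m.coeff_mul_of_add_of_degree_le hp hp, m.coeff_mul_of_add_of_degree_le hq hq,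
      m.coeff_mul_of_add_of_degree_le hr' hr'] at h2
    simpa only [pow_two] using h2

/-- If `-1` is a norm from `k(x₁, …, xₙ)(√a)`, then it is already a norm from `k(√a)`. -/
theorem exists_norm_eq_neg_one_of_fractionRing {k : Type*} [Field k] {n : ℕ} {a : k}
    (hnsq : ∀ c : k, c ^ 2 ≠ a) {x y : FractionRing (MvPolynomial (Fin n) k)}
    (h : x ^ 2 - algebraMap k _ a * y ^ 2 = -1) : ∃ b c : k, b ^ 2 - a * c ^ 2 = -1 := by
  classical
  obtain ⟨r, hr⟩ := IsLocalization.exist_integer_multiples_of_finset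
    (nonZeroDivisors (MvPolynomial (Fin n) k))
    ({x, y} : Finset (FractionRing (MvPolynomial (Fin n) k)))
  obtain ⟨p, hp⟩ := hr x (by simp)
  obtain ⟨q, hq⟩ := hr y (by simp)
  have hr0 : (r : MvPolynomial (Fin n) k) ≠ 0 := nonZeroDivisors.coe_ne_zero r
  have hpqr : p ^ 2 - C a * q ^ 2 + (r : MvPolynomial (Fin n) k) ^ 2 = 0 := by
    apply IsFractionRing.injective (MvPolynomial (Fin n) k)
      (FractionRing (MvPolynomial (Fin n) k))
    have hC : algebraMap (MvPolynomial (Fin n) k) (FractionRing (MvPolynomial (Fin n) k)) (C a) =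
        algebraMap k _ a := by
      rw [IsScalarTower.algebraMap_apply k (MvPolynomial (Fin n) k)
        (FractionRing (MvPolynomial (Fin n) k)), MvPolynomial.algebraMap_eq]
    simp only [map_add, map_sub, map_mul, map_pow, map_zero, hp, hq, hC, Algebra.smul_def]
    linear_combination
      (algebraMap (MvPolynomial (Fin n) k) (FractionRing (MvPolynomial (Fin n) k)) r) ^ 2 * h
  obtain ⟨b, c, d, hne, h0⟩ := exists_isotropic_of_mvPolynomial hr0 hpqr
  by_cases hd : d = 0
  · subst hd
    by_cases hc : c = 0
    · subst hc
      simp_all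
    · exact absurd (by field_simp; linear_combination h0) (hnsq (b / c))
  · exact ⟨b / d, c / d, by field_simp; linear_combination h0⟩

/-- If `√a` lies in a Galois extension of `k` with group `C₄`, then `-1` is a norm from `k(√a)`. -/
theorem exists_norm_eq_neg_one_of_isGalois {k L : Type*} [Field k] (h2 : (2 : k) ≠ 0) [Field L]
    [Algebra k L] [IsGalois k L] [FiniteDimensional k L] {a : k} (hnsq : ∀ c : k, c ^ 2 ≠ a)
    (e : (L ≃ₐ[k] L) ≃* Multiplicative (ZMod 4)) {α : L} (hα : α ^ 2 = algebraMap k L a) :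
    ∃ b c : k, b ^ 2 - a * c ^ 2 = -1 := by
  have h2L : (2 : L) ≠ 0 := by
    simpa only [map_ofNat] using (map_ne_zero (algebraMap k L)).mpr h2
  obtain ⟨g, hg⟩ : ∃ g, g = e.symm (Multiplicative.ofAdd 1) := ⟨_, rfl⟩
  have hgen : ∀ f : L ≃ₐ[k] L, f ∈ Subgroup.zpowers g := by
    intro f
    refine ⟨((Multiplicative.toAdd (e f)).val : ℤ), ?_⟩
    apply e.injective
    simp only [hg, map_zpow, MulEquiv.apply_symm_apply, ← ofAdd_zsmul]
    apply Multiplicative.toAdd.injective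
    simp
  have hfix : ∀ z : L, g z = z → ∃ c : k, algebraMap k L c = z := by
    intro z hz
    have hmem := (mem_fixedField_zpowers_iff g z).mpr hz
    rw [IntermediateField.mem_fixedField_iff] at hmem
    exact (IsGalois.mem_range_algebraMap_iff_fixed z).mpr fun f => hmem f (hgen f)
  have hg4 : ∀ z, g (g (g (g z))) = z := by
    intro z
    have h4 : g ^ 4 = 1 := by
      apply e.injective
      simp only [hg, map_pow, MulEquiv.apply_symm_apply, map_one]
      decide
    simpa [pow_succ] using DFunLike.congr_fun h4 z
  have hgα : g α = -α := by
    have hsq : (g α) ^ 2 = α ^ 2 := by rw [← map_pow, hα, AlgEquiv.commutes]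
    refine (sq_eq_sq_iff_eq_or_eq_neg.mp hsq).resolve_left fun h => ?_
    obtain ⟨c, rfl⟩ := hfix α h
    exact hnsq c ((algebraMap k L).injective (by rw [map_pow, hα]))
  obtain ⟨w, hw⟩ : ∃ w, g (g w) ≠ w := by
    by_contra! hall
    have h4 : g ^ 2 = 1 := by
      ext z
      simpa [pow_succ] using hall z
    have := congrArg e h4
    simp only [hg, map_pow, MulEquiv.apply_symm_apply, map_one] at this
    exact absurd this (by decide)
  obtain ⟨θ, hθ⟩ : ∃ θ, θ = w - g (g w) := ⟨_, rfl⟩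
  have hθ0 : θ ≠ 0 := by rw [hθ]; exact sub_ne_zero.mpr hw.symm
  have hgθ0 : g θ ≠ 0 := (map_ne_zero g).mpr hθ0
  have hggθ : g (g θ) = -θ := by
    rw [hθ]
    simp [hg4]
  have hα0 : α ≠ 0 := by
    rintro rfl
    exact hnsq 0 ((algebraMap k L).injective (by rw [map_pow, map_zero, hα]))
  obtain ⟨b, hb⟩ := hfix ((g θ / θ + -θ / g θ) / 2) (by
    simp only [map_div₀, map_add, map_neg, hggθ, map_ofNat]
    field_simp
    ring)
  obtain ⟨c, hc⟩ := hfix ((g θ / θ - -θ / g θ) / (2 * α)) (by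
    simp only [map_div₀, map_sub, map_mul, map_neg, hggθ, map_ofNat, hgα]
    field_simp
    ring)
  refine ⟨b, c, (algebraMap k L).injective ?_⟩
  simp only [map_sub, map_mul, map_pow, map_neg, map_one, hb, hc, ← hα]
  field_simp
  ring

/-- If `-1` is a norm from `k(√a)`, then `a` is a sum of two squares. -/
theorem exists_eq_sq_add_sq {k : Type*} [Field k] (h2 : (2 : k) ≠ 0) {a x y : k}
    (h : x ^ 2 - a * y ^ 2 = -1) : ∃ b c : k, a = b ^ 2 + c ^ 2 := by
  by_cases hy : y = 0
  · subst hy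
    refine ⟨(a + 1) / 2, x * (a - 1) / 2, ?_⟩
    field_simp
    linear_combination -(a - 1) ^ 2 * h
  · refine ⟨x / y, 1 / y, ?_⟩
    field_simp
    linear_combination -h

/-- If `a = b² + c²` is a non-square, then `k(√a)(√(a + b√a))` is a Galois extension of `k` with
group `C₄`. -/
theorem exists_isGalois_cyclic_four {k : Type} [Field k] (h2 : (2 : k) ≠ 0) {a b c : k}
    (hnsq : ∀ d : k, d ^ 2 ≠ a) (habc : a = b ^ 2 + c ^ 2) {K : Type} [Field K] [Algebra k K]
    {α : K} (hα : α ^ 2 = algebraMap k K a) (hgen : Algebra.adjoin k ({α} : Set K) = ⊤) :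
    ∃ (L : Type) (_ : Field L) (_ : Algebra k L), IsGalois k L ∧ FiniteDimensional k L ∧
      Nonempty (K →ₐ[k] L) ∧ Nonempty ((L ≃ₐ[k] L) ≃* Multiplicative (ZMod 4)) := by
  have h2K : (2 : K) ≠ 0 := by
    simpa only [map_ofNat] using (map_ne_zero (algebraMap k K)).mpr h2
  have hc0 : c ≠ 0 := by
    rintro rfl
    exact hnsq b (by rw [habc]; ring)
  have ha0 : a ≠ 0 := fun h => hnsq 0 (by rw [h]; ring)
  have hα0 : α ≠ 0 := by
    rintro rfl
    exact ha0 ((algebraMap k K).injective (by rw [map_zero, ← hα]; ring))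
  have hmin : minpoly k α = Polynomial.X ^ 2 - Polynomial.C a := by
    symm
    apply minpoly.eq_of_irreducible_of_monic
    · exact (X_pow_sub_C_irreducible_iff_of_prime Nat.prime_two).mpr hnsq
    · simp [hα]
    · exact Polynomial.monic_X_pow_sub_C a two_ne_zero
  have hint : IsIntegral k α :=
    ⟨Polynomial.X ^ 2 - Polynomial.C a, Polynomial.monic_X_pow_sub_C a two_ne_zero, by simp [hα]⟩
  let pb : PowerBasis k K := (Algebra.adjoin.powerBasis hint).map
    ((Subalgebra.equivOfEq _ _ hgen).trans Subalgebra.topEquiv)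
  have hpbgen : pb.gen = α := rfl
  have hpbdim : pb.dim = 2 := by
    change (minpoly k α).natDegree = 2
    rw [hmin, Polynomial.natDegree_X_pow_sub_C]
  have : FiniteDimensional k K := pb.finite
  let ρ : K →ₐ[k] K := pb.lift (-α) (by rw [hpbgen, hmin]; simp [hα])
  have hρα : ρ α = -α := pb.lift_gen (-α) _
  obtain ⟨γ, hγ⟩ : ∃ γ, γ = algebraMap k K a + algebraMap k K b * α := ⟨_, rfl⟩
  have hργ : ρ γ = algebraMap k K a - algebraMap k K b * α := by
    rw [hγ, map_add, map_mul, AlgHom.commutes, AlgHom.commutes, hρα]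
    ring
  have hγρ : γ * ρ γ = (algebraMap k K c * α) ^ 2 := by
    have := congrArg (algebraMap k K) habc
    simp only [map_add, map_pow] at this
    rw [hργ, hγ]
    linear_combination -algebraMap k K a * hα + α ^ 2 * this
  have hγ0 : γ ≠ 0 := by
    rintro h
    rw [h, zero_mul] at hγρ
    exact pow_ne_zero 2 (mul_ne_zero ((map_ne_zero _).mpr hc0) hα0) hγρ.symm
  have hirr : Irreducible (Polynomial.X ^ 2 - Polynomial.C γ) := by
    refine (X_pow_sub_C_irreducible_iff_of_prime Nat.prime_two).mpr fun δ hδ => ?_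
    obtain ⟨x, y, rfl⟩ := exists_eq_add_mul_of_mem_adjoin hα (z := δ) (by simp [hgen])
    have hN : (x ^ 2 - a * y ^ 2) ^ 2 = c ^ 2 * a := by
      apply (algebraMap k K).injective
      rw [← hδ] at hγρ
      simp only [map_add, map_pow, map_mul, AlgHom.commutes, hρα] at hγρ
      simp only [map_sub, map_pow, map_mul, ← hα]
      linear_combination hγρ
    exact hnsq ((x ^ 2 - a * y ^ 2) / c) (by rw [div_pow, hN]; field_simp)
  have : Fact (Irreducible (Polynomial.X ^ 2 - Polynomial.C γ)) := ⟨hirr⟩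
  let L := AdjoinRoot (Polynomial.X ^ 2 - Polynomial.C γ)
  let θ : L := AdjoinRoot.root _
  have hmonic : (Polynomial.X ^ 2 - Polynomial.C γ).Monic :=
    Polynomial.monic_X_pow_sub_C γ two_ne_zero
  have : FiniteDimensional K L := hmonic.finite_adjoinRoot
  have : FiniteDimensional k L := FiniteDimensional.trans k K L
  have hrank : Module.finrank k L = 4 := by
    rw [← Module.finrank_mul_finrank k K L, pb.finrank, hpbdim,
      (AdjoinRoot.powerBasis' hmonic).finrank]
    simp [AdjoinRoot.powerBasis'_dim]
  have hθ : θ ^ 2 = algebraMap K L γ := by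
    have := AdjoinRoot.eval₂_root (Polynomial.X ^ 2 - Polynomial.C γ)
    simp only [Polynomial.eval₂_sub, Polynomial.eval₂_X_pow, Polynomial.eval₂_C] at this
    exact sub_eq_zero.mp this
  have hθ0 : θ ≠ 0 := by
    intro h
    rw [h, zero_pow two_ne_zero] at hθ
    exact hγ0 ((map_eq_zero _).mp hθ.symm)
  let δ : L := algebraMap K L (algebraMap k K c * α)
  have hδ0 : δ ≠ 0 := by
    simp only [δ, ne_eq, map_eq_zero, mul_eq_zero, not_or]
    exact ⟨hc0, hα0⟩
  have hδ : (δ / θ) ^ 2 = algebraMap K L (ρ γ) := by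
    rw [div_pow, hθ, div_eq_iff ((map_ne_zero _).mpr hγ0), ← map_pow, ← map_mul, mul_comm (ρ γ), hγρ]
  have hroot : (Polynomial.X ^ 2 - Polynomial.C γ).eval₂
      ((IsScalarTower.toAlgHom k K L).comp ρ) (δ / θ) = 0 := by
    simp [Polynomial.eval₂_sub, hδ]
  let ψ : L →ₐ[k] L := AdjoinRoot.liftAlgHom _ ((IsScalarTower.toAlgHom k K L).comp ρ) (δ / θ) hroot
  let τ : L ≃ₐ[k] L := AlgEquiv.ofBijective ψ ψ.bijective
  have hτθ : τ θ = δ / θ := AdjoinRoot.liftAlgHom_root _ _ _ hroot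
  have hτK : ∀ z : K, τ (algebraMap K L z) = algebraMap K L (ρ z) := fun z =>
    AdjoinRoot.liftAlgHom_of _ _ _ hroot z
  have hτδ : τ δ = -δ := by
    simp only [δ, hτK, map_mul, AlgHom.commutes, hρα, map_neg]
    ring
  have hτ2θ : τ (τ θ) = -θ := by
    rw [hτθ, map_div₀, hτδ, hτθ]
    exact (neg_div _ _).trans (congrArg _ (div_div_cancel₀ hδ0))
  have hτ2 : ¬ τ ^ 2 ^ 1 = 1 := by
    intro h
    have h' := DFunLike.congr_fun h θ
    have h3 : -θ = θ := by
      rw [← hτ2θ]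
      simpa [pow_succ] using h'
    have h2L : (2 : L) ≠ 0 := by
      simpa only [map_ofNat] using (map_ne_zero (algebraMap K L)).mpr h2K
    exact mul_ne_zero h2L hθ0 (by linear_combination -h3)
  have hρρ : ∀ z, ρ (ρ z) = z := by
    intro z
    have : ρ.comp ρ = AlgHom.id k K := pb.algHom_ext (by simp [hpbgen, hρα])
    exact DFunLike.congr_fun this z
  have hτ4 : τ ^ 2 ^ (1 + 1) = 1 := by
    ext z
    obtain ⟨p, q, rfl⟩ := exists_eq_add_mul_of_mem_adjoin hθ (z := z)
      (by rw [AdjoinRoot.adjoinRoot_eq_top]; trivial)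
    have h4 : ∀ w, (τ ^ 2 ^ (1 + 1)) w = τ (τ (τ (τ w))) := fun w => by simp [pow_succ]
    rw [h4]
    simp only [map_add, map_mul, hτK, hρρ, hτ2θ, map_neg, AlgEquiv.one_apply]
    exact congrArg (fun w => algebraMap K L p + algebraMap K L q * w) (neg_neg θ)
  have hord : orderOf τ = 4 := by
    simpa using orderOf_eq_prime_pow hτ2 hτ4
  have hcard : Nat.card (L ≃ₐ[k] L) = 4 := by
    apply le_antisymm
    · rw [← hrank, Nat.card_congr (algEquivEquivAlgHom k L).toEquiv]
      exact card_algHom_le_finrank k L L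
    · rw [← hord]
      exact orderOf_le_card
  have hcyc : IsCyclic (L ≃ₐ[k] L) := isCyclic_of_orderOf_eq_card τ (by rw [hord, hcard])
  refine ⟨L, inferInstance, inferInstance,
    IsGalois.of_card_aut_eq_finrank k L (by rw [hcard, hrank]), inferInstance,
    ⟨IsScalarTower.toAlgHom k K L⟩, ⟨mulEquivOfCyclicCardEq ?_⟩⟩
  rw [hcard]
  simp

open scoped IntermediateField.algebraAdjoinAdjoin in
/-- Let `σ` act on `k(√a)(u, v)` by `√a ↦ -√a`, `u ↦ u⁻¹`, `v ↦ -v⁻¹`. If `-1` is a norm from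
`k(√a)`, then the fixed field of `σ` is rational over `k`. -/
theorem isRational_fixedField_of_norm_eq_neg_one {k Ω : Type*} [Field k] (h2 : (2 : k) ≠ 0)
    [Field Ω] [Algebra k Ω] {a : k} (ha : a ≠ 0) {α : Ω} (hα : α ^ 2 = algebraMap k Ω a)
    (σ : Ω ≃ₐ[k] Ω) {f : Fin 2 → Ω} (hf : AlgebraicIndependent k f)
    (hgen : IntermediateField.adjoin k (insert α (Set.range f)) = ⊤)
    (hσα : σ α = -α) (hσu : σ (f 0) = (f 0)⁻¹) (hσv : σ (f 1) = -(f 1)⁻¹)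
    {x y : k} (hxy : x ^ 2 - a * y ^ 2 = -1) :
    IsRational k (IntermediateField.fixedField (Subgroup.zpowers σ)) := by
  have h2Ω : (2 : Ω) ≠ 0 := by
    simpa only [map_ofNat] using (map_ne_zero (algebraMap k Ω)).mpr h2
  have hα0 : α ≠ 0 := by
    rintro rfl
    exact ha ((algebraMap k Ω).injective (by rw [map_zero, ← hα]; ring))
  have hint : IsIntegral k α :=
    ⟨Polynomial.X ^ 2 - Polynomial.C a, Polynomial.monic_X_pow_sub_C a two_ne_zero, by simp [hα]⟩
  obtain ⟨β, hβ⟩ : ∃ β, β = algebraMap k Ω x + algebraMap k Ω y * α := ⟨_, rfl⟩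
  have hσβ : σ β = algebraMap k Ω x - algebraMap k Ω y * α := by
    rw [hβ, map_add, map_mul, AlgEquiv.commutes, AlgEquiv.commutes, hσα]
    ring
  have hββ : β * σ β = -1 := by
    have := congrArg (algebraMap k Ω) hxy
    simp only [map_sub, map_mul, map_pow, map_neg, map_one] at this
    rw [hσβ, hβ]
    linear_combination this - algebraMap k Ω y ^ 2 * hα
  have hβ0 : β ≠ 0 := by
    rintro h
    simp [h] at hββ
  have hσβ' : σ β = -β⁻¹ := by
    field_simp
    linear_combination hββ
  have hβint : IsIntegral k β := by
    rw [hβ]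
    exact isIntegral_algebraMap.add (isIntegral_algebraMap.mul hint)
  obtain ⟨u, hu⟩ : ∃ u, u = f 0 := ⟨_, rfl⟩
  obtain ⟨v, hv⟩ : ∃ v, v = f 1 := ⟨_, rfl⟩
  rw [← hu] at hσu
  rw [← hv] at hσv
  have hu0 : u ≠ 0 := hu ▸ hf.ne_zero 0
  have hv0 : v ≠ 0 := hv ▸ hf.ne_zero 1
  have hu1 : 1 + u ≠ 0 := by
    intro h
    refine hf.transcendental 0 ?_
    rw [← hu, show u = algebraMap k Ω (-1) by rw [map_neg, map_one]; linear_combination h]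
    exact isAlgebraic_algebraMap _
  have hv1 : β + v ≠ 0 := by
    intro h
    refine hf.transcendental 1 ?_
    rw [← hv, show v = -β by linear_combination h]
    exact hβint.neg.isAlgebraic
  obtain ⟨s, hs⟩ : ∃ s, s = α * (1 - u) / (1 + u) := ⟨_, rfl⟩
  obtain ⟨t, ht⟩ : ∃ t, t = α * (β - v) / (β + v) := ⟨_, rfl⟩
  have hσs : σ s = s := by
    have : 1 + u⁻¹ ≠ 0 := by
      intro h
      field_simp at h
      exact hu1 (by linear_combination h)
    rw [hs]
    simp only [map_div₀, map_mul, map_sub, map_add, map_one, hσα, hσu]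
    rw [div_eq_div_iff this hu1]
    field_simp
    ring
  have hσt : σ t = t := by
    have : -β⁻¹ + -v⁻¹ ≠ 0 := by
      intro h
      field_simp at h
      exact hv1 (by linear_combination -h)
    rw [ht]
    simp only [map_div₀, map_mul, map_sub, map_add, hσα, hσv, hσβ']
    rw [div_eq_div_iff this hv1]
    field_simp
    ring
  have hus : u = (α - s) / (α + s) := by
    have h : α + s = 2 * α / (1 + u) := by rw [hs]; field_simp; ring
    rw [h, hs]
    field_simp
    ring
  have hvt : v = β * (α - t) / (α + t) := by
    have h : α + t = 2 * α * β / (β + v) := by rw [ht]; field_simp; ring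
    rw [h, ht]
    field_simp
    ring
  let E : IntermediateField k Ω := IntermediateField.adjoin k (Set.range ![s, t])
  have hsE : s ∈ E := IntermediateField.subset_adjoin k _ ⟨0, rfl⟩
  have htE : t ∈ E := IntermediateField.subset_adjoin k _ ⟨1, rfl⟩
  have hαE : α ^ 2 = algebraMap E Ω (algebraMap k E a) := by
    rw [hα, ← IsScalarTower.algebraMap_apply]
  have hintE : IsIntegral E α := hint.tower_top
  have htop : ∀ z : Ω, z ∈ Algebra.adjoin E {α} := by
    intro z
    let M := IntermediateField.adjoin E {α}
    have hEM : ∀ e ∈ E, e ∈ M := fun e he => M.algebraMap_mem ⟨e, he⟩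
    have hαM : α ∈ M := IntermediateField.mem_adjoin_simple_self E α
    have hkM : ∀ c : k, algebraMap k Ω c ∈ M := fun c => hEM _ (E.algebraMap_mem c)
    have hβM : β ∈ M := by
      rw [hβ]
      exact add_mem (hkM x) (mul_mem (hkM y) hαM)
    have hM : (⊤ : IntermediateField k Ω) ≤ M.restrictScalars k := by
      rw [← hgen, IntermediateField.adjoin_le_iff]
      rintro w (rfl | ⟨i, rfl⟩)
      · exact hαM
      · change f i ∈ M
        fin_cases i
        · change f 0 ∈ M
          rw [← hu, hus]
          exact div_mem (sub_mem hαM (hEM s hsE)) (add_mem hαM (hEM s hsE))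
        · change f 1 ∈ M
          rw [← hv, hvt]
          exact div_mem (mul_mem hβM (sub_mem hαM (hEM t htE))) (add_mem hαM (hEM t htE))
    have hz : z ∈ M := hM (IntermediateField.mem_top (x := z))
    rwa [← IntermediateField.mem_toSubalgebra,
      IntermediateField.adjoin_simple_toSubalgebra_of_isAlgebraic hintE.isAlgebraic] at hz
  have hle : E ≤ IntermediateField.fixedField (Subgroup.zpowers σ) := by
    rw [IntermediateField.adjoin_le_iff]
    rintro _ ⟨i, rfl⟩
    rw [SetLike.mem_coe, mem_fixedField_zpowers_iff]
    fin_cases i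
    exacts [hσs, hσt]
  have hE : E = IntermediateField.fixedField (Subgroup.zpowers σ) := by
    refine le_antisymm hle fun z hz => ?_
    rw [mem_fixedField_zpowers_iff] at hz
    obtain ⟨p, q, rfl⟩ := exists_eq_add_mul_of_mem_adjoin hαE (htop z)
    have hfixE : ∀ e : E, σ (algebraMap E Ω e) = algebraMap E Ω e := fun e =>
      (mem_fixedField_zpowers_iff σ _).mp (hle e.2)
    rw [map_add, map_mul, hfixE, hfixE, hσα] at hz
    have h0 : algebraMap E Ω q * α = 0 := by
      apply mul_left_cancel₀ h2Ω
      linear_combination -hz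
    rw [h0, add_zero]
    exact p.2
  have : Algebra.IsAlgebraic E Ω := by
    refine ⟨fun z => ?_⟩
    obtain ⟨p, q, rfl⟩ := exists_eq_add_mul_of_mem_adjoin hαE (htop z)
    exact (isIntegral_algebraMap.add (isIntegral_algebraMap.mul hintE)).isAlgebraic
  have : Algebra.IsAlgebraic (Algebra.adjoin k (Set.range ![s, t])) Ω :=
    (IsFractionRing.comap_isAlgebraic_iff
      (K := IntermediateField.adjoin k (Set.range ![s, t]))).mpr this
  have hind : AlgebraicIndependent k ![s, t] :=
    (Algebra.IsAlgebraic.isTranscendenceBasis_of_lift_le_trdeg_of_finite k ![s, t]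
      hf.lift_cardinalMk_le_trdeg).1
  exact ⟨2, ⟨((hind.aevalEquivField).trans (IntermediateField.equivOfEq hE)).symm⟩⟩

/-- **Hoshi–Kang–Kitayama.** Let `k` be a field, `char k ≠ 2`, `a ∈ kˣ` a non-square,
`K = k(√a)`, and let `G = ⟨σ⟩` act on `K(u,v)` by `σ(√a) = -√a`, `σ(u) = 1/u`,
`σ(v) = -1/v`. Then `K(u,v)^G` is `k`-rational iff there is a Galois extension `L/k` with
`k ⊆ k(√a) ⊆ L` and `Gal(L/k) ≅ C₄`. -/
theorem C4_case_embedding_problem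
    (k : Type) [Field k] (hchar : ringChar k ≠ 2)
    (a : k) (ha : a ≠ 0) (hnsq : ∀ c : k, c ^ 2 ≠ a)
    (K : Type) [Field K] [Algebra k K] (α : K)
    (hα : α ^ 2 = algebraMap k K a) (hgen : Algebra.adjoin k ({α} : Set K) = ⊤)
    (σ : FractionRing (MvPolynomial (Fin 2) K) ≃ₐ[k] FractionRing (MvPolynomial (Fin 2) K))
    (hσα : σ (algebraMap K _ α) = - algebraMap K _ α)
    (hσu : σ (algebraMap (MvPolynomial (Fin 2) K) _ (X 0)) =
      (algebraMap (MvPolynomial (Fin 2) K) _ (X 0))⁻¹)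
    (hσv : σ (algebraMap (MvPolynomial (Fin 2) K) _ (X 1)) =
      - (algebraMap (MvPolynomial (Fin 2) K) _ (X 1))⁻¹) :
    IsRational k (IntermediateField.fixedField (Subgroup.zpowers σ)) ↔
      ∃ (L : Type) (_ : Field L) (_ : Algebra k L), IsGalois k L ∧ FiniteDimensional k L ∧
        Nonempty (K →ₐ[k] L) ∧
        Nonempty ((L ≃ₐ[k] L) ≃* Multiplicative (ZMod 4)) := by
  have h2 : (2 : k) ≠ 0 := Ring.two_ne_zero hchar
  have hαΩ : (algebraMap K (FractionRing (MvPolynomial (Fin 2) K)) α) ^ 2 =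
      algebraMap k _ a := by
    rw [← map_pow, hα, ← IsScalarTower.algebraMap_apply]
  have h2Ω : (2 : FractionRing (MvPolynomial (Fin 2) K)) ≠ 0 := by
    simpa only [map_ofNat] using
      (map_ne_zero (algebraMap k (FractionRing (MvPolynomial (Fin 2) K)))).mpr h2
  have hα0 : algebraMap K (FractionRing (MvPolynomial (Fin 2) K)) α ≠ 0 := by
    intro h
    rw [h, zero_pow two_ne_zero] at hαΩ
    exact ha ((map_eq_zero _).mp hαΩ.symm)
  have hv0 : algebraMap (MvPolynomial (Fin 2) K) (FractionRing (MvPolynomial (Fin 2) K)) (X 1) ≠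
      0 := by
    simp
  constructor
  · rintro ⟨n, ⟨e⟩⟩
    obtain ⟨v, hv⟩ : ∃ v, v = algebraMap (MvPolynomial (Fin 2) K)
      (FractionRing (MvPolynomial (Fin 2) K)) (X 1) := ⟨_, rfl⟩
    obtain ⟨A, hA⟩ : ∃ A, A = algebraMap K (FractionRing (MvPolynomial (Fin 2) K)) α := ⟨_, rfl⟩
    rw [← hv] at hσv hv0
    rw [← hA] at hσα hαΩ hα0
    let x : IntermediateField.fixedField (Subgroup.zpowers σ) := ⟨(v + -v⁻¹) / 2, by
      rw [mem_fixedField_zpowers_iff]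
      simp only [map_div₀, map_add, map_neg, map_inv₀, hσv, map_ofNat]
      field_simp
      ring⟩
    let y : IntermediateField.fixedField (Subgroup.zpowers σ) := ⟨(v - -v⁻¹) / (2 * A), by
      rw [mem_fixedField_zpowers_iff]
      simp only [map_div₀, map_sub, map_mul, map_neg, map_inv₀, hσv, map_ofNat, hσα]
      field_simp
      ring⟩
    have hxy : x ^ 2 - algebraMap k _ a * y ^ 2 = -1 := by
      apply Subtype.ext
      change ((v + -v⁻¹) / 2) ^ 2 - algebraMap k (FractionRing (MvPolynomial (Fin 2) K)) a *
        ((v - -v⁻¹) / (2 * A)) ^ 2 = -1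
      rw [← hαΩ]
      field_simp
      ring
    have hxy' := congrArg e hxy
    simp only [map_sub, map_mul, map_pow, map_neg, map_one, AlgEquiv.commutes] at hxy'
    obtain ⟨b, c, hbc⟩ := exists_norm_eq_neg_one_of_fractionRing hnsq hxy'
    obtain ⟨b, c, habc⟩ := exists_eq_sq_add_sq h2 hbc
    exact exists_isGalois_cyclic_four h2 hnsq habc hα hgen
  · rintro ⟨L, _, _, _, _, ⟨i⟩, ⟨e⟩⟩
    obtain ⟨b, c, hbc⟩ := exists_norm_eq_neg_one_of_isGalois h2 hnsq e (α := i α)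
      (by rw [← map_pow, hα, AlgHom.commutes])
    refine isRational_fixedField_of_norm_eq_neg_one h2 ha hαΩ σ
      (f := fun j => algebraMap (MvPolynomial (Fin 2) K) _ (X j)) ?_ ?_ hσα hσu hσv hbc
    · have hinj : Function.Injective ((IsScalarTower.toAlgHom k (MvPolynomial (Fin 2) K)
          (FractionRing (MvPolynomial (Fin 2) K))).comp
            (MvPolynomial.mapAlgHom (σ := Fin 2) (Algebra.ofId k K))) :=
        (IsFractionRing.injective (MvPolynomial (Fin 2) K)
          (FractionRing (MvPolynomial (Fin 2) K))).comp
            (MvPolynomial.map_injective _ (algebraMap k K).injective)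
      rw [algebraicIndependent_iff_injective_aeval]
      convert hinj
      ext j
      simp
    · rw [eq_top_iff]
      intro z _
      set M := IntermediateField.adjoin k (insert (algebraMap K (FractionRing
        (MvPolynomial (Fin 2) K)) α) (Set.range fun j : Fin 2 =>
          algebraMap (MvPolynomial (Fin 2) K) (FractionRing (MvPolynomial (Fin 2) K)) (X j)))
      have hK : ∀ c : K, algebraMap K (FractionRing (MvPolynomial (Fin 2) K)) c ∈ M := by
        intro c
        obtain ⟨p, q, rfl⟩ := exists_eq_add_mul_of_mem_adjoin hα (z := c) (by simp [hgen])
        rw [map_add, map_mul, ← IsScalarTower.algebraMap_apply, ← IsScalarTower.algebraMap_apply]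
        exact add_mem (M.algebraMap_mem p) (mul_mem (M.algebraMap_mem q)
          (IntermediateField.subset_adjoin k _ (Set.mem_insert _ _)))
      have hP : ∀ p : MvPolynomial (Fin 2) K,
          algebraMap _ (FractionRing (MvPolynomial (Fin 2) K)) p ∈ M := by
        intro p
        induction p using MvPolynomial.induction_on with
        | C c =>
          rw [← MvPolynomial.algebraMap_eq, ← IsScalarTower.algebraMap_apply]
          exact hK c
        | add p q hp hq =>
          rw [map_add]
          exact add_mem hp hq
        | mul_X p j hp =>
          rw [map_mul]
          exact mul_mem hp (IntermediateField.subset_adjoin k _ (Set.mem_insert_of_mem _ ⟨j, rfl⟩))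
      obtain ⟨p, q, -, rfl⟩ := IsFractionRing.div_surjective (A := MvPolynomial (Fin 2) K) z
      exact div_mem (hP p) (hP q)
end
end
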